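/- Let ℓ ≥ 2 be an integer, c, c₁ ∈ (0,1), δ > 0, K ≥ 1, and let Λ ⊆ (0,1] be compact; set θ(c,c₁) = min{c + c₁, 1/2 − 2c₁}. There exist C > 0 and ε₀ > 0 such that for every ε ∈ (0,ε₀), every λ ∈ Λ, and every interval I ⊆ [0,1] with K⁻¹·ε^c ≤ |I| ≤ K·ε^c, one has |G^{(2)}_{ℓ,I,ε}(λ) − c_I·C(ℓ)·(ζ(2) − λ)/ℓ| ≤ C·ε^{θ(c,c₁)−δ}, and the identical estimate holds with G^{(3)}_{ℓ,I,ε} in place of G^{(2)}_{ℓ,I,ε}. -/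

import Mathlib

open MeasureTheory Real Set Filter
open scoped ENNReal Pointwise

noncomputable def zeta2 : ℝ := π ^ 2 / 6

noncomputable def Cconst (l : ℕ) : ℝ :=
  ((Nat.totient l : ℝ) / l) * ∏' p : {p : ℕ // p.Prime ∧ ¬ p ∣ l}, (1 - 1 / (p.1 : ℝ) ^ 2)

def Zl (l : ℕ) : Set (ℝ × ℝ) :=
  {p | ∃ m n : ℤ, p = ((m : ℝ), (n : ℝ)) ∧ ¬ ((l : ℤ) ∣ (m - n))}

def Vseg (ε : ℝ) : Set (ℝ × ℝ) := {(0 : ℝ)} ×ˢ Set.Icc (-ε) ε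

noncomputable def qfree (l : ℕ) (ε ω : ℝ) : ℝ≥0∞ :=
  ⨅ q : {q : ℝ // 0 < q ∧ (q, q * Real.tan ω) ∈ Zl l + Vseg ε}, ENNReal.ofReal q.1

def FareyQ (Q : ℕ) : Set ℚ := {x | 0 < x ∧ x ≤ 1 ∧ x.den ≤ Q}

def FareyCong (l : ℕ) : Set ℚ := {x | 0 < x ∧ x ≤ 1 ∧ (l : ℤ) ∣ ((x.den : ℤ) - x.num)}

def ConsecFarey (Q : ℕ) (γ γ' : ℚ) : Prop :=
  γ ∈ FareyQ Q ∧ γ' ∈ FareyQ Q ∧ γ < γ' ∧ ∀ z ∈ FareyQ Q, ¬ (γ < z ∧ z < γ')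

/-- `G^{(2)}_{ℓ,I,ε}(λ)`: the measure of the set of `ω ∈ arctan I` with `q_{ℓ,ε}(ω) > λQ`
(`Q = ⌊1/ε⌋`) and `γ < tan ω < γ'` for some consecutive `γ, γ'` in `F_Q` with
`γ, γ' ∈ I` and `γ ∈ F^{(ℓ)}`. -/
noncomputable def Gmeas2 (l : ℕ) (I : Set ℝ) (ε lam : ℝ) : ℝ :=
  (volume {ω ∈ Real.arctan '' I |
    ENNReal.ofReal (lam * (⌊1 / ε⌋₊ : ℝ)) < qfree l ε ω ∧
    ∃ γ γ' : ℚ, ConsecFarey ⌊1 / ε⌋₊ γ γ' ∧ (γ : ℝ) ∈ I ∧ (γ' : ℝ) ∈ I ∧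
      γ ∈ FareyCong l ∧ (γ : ℝ) < Real.tan ω ∧ Real.tan ω < (γ' : ℝ)}).toReal

/-- `G^{(3)}_{ℓ,I,ε}(λ)`: same as `G^{(2)}_{ℓ,I,ε}(λ)` but with the condition
`γ' ∈ F^{(ℓ)}` instead of `γ ∈ F^{(ℓ)}`. -/
noncomputable def Gmeas3 (l : ℕ) (I : Set ℝ) (ε lam : ℝ) : ℝ :=
  (volume {ω ∈ Real.arctan '' I |
    ENNReal.ofReal (lam * (⌊1 / ε⌋₊ : ℝ)) < qfree l ε ω ∧
    ∃ γ γ' : ℚ, ConsecFarey ⌊1 / ε⌋₊ γ γ' ∧ (γ : ℝ) ∈ I ∧ (γ' : ℝ) ∈ I ∧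
      γ' ∈ FareyCong l ∧ (γ : ℝ) < Real.tan ω ∧ Real.tan ω < (γ' : ℝ)}).toReal

section Stepanov

open Polynomial

theorem Polynomial.natCard_degreeLT (F : Type*) [Field F] [Finite F] (n : ℕ) :
    Nat.card (Polynomial.degreeLT F n) = Nat.card F ^ n := by
  rw [Nat.card_congr (degreeLTEquiv F n).toEquiv, Nat.card_fun]
  simp

theorem Polynomial.finite_degreeLT (F : Type*) [Field F] [Finite F] (n : ℕ) :
    Finite (Polynomial.degreeLT F n) :=
  Finite.of_equiv _ (degreeLTEquiv F n).toEquiv.symm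

/-- A squarefree nonconstant polynomial times a nonzero constant is not a ratio of squares. -/
theorem Polynomial.eq_zero_of_sq_eq_mul_sq {F : Type*} [Field F] {g : F[X]} (hg : Squarefree g)
    (hdeg : 0 < g.natDegree) {κ : F} (hκ : κ ≠ 0) :
    ∀ (n : ℕ) (A D : F[X]), A.natDegree ≤ n → A ^ 2 = C κ * g * D ^ 2 → A = 0 ∧ D = 0 := by
  have hg0 : g ≠ 0 := by rintro rfl; simp at hdeg
  intro n
  induction n using Nat.strong_induction_on with
  | _ n ih =>
    intro A D hA h
    have key : A = 0 → A = 0 ∧ D = 0 := by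
      rintro rfl
      refine ⟨rfl, ?_⟩
      have : C κ * g * D ^ 2 = 0 := by rw [← h]; simp
      simpa [hκ, hg0] using this
    by_contra hne
    have hA0 : A ≠ 0 := fun h0 => hne (key h0)
    have h1 : g ∣ A := by
      rw [← hg.dvd_pow_iff_dvd two_ne_zero, h]
      exact ⟨C κ * D ^ 2, by ring⟩
    obtain ⟨A', rfl⟩ := h1
    have hA'0 : A' ≠ 0 := right_ne_zero_of_mul hA0
    have h2 : g * A' ^ 2 = C κ * D ^ 2 := by
      apply mul_left_cancel₀ hg0
      linear_combination h
    have h3 : D ^ 2 = C κ⁻¹ * g * A' ^ 2 := by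
      have : C κ⁻¹ * C κ = (1 : F[X]) := by rw [← C_mul, inv_mul_cancel₀ hκ, C_1]
      linear_combination (-C κ⁻¹) * h2 + (- D ^ 2) * this
    have h4 : g ∣ D := by
      rw [← hg.dvd_pow_iff_dvd two_ne_zero, h3]
      exact ⟨C κ⁻¹ * A' ^ 2, by ring⟩
    obtain ⟨D', rfl⟩ := h4
    have h5 : A' ^ 2 = C κ * g * D' ^ 2 := by
      apply mul_left_cancel₀ hg0
      linear_combination h2
    have hlt : A'.natDegree < n := by
      rw [natDegree_mul hg0 hA'0] at hA; omega
    exact hA'0 (ih _ hlt A' D' le_rfl h5).1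

variable {F : Type*} [Field F]

/-- The auxiliary polynomial of Stepanov's method. -/
noncomputable def stepanovAux (g : F[X]) (P W : ℕ) (A D : Fin W → F[X]) : F[X] :=
  ∑ i, (A i + D i * g ^ ((P + 1) / 2)) * X ^ (i.1 * P)

theorem stepanovAux_ne_zero {g : F[X]} {p k d e W : ℕ} [Fact p.Prime] [CharP F p] (hp : p ≠ 2)
    (hd : g.natDegree = 2 * d) (hd0 : 0 < d) (hg : Squarefree g) (h0 : g.eval 0 ≠ 0)
    (hsmall : 2 * (e + d) ≤ p ^ k) (he : 0 < e)
    {A D : Fin W → F[X]} (hA : ∀ i, (A i).natDegree < e + d) (hD : ∀ i, (D i).natDegree < e)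
    (hAD : stepanovAux g (p ^ k) W A D = 0) : ∀ i, A i = 0 ∧ D i = 0 := by
  set P := p ^ k with hP
  have hPpos : 0 < P := by omega
  have hPodd : Odd P := ((Fact.out : p.Prime).odd_of_ne_two hp).pow
  have hhalf : 2 * ((P + 1) / 2) = P + 1 := by
    obtain ⟨m, hm⟩ := hPodd; omega
  by_contra hne
  push Not at hne
  have hex : ∃ n : ℕ, ∃ h : n < W, ¬ (A ⟨n, h⟩ = 0 ∧ D ⟨n, h⟩ = 0) := by
    obtain ⟨i, hi⟩ := hne
    exact ⟨i.1, i.2, by tauto⟩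
  classical
  obtain ⟨hn, hnn⟩ := Nat.find_spec hex
  set n := Nat.find hex with hndef
  have hmin : ∀ i : Fin W, i.1 < n → A i = 0 ∧ D i = 0 := by
    intro i hi
    have := Nat.find_min hex hi
    push Not at this
    have := this i.2
    tauto
  have hdvd : (X : F[X]) ^ P ∣ A ⟨n, hn⟩ + D ⟨n, hn⟩ * g ^ ((P + 1) / 2) := by
    have h1 : (X : F[X]) ^ (n * P) * X ^ P ∣
        (A ⟨n, hn⟩ + D ⟨n, hn⟩ * g ^ ((P + 1) / 2)) * X ^ (n * P) := by
      have h2 := hAD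
      unfold stepanovAux at h2
      rw [← Finset.add_sum_erase _ _ (Finset.mem_univ (⟨n, hn⟩ : Fin W))] at h2
      rw [eq_neg_of_add_eq_zero_left h2]
      refine (Finset.dvd_sum ?_).neg_right
      intro i hi
      rcases lt_trichotomy i.1 n with hlt | heq | hgt
      · obtain ⟨h3, h4⟩ := hmin i hlt
        simp [h3, h4]
      · exact absurd (Fin.ext heq) (Finset.ne_of_mem_erase hi)
      · refine Dvd.dvd.mul_left ?_ _
        rw [← pow_add]
        apply pow_dvd_pow
        calc n * P + P = (n + 1) * P := by ring
          _ ≤ i.1 * P := Nat.mul_le_mul_right _ hgt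
    rw [mul_comm (_ + _)] at h1
    exact (mul_dvd_mul_iff_left (pow_ne_zero _ X_ne_zero)).1 h1
  set a := A ⟨n, hn⟩ with ha
  set b := D ⟨n, hn⟩ with hb
  set κ := (g.eval 0) ^ P with hκ
  have hgP : (X : F[X]) ^ P ∣ g ^ P - C κ := by
    have h1 : (X : F[X]) ∣ g - C (g.eval 0) := by
      rw [X_dvd_iff, coeff_sub, coeff_C_zero, coeff_zero_eq_eval_zero, sub_self]
    have h2 := pow_dvd_pow_of_dvd h1 P
    rwa [hP, sub_pow_char_pow, ← hP, ← C_pow] at h2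
  have hdvd2 : (X : F[X]) ^ P ∣ a ^ 2 - C κ * g * b ^ 2 := by
    have h1 : (X : F[X]) ^ P ∣ (a + b * g ^ ((P + 1) / 2)) * (a - b * g ^ ((P + 1) / 2)) :=
      hdvd.mul_right _
    have h2 : (X : F[X]) ^ P ∣ (g ^ P - C κ) * (g * b ^ 2) := hgP.mul_right _
    have h3 := dvd_add h1 h2
    have h4 : (g ^ ((P + 1) / 2)) ^ 2 = g ^ P * g := by
      rw [← pow_mul, mul_comm, hhalf, pow_succ]
    convert h3 using 1
    linear_combination b ^ 2 * h4
  have hdeg : (a ^ 2 - C κ * g * b ^ 2).natDegree < P := by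
    refine lt_of_le_of_lt (natDegree_sub_le _ _) (max_lt ?_ ?_)
    · have := hA ⟨n, hn⟩
      refine lt_of_le_of_lt natDegree_pow_le ?_
      rw [← ha] at this
      omega
    · have := hD ⟨n, hn⟩
      rw [← hb] at this
      refine lt_of_le_of_lt natDegree_mul_le ?_
      have h1 : (C κ * g).natDegree ≤ 2 * d := by
        rw [← hd]; exact natDegree_C_mul_le _ _
      have h2 : (b ^ 2).natDegree ≤ 2 * b.natDegree := natDegree_pow_le
      omega
  have hz : a ^ 2 - C κ * g * b ^ 2 = 0 := by
    by_contra hcon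
    have := natDegree_le_of_dvd hdvd2 hcon
    rw [natDegree_X_pow] at this
    omega
  exact hnn (eq_zero_of_sq_eq_mul_sq hg (by omega) (pow_ne_zero _ h0) _ a b le_rfl
    (sub_eq_zero.1 hz))

theorem exists_stepanovAux [Finite F] (g : F[X]) {p k d e W : ℕ} [Fact p.Prime]
    [CharP F p] (hd : g.natDegree = 2 * d) (he : 0 < e)
    (hP : Odd (p ^ k)) (hcount : p ^ k * (e + d - 1) + W + d < W * (2 * e + d)) :
    ∃ A D : Fin W → F[X], (∀ i, (A i).natDegree < e + d) ∧ (∀ i, (D i).natDegree < e) ∧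
      (¬ ∀ i, A i = 0 ∧ D i = 0) ∧
      ∑ i, (A i ^ p ^ k + D i ^ p ^ k * g ^ ((p ^ k + 1) / 2)) * X ^ i.1 = 0 := by
  set P := p ^ k with hPdef
  have hPpos : 0 < P := hP.pos
  have hhalf : 2 * ((P + 1) / 2) = P + 1 := by
    obtain ⟨m, hm⟩ := hP; omega
  have := fun n => finite_degreeLT F n
  have hlt_of : ∀ {n : ℕ} (_ : 0 < n) (f : degreeLT F n), (f : F[X]).natDegree < n := by
    intro n hn f
    by_cases hf : (f : F[X]) = 0
    · simpa [hf] using hn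
    · exact (natDegree_lt_iff_degree_lt hf).2 (mem_degreeLT.1 f.2)
  let T := P * (e + d - 1) + W + d
  let φ : (Fin W → degreeLT F (e + d) × degreeLT F e) → F[X] := fun f =>
    ∑ i, (((f i).1 : F[X]) ^ P + ((f i).2 : F[X]) ^ P * g ^ ((P + 1) / 2)) * X ^ i.1
  have hφ : ∀ f, φ f ∈ degreeLT F T := by
    intro f
    refine Submodule.sum_mem _ fun i _ => ?_
    rw [mem_degreeLT]
    refine lt_of_le_of_lt degree_le_natDegree ?_
    rw [Nat.cast_lt]
    have h1 := hlt_of (by omega) (f i).1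
    have h2 := hlt_of he (f i).2
    have h3 : (((f i).1 : F[X]) ^ P).natDegree ≤ P * (e + d - 1) :=
      natDegree_pow_le.trans (Nat.mul_le_mul_left _ (by omega))
    have h4 : (((f i).2 : F[X]) ^ P * g ^ ((P + 1) / 2)).natDegree ≤ P * (e + d - 1) + d := by
      refine natDegree_mul_le.trans ?_
      have h5 : (((f i).2 : F[X]) ^ P).natDegree ≤ P * (e - 1) :=
        natDegree_pow_le.trans (Nat.mul_le_mul_left _ (by omega))
      have h6 : (g ^ ((P + 1) / 2)).natDegree ≤ (P + 1) * d := by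
        refine natDegree_pow_le.trans ?_
        rw [hd]; nlinarith
      have h7 : P * (e + d - 1) = P * (e - 1) + P * d := by
        rw [← mul_add]; congr 1; omega
      rw [h7]
      linarith
    have h5 : (((f i).1 : F[X]) ^ P + ((f i).2 : F[X]) ^ P * g ^ ((P + 1) / 2)).natDegree ≤
        P * (e + d - 1) + d :=
      (natDegree_add_le _ _).trans (max_le (h3.trans (Nat.le_add_right _ _)) h4)
    have h6 := natDegree_mul_le (p := (((f i).1 : F[X]) ^ P +
      ((f i).2 : F[X]) ^ P * g ^ ((P + 1) / 2))) (q := X ^ i.1)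
    rw [natDegree_X_pow] at h6
    have := i.2
    show _ < P * (e + d - 1) + W + d
    omega
  have hninj : ¬ Function.Injective (fun f => (⟨φ f, hφ f⟩ : degreeLT F T)) := by
    intro hinj
    have hc := Nat.card_le_card_of_injective _ hinj
    rw [natCard_degreeLT, Nat.card_fun, Nat.card_prod, natCard_degreeLT, natCard_degreeLT,
      Nat.card_fin, ← pow_add, ← pow_mul] at hc
    have h1 : 1 < Nat.card F := Finite.one_lt_card
    rw [Nat.pow_le_pow_iff_right h1] at hc
    have : (e + d + e) * W = W * (2 * e + d) := by ring
    simp only [T] at hc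
    omega
  simp only [Function.Injective, not_forall] at hninj
  obtain ⟨f, f', hff, hne⟩ := hninj
  have hff : φ f = φ f' := by simpa using hff
  refine ⟨fun i => ((f i).1 - (f' i).1 : degreeLT F (e + d)),
    fun i => ((f i).2 - (f' i).2 : degreeLT F e), fun i => hlt_of (by omega) _,
    fun i => hlt_of he _, ?_, ?_⟩
  · intro hall
    apply hne
    funext i
    obtain ⟨h1, h2⟩ := hall i
    rw [ZeroMemClass.coe_eq_zero, sub_eq_zero] at h1 h2
    exact Prod.ext h1 h2
  · rw [← sub_eq_zero] at hff
    rw [← hff, ← Finset.sum_sub_distrib]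
    refine Finset.sum_congr rfl fun i _ => ?_
    simp only [AddSubgroupClass.coe_sub, hPdef, sub_pow_char_pow]
    ring

theorem card_stepanov_le [Fintype F] [DecidableEq F] {g : F[X]} {p k d : ℕ}
    [Fact p.Prime] [CharP F p] (hp : p ≠ 2) (hcard : Fintype.card F = (p ^ k) ^ 2)
    (hd : g.natDegree = 2 * d) (hd0 : 0 < d) (hg : Squarefree g) (h0 : g.eval 0 ≠ 0)
    (hlarge : 2 * d + 4 < p ^ k) :
    2 * (Finset.univ.filter fun x : F =>
      g.eval x = 0 ∨ g.eval x ^ (Fintype.card F / 2) = 1).card ≤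
      (p ^ k) ^ 2 + 4 * d * p ^ k + 2 * d := by
  have hPodd : Odd (p ^ k) := ((Fact.out : p.Prime).odd_of_ne_two hp).pow
  obtain ⟨m, hm⟩ := id hPodd
  set P := p ^ k with hP
  have hPpos : 0 < P := by omega
  obtain ⟨e, he⟩ : ∃ e, m = e + d := ⟨m - d, by omega⟩
  have he0 : 0 < e := by omega
  have hPe : P = 2 * e + 2 * d + 1 := by omega
  set W := e + 2 * d + 1 with hW
  have hcount : P * (e + d - 1) + W + d < W * (2 * e + d) := by
    obtain ⟨t, ht⟩ : ∃ t, e = t + 1 := ⟨e - 1, by omega⟩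
    have : e + d - 1 = t + d := by omega
    rw [this, hPe, hW, ht]
    nlinarith
  obtain ⟨A, D, hA, hD, hne, hsum⟩ := exists_stepanovAux g (p := p) (k := k) hd he0 hPodd hcount
  have hH : stepanovAux g P W A D ≠ 0 := fun h =>
    hne (stepanovAux_ne_zero hp hd hd0 hg h0 (by omega) he0 hA hD h)
  have hhalf : (P + 1) / 2 = m + 1 := by clear_value P; omega
  have hdegH : (stepanovAux g P W A D).natDegree ≤ e + d * (P + 1) + P * (W - 1) := by
    refine natDegree_sum_le_of_forall_le _ _ fun i _ => ?_
    refine natDegree_mul_le.trans ?_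
    rw [natDegree_X_pow]
    have h1 : i.1 * P ≤ P * (W - 1) := by
      rw [mul_comm]; exact Nat.mul_le_mul_left _ (by have := i.2; omega)
    refine add_le_add ((natDegree_add_le _ _).trans (max_le ?_ ?_)) h1
    · have := hA i; nlinarith
    · refine natDegree_mul_le.trans ?_
      have h2 : (g ^ ((P + 1) / 2)).natDegree ≤ d * (P + 1) := by
        refine natDegree_pow_le.trans ?_
        rw [hd, hhalf, hm]; apply le_of_eq; ring
      have := hD i
      omega
  have hroot : ∀ x ∈ (Finset.univ.filter fun x : F =>
      g.eval x = 0 ∨ g.eval x ^ (Fintype.card F / 2) = 1),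
      (stepanovAux g P W A D).eval x = 0 := by
    intro x hx
    have hx := (Finset.mem_filter.1 hx).2
    have hxq : x ^ (P * P) = x := by
      rw [← sq, ← hcard]; exact FiniteField.pow_card x
    have hgx : (g.eval x ^ ((P + 1) / 2)) ^ P = g.eval x ^ ((P + 1) / 2) := by
      rcases hx with hx | hx
      · rw [hx, hhalf]; simp [hPpos.ne']
      · have h1 : (P + 1) / 2 * P = (P + 1) / 2 + Fintype.card F / 2 := by
          rw [hcard, hhalf]
          have : P ^ 2 = 2 * (2 * m ^ 2 + 2 * m) + 1 := by rw [hm]; ring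
          have h3 : P ^ 2 / 2 = 2 * m ^ 2 + 2 * m := by omega
          rw [h3, hm]; ring
        rw [← pow_mul, h1, pow_add, hx, mul_one]
    have h2 := congrArg (eval x) hsum
    simp only [eval_finsetSum, eval_mul, eval_add, eval_pow, eval_X, eval_zero] at h2
    have h3 : ((stepanovAux g P W A D).eval x) ^ P = 0 := by
      rw [← h2, stepanovAux]
      simp only [eval_finsetSum, eval_mul, eval_add, eval_pow, eval_X]
      rw [hP, sum_pow_char_pow, ← hP]
      refine Finset.sum_congr rfl fun i _ => ?_
      rw [mul_pow, hP, add_pow_char_pow, ← hP, mul_pow, hgx, ← pow_mul, mul_assoc, mul_comm i.1,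
        pow_mul, hxq]
    exact pow_eq_zero_iff (hPpos.ne') |>.1 h3
  have hcardle : (Finset.univ.filter fun x : F =>
      g.eval x = 0 ∨ g.eval x ^ (Fintype.card F / 2) = 1).card ≤
      (stepanovAux g P W A D).natDegree := by
    refine (card_le_degree_of_subset_roots (Z := (Finset.univ.filter fun x : F =>
      g.eval x = 0 ∨ g.eval x ^ (Fintype.card F / 2) = 1)) ?_)
    intro x hx
    rw [mem_roots hH]
    exact hroot x hx
  have hfin : 2 * (e + d * (P + 1) + P * (W - 1)) ≤ P ^ 2 + 4 * d * P + 2 * d := by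
    have : W - 1 = e + 2 * d := by omega
    rw [this, hPe]; nlinarith
  omega

end Stepanov

section ArtinSchreier

open Polynomial

variable {F : Type*} [Field F]

/-- The discriminant polynomial of `x + b / x = y ^ p - y - c`, seen as a quadratic in `x`. -/
noncomputable def artinSchreierDisc (p : ℕ) (b c : F) : F[X] := (X ^ p - X - C c) ^ 2 - C (4 * b)

theorem natDegree_X_pow_sub_X_sub_C {p : ℕ} (hp : 2 ≤ p) (c : F) :
    (X ^ p - X - C c : F[X]).natDegree = p := by
  have : (X ^ p - X - C c : F[X]) = X ^ p - (X + C c) := by ring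
  rw [this, natDegree_sub_eq_left_of_natDegree_lt, natDegree_X_pow]
  rw [natDegree_X_pow, natDegree_X_add_C]; omega

theorem natDegree_artinSchreierDisc {p : ℕ} (hp : 2 ≤ p) (b c : F) :
    (artinSchreierDisc p b c).natDegree = 2 * p := by
  unfold artinSchreierDisc
  rw [natDegree_sub_C, natDegree_pow, natDegree_X_pow_sub_X_sub_C hp]

theorem squarefree_artinSchreierDisc {p : ℕ} [Fact p.Prime] [CharP F p] (hp : p ≠ 2) {b : F}
    (hb : b ≠ 0) (c : F) : Squarefree (artinSchreierDisc p b c) := by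
  apply Separable.squarefree
  have h2 : (2 : F) ≠ 0 := by
    intro h
    have h2 : ((2 : ℕ) : F) = 0 := by exact_mod_cast h
    rw [CharP.cast_eq_zero_iff F p] at h2
    exact hp ((Nat.prime_dvd_prime_iff_eq Fact.out Nat.prime_two).1 h2)
  have h8 : -(8 * b) ≠ 0 := by
    have : (8 : F) = 2 ^ 3 := by norm_num
    rw [this]; simp [h2, hb]
  have hder : derivative (artinSchreierDisc p b c) = -2 * (X ^ p - X - C c) := by
    unfold artinSchreierDisc
    rw [derivative_sub, derivative_C, derivative_pow]
    simp only [derivative_sub, derivative_X_pow, derivative_X, derivative_C]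
    have hC2 : (C 2 : F[X]) = 2 := by rw [C_ofNat]
    simp [CharP.cast_eq_zero, hC2]
  refine ⟨C (-(8 * b))⁻¹ * 2, C (-(8 * b))⁻¹ * (X ^ p - X - C c), ?_⟩
  rw [hder]
  have h1 : C (-(8 * b))⁻¹ * C (-(8 * b)) = (1 : F[X]) := by
    rw [← C_mul, inv_mul_cancel₀ h8, C_1]
  have h3 : C (-(8 * b)) = -8 * C b := by rw [C_neg, C_mul, C_ofNat, neg_mul]
  have h4 : C (4 * b) = 4 * C b := by rw [C_mul, C_ofNat]
  unfold artinSchreierDisc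
  rw [h4]
  rw [h3] at h1
  linear_combination h1

variable [Fintype F] [DecidableEq F]

/-- Points of `x + b / x = y ^ p - y - c` with `x ≠ 0`. -/
def artinSchreierPoints (p : ℕ) (b c : F) : Finset (Fˣ × F) :=
  Finset.univ.filter fun z => z.2 ^ p - z.2 - (z.1 + b * (z.1⁻¹ : Fˣ)) = c

theorem card_units_add_eq_le (b t : F) :
    (Finset.univ.filter fun u : Fˣ => (u : F) + b * (u⁻¹ : Fˣ) = t).card ≤ 2 := by
  set f : F[X] := X ^ 2 - C t * X + C b with hf
  have hdeg : f.natDegree = 2 := by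
    rw [hf]; compute_degree!
  have hf0 : f ≠ 0 := by
    intro h; rw [h] at hdeg; simp at hdeg
  have h1 : ((Finset.univ.filter fun u : Fˣ => (u : F) + b * (u⁻¹ : Fˣ) = t).image
      (fun u : Fˣ => (u : F))).card ≤ f.natDegree := by
    apply card_le_degree_of_subset_roots
    intro x hx
    rw [Finset.mem_val, Finset.mem_image] at hx
    obtain ⟨u, hu, rfl⟩ := hx
    have hu := (Finset.mem_filter.1 hu).2
    rw [mem_roots hf0, IsRoot, hf]
    simp only [eval_add, eval_sub, eval_pow, eval_X, eval_mul, eval_C]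
    have h2 : (u : F) * (u⁻¹ : Fˣ) = 1 := u.mul_inv
    rw [← hu]
    linear_combination (-b) * h2
  rw [Finset.card_image_of_injective _ Units.val_injective, hdeg] at h1
  exact h1

theorem card_artinSchreierPoints_le_of_subset (p : ℕ) (b c : F) (s : Finset F)
    (hs : ∀ z ∈ artinSchreierPoints p b c, z.2 ∈ s) :
    (artinSchreierPoints p b c).card ≤ 2 * s.card := by
  refine Finset.card_le_mul_card_image_of_maps_to (f := Prod.snd) hs 2 ?_
  intro y _
  refine le_trans ?_ (card_units_add_eq_le b (y ^ p - y - c))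
  refine Finset.card_le_card_of_injOn Prod.fst ?_ ?_
  · rintro ⟨u, y'⟩ h
    simp only [artinSchreierPoints, Finset.coe_filter, Finset.mem_filter, Finset.mem_univ,
      true_and, Set.mem_ofPred_eq] at h ⊢
    obtain ⟨h1, rfl⟩ := h
    rw [← h1]; ring
  · rintro ⟨u, y₁⟩ h ⟨u', y₂⟩ h' huu
    simp only [Finset.coe_filter, Set.mem_ofPred_eq] at h h'
    exact Prod.ext huu (h.2.trans h'.2.symm)

theorem card_artinSchreierPoints_le {p k : ℕ} [Fact p.Prime] [CharP F p] (hp : p ≠ 2)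
    (hcard : Fintype.card F = (p ^ k) ^ 2) {b c : F} (hb : b ≠ 0) (hc : c ^ 2 - 4 * b ≠ 0)
    (hlarge : 2 * p + 4 < p ^ k) :
    (artinSchreierPoints p b c).card ≤ (p ^ k) ^ 2 + 4 * p * p ^ k + 2 * p := by
  have hp2 : 2 ≤ p := (Fact.out : p.Prime).two_le
  refine le_trans (card_artinSchreierPoints_le_of_subset p b c _ ?_)
    (card_stepanov_le hp hcard (natDegree_artinSchreierDisc hp2 b c) (by omega)
      (squarefree_artinSchreierDisc hp hb c) ?_ hlarge)
  · rintro ⟨u, y⟩ h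
    simp only [artinSchreierPoints, Finset.mem_filter, Finset.mem_univ, true_and] at h ⊢
    have hev : (artinSchreierDisc p b c).eval y = ((u : F) - b * (u⁻¹ : Fˣ)) ^ 2 := by
      unfold artinSchreierDisc
      simp only [eval_sub, eval_pow, eval_X, eval_C]
      have h2 : (u : F) * (u⁻¹ : Fˣ) = 1 := u.mul_inv
      have h3 : y ^ p - y - c = u + b * (u⁻¹ : Fˣ) := by rw [← h]; ring
      rw [h3]
      linear_combination 4 * b * h2
    rw [hev]
    by_cases h0 : ((u : F) - b * (u⁻¹ : Fˣ)) = 0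
    · left; rw [h0]; simp
    · right
      rw [← FiniteField.isSquare_iff (by rw [ringChar.eq F p]; exact hp) (pow_ne_zero 2 h0)]
      exact ⟨_, sq _⟩
  · have : (0 : F) ^ p = 0 := zero_pow (by omega)
    simp [artinSchreierDisc, this, hc]

theorem norm_sum_kloosterman_le_of_card {p k : ℕ} [Fact p.Prime] [CharP F p] (hp : p ≠ 2)
    (hcard : Fintype.card F = (p ^ k) ^ 2) {b : F} (hb : b ≠ 0)
    (hlarge : 2 * p + 4 < p ^ k) (ψ : AddChar F ℂ) (hψ : ψ ≠ 1) (hfrob : ∀ y, ψ (y ^ p) = ψ y) :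
    ‖∑ u : Fˣ, ψ (u + b * (u⁻¹ : Fˣ))‖ ≤ 4 * p * p ^ k + 2 * p + 9 := by
  set q := Fintype.card F with hq
  have hq0 : (0 : ℝ) < q := by exact_mod_cast Fintype.card_pos
  set S := ∑ u : Fˣ, ψ (u + b * (u⁻¹ : Fˣ)) with hS
  let N : F → ℕ := fun c => (artinSchreierPoints p b c).card
  set B : ℝ := (p ^ k : ℝ) ^ 2 + 4 * p * p ^ k + 2 * p with hB
  have hqR : (q : ℝ) = (p ^ k : ℝ) ^ 2 := by rw [hcard]; push_cast; rfl
  let cc : Fˣ × F → F := fun z => z.2 ^ p - z.2 - (z.1 + b * (z.1⁻¹ : Fˣ))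
  have hNtot : ∑ c, (N c : ℝ) = (q - 1) * q := by
    have h1 := Finset.card_eq_sum_card_fiberwise (f := cc) (s := Finset.univ) (t := Finset.univ)
      (by simp)
    have h2 : (Finset.univ : Finset (Fˣ × F)).card = (q - 1) * q := by
      rw [Finset.card_univ, Fintype.card_prod, Fintype.card_units]
    have h3 : 1 ≤ q := Fintype.card_pos
    rw [h2] at h1
    have h4 := congrArg (Nat.cast : ℕ → ℝ) h1
    rw [Nat.cast_mul, Nat.cast_sub h3, Nat.cast_sum] at h4
    rw [← Nat.cast_one, h4]
    rfl
  have hsum : ∑ c, (N c : ℂ) * ψ (-c) = q * S := by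
    have h1 : ∑ z : Fˣ × F, ψ (-(cc z)) = q * S := by
      rw [Fintype.sum_prod_type, hS, Finset.mul_sum]
      refine Finset.sum_congr rfl fun u _ => ?_
      have : ∀ y : F, ψ (-(cc (u, y))) = ψ (u + b * (u⁻¹ : Fˣ)) := by
        intro y
        have h2 : -(cc (u, y)) = (u + b * (u⁻¹ : Fˣ)) + (y - y ^ p) := by simp only [cc]; ring
        rw [h2, AddChar.map_add_eq_mul, AddChar.map_sub_eq_div, hfrob,
          div_self (by rw [← norm_ne_zero_iff, AddChar.norm_apply]; exact one_ne_zero), mul_one]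
      simp [this, hq]
    rw [← h1, ← Finset.sum_fiberwise Finset.univ cc]
    refine Finset.sum_congr rfl fun c _ => ?_
    rw [Finset.sum_congr rfl (g := fun _ => ψ (-c))
      (fun z hz => by rw [(Finset.mem_filter.1 hz).2])]
    simp [N, artinSchreierPoints, cc]
  have hsum0 : ∑ c, ψ (-c) = 0 := by
    have h1 := Equiv.sum_comp (Equiv.neg F) fun c => ψ c
    simp only [Equiv.neg_apply] at h1
    rw [h1]
    exact AddChar.sum_eq_zero_of_ne_one hψ
  have hsum' : ∑ c, ((N c : ℂ) - B) * ψ (-c) = q * S := by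
    simp only [sub_mul, Finset.sum_sub_distrib, ← Finset.mul_sum, hsum0, hsum, mul_zero, sub_zero]
  have hbad : (Finset.univ.filter fun c : F => c ^ 2 - 4 * b = 0).card ≤ 2 := by
    have hdeg : (X ^ 2 - C (4 * b) : F[X]).natDegree = 2 := by compute_degree!
    refine le_trans ?_ hdeg.le
    apply card_le_degree_of_subset_roots
    intro x hx
    rw [mem_roots (by intro h; rw [h] at hdeg; simp at hdeg)]
    simpa using hx
  have hterm : ∀ c, |(N c : ℝ) - B| ≤
      (B - N c) + (if c ^ 2 - 4 * b = 0 then 4 * (q : ℝ) else 0) := by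
    intro c
    split_ifs with h
    · have h1 : (N c : ℝ) ≤ 2 * q := by
        exact_mod_cast card_artinSchreierPoints_le_of_subset p b c Finset.univ (by simp)
      have : 0 ≤ B := by positivity
      rw [abs_le]; constructor <;> linarith
    · have h1 : (N c : ℝ) ≤ B := by
        rw [hB]; exact_mod_cast card_artinSchreierPoints_le hp hcard hb h hlarge
      rw [abs_of_nonpos (by linarith)]; linarith
  have hfinal : q * ‖S‖ ≤ q * (4 * p * p ^ k + 2 * p + 9) := by
    calc q * ‖S‖ = ‖∑ c, ((N c : ℂ) - B) * ψ (-c)‖ := by rw [hsum']; simp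
      _ ≤ ∑ c, ‖((N c : ℂ) - B) * ψ (-c)‖ := norm_sum_le _ _
      _ = ∑ c, |(N c : ℝ) - B| := by
        refine Finset.sum_congr rfl fun c _ => ?_
        rw [norm_mul, AddChar.norm_apply, mul_one]
        have : ((N c : ℂ) - B) = ((N c - B : ℝ) : ℂ) := by push_cast; rfl
        rw [this, Complex.norm_real, Real.norm_eq_abs]
      _ ≤ ∑ c, ((B - N c) + (if c ^ 2 - 4 * b = 0 then 4 * (q : ℝ) else 0)) :=
        Finset.sum_le_sum fun c _ => hterm c
      _ = q * B - (q - 1) * q +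
          (Finset.univ.filter fun c : F => c ^ 2 - 4 * b = 0).card * (4 * q) := by
        rw [Finset.sum_add_distrib, Finset.sum_sub_distrib, hNtot, ← Finset.sum_filter]
        simp [hq]
      _ ≤ q * B - (q - 1) * q + 2 * (4 * q) := by
        gcongr
        exact_mod_cast hbad
      _ = q * (4 * p * p ^ k + 2 * p + 9) := by rw [hB, hqR]; ring
  exact le_of_mul_le_mul_left hfinal hq0

end ArtinSchreier

section InverseTrace

open Polynomial

theorem Matrix.charpoly_coeff_one_eq_of_isUnit {R n : Type*} [CommRing R]
    [DecidableEq n] [Fintype n]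
    (A : Matrix n n R) (hA : IsUnit A) :
    A.charpoly.coeff 1 = - (A⁻¹).trace * A.charpoly.coeff 0 := by
  have h1 : IsUnit A⁻¹ := (Matrix.isUnit_nonsing_inv_iff).2 hA
  have h2 := Matrix.charpoly_inv A⁻¹ h1
  rw [Matrix.nonsing_inv_nonsing_inv _ ((Matrix.isUnit_iff_isUnit_det A).1 hA)] at h2
  have h3 : ((-1) ^ Fintype.card n * C (Ring.inverse (A⁻¹).det) : R[X]) =
      C ((-1) ^ Fintype.card n * (Ring.inverse (A⁻¹).det)) := by simp
  have h4 : (A⁻¹).charpolyRev.coeff 0 = 1 := by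
    rw [coeff_zero_eq_eval_zero]; exact Matrix.eval_charpolyRev
  rw [h2, h3, coeff_C_mul, coeff_C_mul, h4, Matrix.coeff_charpolyRev_eq_neg_trace]
  ring

variable {K L : Type*} [Field K] [Field L] [Algebra K L] [FiniteDimensional K L]

theorem trace_inv_mul_minpoly_coeff_zero {x : L} (hx : x ≠ 0) :
    Algebra.trace K L x⁻¹ * (minpoly K x).coeff 0 =
      - (Module.finrank (IntermediateField.adjoin K {x}) L : K) * (minpoly K x).coeff 1 := by
  have hi : IsIntegral K x := Algebra.IsIntegral.isIntegral x
  set pb := IntermediateField.adjoin.powerBasis hi with hpb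
  set g := IntermediateField.AdjoinSimple.gen K x with hg
  have hgx : algebraMap (IntermediateField.adjoin K {x}) L g = x :=
    IntermediateField.AdjoinSimple.algebraMap_gen K x
  have hg0 : g ≠ 0 := by
    intro h; rw [h, map_zero] at hgx; exact hx hgx.symm
  have hpg : pb.gen = g := IntermediateField.adjoin.powerBasis_gen hi
  set A := Algebra.leftMulMatrix pb.basis g with hA
  set B := Algebra.leftMulMatrix pb.basis g⁻¹ with hB
  have hAB : A * B = 1 := by rw [hA, hB, ← map_mul, mul_inv_cancel₀ hg0, map_one]
  have hAu : IsUnit A := by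
    rw [Matrix.isUnit_iff_isUnit_det]
    exact Matrix.isUnit_det_of_right_inverse hAB
  have hBi : A⁻¹ = B := Matrix.inv_eq_right_inv hAB
  have hcp : A.charpoly = minpoly K x := by
    have := charpoly_leftMulMatrix pb
    rw [hpg] at this
    rw [hA, this, hg, IntermediateField.minpoly_gen]
  have h1 := Matrix.charpoly_coeff_one_eq_of_isUnit A hAu
  rw [hBi, hcp] at h1
  have h2 : Algebra.trace K (IntermediateField.adjoin K {x}) g⁻¹ = B.trace :=
    Algebra.trace_eq_matrix_trace pb.basis _
  have h3 : Algebra.trace K L x⁻¹ =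
      (Module.finrank (IntermediateField.adjoin K {x}) L : K) * B.trace := by
    have h4 : x⁻¹ = algebraMap (IntermediateField.adjoin K {x}) L g⁻¹ := by rw [map_inv₀, hgx]
    rw [← Algebra.trace_trace (S := IntermediateField.adjoin K {x}), h4,
      Algebra.trace_algebraMap, map_nsmul, h2, nsmul_eq_mul]
  rw [h3, h1]; ring

end InverseTrace

section KloostermanWeight

open Polynomial

variable {K : Type*} [Field K]

open Classical in
/-- The completely multiplicative weight on monic polynomials attached to a Kloosterman sum. -/
noncomputable def kloostermanWeight (ψ : AddChar K ℂ) (b : K) (h : K[X]) : ℂ :=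
  if h.coeff 0 = 0 then 0 else ψ (-(h.nextCoeff + b * (h.coeff 1 / h.coeff 0)))

theorem kloostermanWeight_mul (ψ : AddChar K ℂ) (b : K) {f g : K[X]} (hf : f.Monic)
    (hg : g.Monic) :
    kloostermanWeight ψ b (f * g) = kloostermanWeight ψ b f * kloostermanWeight ψ b g := by
  unfold kloostermanWeight
  by_cases h1 : f.coeff 0 = 0
  · simp [h1]
  by_cases h2 : g.coeff 0 = 0
  · simp [h2]
  rw [if_neg (by simp [h1, h2]), if_neg h1, if_neg h2, ← AddChar.map_add_eq_mul,
    hf.nextCoeff_mul hg, mul_coeff_one, mul_coeff_zero]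
  congr 1
  field_simp
  ring

theorem kloostermanWeight_one (ψ : AddChar K ℂ) (b : K) : kloostermanWeight ψ b 1 = 1 := by
  unfold kloostermanWeight
  rw [if_neg (by simp), ← C_1, nextCoeff_C_eq_zero, coeff_C]
  simp

theorem kloostermanWeight_pow (ψ : AddChar K ℂ) (b : K) {f : K[X]} (hf : f.Monic) (n : ℕ) :
    kloostermanWeight ψ b (f ^ n) = kloostermanWeight ψ b f ^ n := by
  induction n with
  | zero => simp [kloostermanWeight_one]
  | succ n ih => rw [pow_succ, kloostermanWeight_mul ψ b (hf.pow n) hf, ih, pow_succ]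

/-- The characteristic polynomial of an element of a finite extension. -/
noncomputable def minpolyPow (K : Type*) {L : Type*} [Field K] [Field L] [Algebra K L] (x : L) :
    K[X] := minpoly K x ^ Module.finrank (IntermediateField.adjoin K {x}) L

variable {L : Type*} [Field L] [Algebra K L] [FiniteDimensional K L]

theorem monic_minpolyPow (x : L) : (minpolyPow K x).Monic :=
  (minpoly.monic (Algebra.IsIntegral.isIntegral x)).pow _

theorem natDegree_minpolyPow (x : L) : (minpolyPow K x).natDegree = Module.finrank K L := by
  unfold minpolyPow
  rw [(minpoly.monic (Algebra.IsIntegral.isIntegral x)).natDegree_pow, 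
    ← IntermediateField.adjoin.finrank (Algebra.IsIntegral.isIntegral x), mul_comm,
    Module.finrank_mul_finrank]

theorem kloostermanWeight_minpolyPow_zero (ψ : AddChar K ℂ) (b : K) :
    kloostermanWeight ψ b (minpolyPow K (0 : L)) = 0 := by
  have : Module.finrank (IntermediateField.adjoin K {(0 : L)}) L ≠ 0 := Module.finrank_pos.ne'
  rw [kloostermanWeight, if_pos]
  simp [minpolyPow, minpoly.zero, coeff_X_pow, this.symm]

theorem kloostermanWeight_minpolyPow (ψ : AddChar K ℂ) (b : K) {x : L} (hx : x ≠ 0) :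
    kloostermanWeight ψ b (minpolyPow K x) =
      ψ (Algebra.trace K L (x + algebraMap K L b * x⁻¹)) := by
  have hi : IsIntegral K x := Algebra.IsIntegral.isIntegral x
  have h0 : (minpoly K x).coeff 0 ≠ 0 := minpoly.coeff_zero_ne_zero hi hx
  unfold minpolyPow
  rw [kloostermanWeight_pow _ _ (minpoly.monic hi), kloostermanWeight, if_neg h0,
    ← AddChar.map_nsmul_eq_pow]
  congr 1
  rw [map_add, ← Algebra.smul_def, map_smul, trace_eq_finrank_mul_minpoly_nextCoeff, smul_eq_mul,
    nsmul_eq_mul]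
  have h := trace_inv_mul_minpoly_coeff_zero (K := K) hx
  rw [← eq_div_iff h0] at h
  rw [h]; ring

end KloostermanWeight

section NewtonIdentity

open Polynomial

variable {p : ℕ} [Fact p.Prime]

theorem card_minpoly_eq_natDegree {k : ℕ} (hk : k ≠ 0) [Fintype (GaloisField p k)]
    [DecidableEq (ZMod p)[X]] {P : (ZMod p)[X]}
    (hP : Irreducible P) (hm : P.Monic) (hd : P.natDegree ∣ k) :
    (Finset.univ.filter fun x : GaloisField p k => minpoly (ZMod p) x = P).card = P.natDegree := by
  classical
  have hs : P.Separable := PerfectField.separable_of_irreducible hP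
  have hdvd := hP.natDegree_dvd_iff_dvd_X_pow_card_pow_sub_X.1 hd
  have hc : Fintype.card (GaloisField p k) = p ^ k := by
    rw [← Nat.card_eq_fintype_card, GaloisField.card p k hk]
  have hsp : (map (algebraMap (ZMod p) (GaloisField p k)) P).Splits := by
    have h1 := FiniteField.splits_X_pow_card_sub_X p (K := GaloisField p k)
    rw [hc] at h1
    rw [Nat.card_zmod] at hdvd
    refine h1.of_dvd ?_ (Polynomial.map_dvd _ hdvd)
    rw [Polynomial.map_ne_zero_iff (algebraMap (ZMod p) (GaloisField p k)).injective]
    exact FiniteField.X_pow_card_pow_sub_X_ne_zero _ hk (Fact.out : p.Prime).one_lt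
  rw [← card_rootSet_eq_natDegree (K := GaloisField p k) hs hsp, ← Set.toFinset_card]
  congr 1
  ext x
  rw [Finset.mem_filter, Set.mem_toFinset, mem_rootSet]
  constructor
  · rintro ⟨-, h⟩
    exact ⟨hP.ne_zero, by rw [← h]; exact minpoly.aeval _ _⟩
  · rintro ⟨-, h⟩
    exact ⟨Finset.mem_univ _, (minpoly.eq_of_irreducible_of_monic hP h hm).symm⟩

noncomputable instance fintypeGaloisField (k : ℕ) : Fintype (GaloisField p k) := Fintype.ofFinite _

open Classical in
/-- Number of elements of the degree `k` extension whose characteristic polynomial divides `h`. -/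
noncomputable def cardMinpolyPowDvd (p : ℕ) [Fact p.Prime] (k : ℕ) (h : (ZMod p)[X]) : ℕ :=
  (Finset.univ.filter fun x : GaloisField p k => minpolyPow (ZMod p) x ∣ h).card

theorem natDegree_minpolyPow_galoisField {k : ℕ} (hk : k ≠ 0) (x : GaloisField p k) :
    (minpolyPow (ZMod p) x).natDegree = k := by
  rw [natDegree_minpolyPow, GaloisField.finrank p hk]

open Classical in
theorem cardMinpolyPowDvd_mul {k : ℕ} (hk : k ≠ 0) {P h : (ZMod p)[X]} (hP : Irreducible P)
    (hm : P.Monic) (hh : h ≠ 0) :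
    cardMinpolyPowDvd p k (P * h) = cardMinpolyPowDvd p k h +
      if k = (multiplicity P h + 1) * P.natDegree then P.natDegree else 0 := by
  have hfin : FiniteMultiplicity P h :=
    finiteMultiplicity_of_degree_pos_of_monic hP.degree_pos hm hh
  have hsub : (Finset.univ.filter fun x : GaloisField p k => minpolyPow (ZMod p) x ∣ P * h) =
      (Finset.univ.filter fun x : GaloisField p k => minpolyPow (ZMod p) x ∣ h) ∪
      (Finset.univ.filter fun x : GaloisField p k => minpoly (ZMod p) x = P ∧
        k = (multiplicity P h + 1) * P.natDegree) := by
    ext x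
    have hi : IsIntegral (ZMod p) x := Algebra.IsIntegral.isIntegral x
    have hir : Irreducible (minpoly (ZMod p) x) := minpoly.irreducible hi
    have hmo : (minpoly (ZMod p) x).Monic := minpoly.monic hi
    have hd := natDegree_minpolyPow_galoisField hk x
    have hj : Module.finrank (IntermediateField.adjoin (ZMod p) {x}) (GaloisField p k) ≠ 0 :=
      Module.finrank_pos.ne'
    simp only [Finset.mem_union, Finset.mem_filter, Finset.mem_univ, true_and]
    unfold minpolyPow at hd ⊢
    obtain ⟨j, hj'⟩ := Nat.exists_eq_succ_of_ne_zero hj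
    rw [hj'] at hd ⊢
    rw [hmo.natDegree_pow] at hd
    by_cases hR : minpoly (ZMod p) x = P
    · rw [hR] at hd ⊢
      have hPd : 0 < P.natDegree := hP.natDegree_pos
      rw [pow_succ', mul_dvd_mul_iff_left hP.ne_zero, ← pow_succ', 
        hfin.pow_dvd_iff_le_multiplicity, hfin.pow_dvd_iff_le_multiplicity]
      simp only [true_and]
      constructor
      · intro h1
        by_cases h2 : j.succ ≤ multiplicity P h
        · left; exact h2
        · right; rw [← hd]; congr 1; omega
      · rintro (h1 | h1)
        · omega
        · rw [← hd] at h1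
          have := Nat.eq_of_mul_eq_mul_right hPd h1
          omega
    · have hcop : IsCoprime (minpoly (ZMod p) x ^ j.succ) P := by
        apply IsCoprime.pow_left
        rcases (EuclideanDomain.dvd_or_coprime _ P hir).symm with h | h
        · exact h
        · exact absurd (eq_of_monic_of_associated hmo hm (hir.associated_of_dvd hP h)) hR
      simp only [hR, false_and, or_false]
      exact ⟨fun h => hcop.dvd_of_dvd_mul_left h, fun h => h.mul_left _⟩
  have hdis : Disjoint
      (Finset.univ.filter fun x : GaloisField p k => minpolyPow (ZMod p) x ∣ h)
      (Finset.univ.filter fun x : GaloisField p k => minpoly (ZMod p) x = P ∧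
        k = (multiplicity P h + 1) * P.natDegree) := by
    rw [Finset.disjoint_filter]
    rintro x - h1 ⟨h2, h3⟩
    have hd := natDegree_minpolyPow_galoisField hk x
    unfold minpolyPow at hd h1
    have hPd : 0 < P.natDegree := hP.natDegree_pos
    rw [h2] at hd h1
    rw [hm.natDegree_pow] at hd
    rw [hfin.pow_dvd_iff_le_multiplicity] at h1
    have := Nat.eq_of_mul_eq_mul_right hPd (hd.trans h3)
    omega
  unfold cardMinpolyPowDvd
  rw [hsub, Finset.card_union_of_disjoint hdis]
  congr 1
  split_ifs with h1
  · refine Eq.trans ?_ (card_minpoly_eq_natDegree hk hP hm (Dvd.intro_left _ h1.symm))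
    congr 1
    ext x
    rw [Finset.mem_filter, Finset.mem_filter]
    exact ⟨fun h => ⟨h.1, h.2.1⟩, fun h => ⟨h.1, h.2, h1⟩⟩
  · simp [h1]

theorem sum_cardMinpolyPowDvd {N : ℕ} {h : (ZMod p)[X]} (hm : h.Monic) (hN : h.natDegree ≤ N) :
    ∑ k ∈ Finset.Icc 1 N, cardMinpolyPowDvd p k h = h.natDegree := by
  classical
  suffices H : ∀ n : ℕ, ∀ h : (ZMod p)[X], h.Monic → h.natDegree = n → n ≤ N →
      ∑ k ∈ Finset.Icc 1 N, cardMinpolyPowDvd p k h = n from H _ h hm rfl hN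
  intro n
  induction n using Nat.strong_induction_on with
  | _ n ih =>
  intro h hm hn hnN
  rcases Nat.eq_zero_or_pos n with h0 | h0
  · have h1 : h = 1 := by
      apply eq_one_of_monic_natDegree_zero hm; omega
    rw [h0]
    apply Finset.sum_eq_zero
    intro k hk
    rw [Finset.mem_Icc] at hk
    unfold cardMinpolyPowDvd
    rw [Finset.card_eq_zero, Finset.filter_eq_empty_iff]
    intro x _ hx
    have hd := natDegree_minpolyPow_galoisField (p := p) (k := k) (by omega) x
    have := natDegree_le_of_dvd hx hm.ne_zero
    rw [h1] at this
    simp at this; omega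
  · have hnu : ¬ IsUnit h := by
      intro hu
      have := natDegree_eq_zero_of_isUnit hu
      omega
    obtain ⟨P, hPm, hP, g, rfl⟩ := exists_monic_irreducible_factor h hnu
    have hg : g.Monic := hPm.of_mul_monic_left hm
    have hPd : 0 < P.natDegree := hP.natDegree_pos
    have hdeg : P.natDegree + g.natDegree = n := by rw [← hn, hPm.natDegree_mul hg]
    have ih1 := ih g.natDegree (by omega) g hg rfl (by omega)
    rw [Finset.sum_congr rfl (fun k hk => cardMinpolyPowDvd_mul
      (by rw [Finset.mem_Icc] at hk; omega) hP hPm hg.ne_zero), Finset.sum_add_distrib, ih1,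
      Finset.sum_ite_eq', if_pos, ← hdeg, add_comm]
    rw [Finset.mem_Icc]
    have h1 : P ^ multiplicity P g ∣ g := pow_multiplicity_dvd P g
    have h2 := natDegree_le_of_dvd h1 hg.ne_zero
    rw [hPm.natDegree_pow] at h2
    constructor
    · nlinarith
    · rw [add_mul, one_mul]; omega

theorem finite_monic_natDegree {K : Type*} [Field K] [Finite K] (n : ℕ) :
    {h : K[X] | h.Monic ∧ h.natDegree = n}.Finite := by
  have := Polynomial.finite_degreeLT K (n + 1)
  refine Set.Finite.subset (s := (degreeLT K (n+1) : Set K[X])) ?_ ?_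
  · exact Set.toFinite _
  · rintro h ⟨-, h2⟩
    simp only [SetLike.mem_coe, mem_degreeLT]
    exact lt_of_le_of_lt degree_le_natDegree (by rw [h2]; exact_mod_cast Nat.lt_succ_self n)

/-- The finite set of monic polynomials of given degree over a finite field. -/
noncomputable def monicOfDegree (K : Type*) [Field K] [Finite K] (n : ℕ) : Finset K[X] :=
  (finite_monic_natDegree (K := K) n).toFinset

theorem mem_monicOfDegree {K : Type*} [Field K] [Finite K] {n : ℕ} {h : K[X]} :
    h ∈ monicOfDegree K n ↔ h.Monic ∧ h.natDegree = n := by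
  simp [monicOfDegree]

open Classical in
theorem sum_kloostermanWeight_dvd {K : Type*} [Field K] [Finite K] (ψ : AddChar K ℂ) (b : K)
    {g : K[X]} (hg : g.Monic) {N : ℕ} (hN : g.natDegree ≤ N) :
    ∑ h ∈ (monicOfDegree K N).filter (g ∣ ·), kloostermanWeight ψ b h =
      kloostermanWeight ψ b g *
        ∑ h ∈ monicOfDegree K (N - g.natDegree), kloostermanWeight ψ b h := by
  rw [Finset.mul_sum]
  symm
  refine Finset.sum_bij (fun h _ => g * h) ?_ ?_ ?_ ?_
  · intro h hh
    rw [mem_monicOfDegree] at hh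
    rw [Finset.mem_filter, mem_monicOfDegree]
    refine ⟨⟨hg.mul hh.1, ?_⟩, dvd_mul_right _ _⟩
    rw [hg.natDegree_mul hh.1, hh.2]; omega
  · intro h _ h' _ he
    exact mul_left_cancel₀ hg.ne_zero he
  · intro h hh
    rw [Finset.mem_filter, mem_monicOfDegree] at hh
    obtain ⟨⟨h1, h2⟩, f, rfl⟩ := hh
    have hf : f.Monic := hg.of_mul_monic_left h1
    refine ⟨f, ?_, rfl⟩
    rw [mem_monicOfDegree]
    refine ⟨hf, ?_⟩
    rw [hg.natDegree_mul hf] at h2; omega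
  · intro h hh
    rw [mem_monicOfDegree] at hh
    rw [kloostermanWeight_mul ψ b hg hh.1]

/-- The Kloosterman sum over the degree `k` extension of the prime field. -/
noncomputable def kloostermanExt (ψ : AddChar (ZMod p) ℂ) (b : ZMod p) (k : ℕ) : ℂ :=
  ∑ x : GaloisField p k, kloostermanWeight ψ b (minpolyPow (ZMod p) x)

theorem newton_kloosterman (ψ : AddChar (ZMod p) ℂ) (b : ZMod p) (N : ℕ) :
    (N : ℂ) * ∑ h ∈ monicOfDegree (ZMod p) N, kloostermanWeight ψ b h =
      ∑ k ∈ Finset.Icc 1 N, kloostermanExt ψ b k *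
        ∑ h ∈ monicOfDegree (ZMod p) (N - k), kloostermanWeight ψ b h := by
  classical
  have h1 : ∀ h ∈ monicOfDegree (ZMod p) N, (N : ℂ) * kloostermanWeight ψ b h =
      ∑ k ∈ Finset.Icc 1 N, ∑ x : GaloisField p k,
        if minpolyPow (ZMod p) x ∣ h then kloostermanWeight ψ b h else 0 := by
    intro h hh
    rw [mem_monicOfDegree] at hh
    have := sum_cardMinpolyPowDvd (N := N) hh.1 hh.2.le
    rw [hh.2] at this
    conv_lhs => rw [← this]
    rw [Nat.cast_sum, Finset.sum_mul]
    refine Finset.sum_congr rfl fun k _ => ?_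
    unfold cardMinpolyPowDvd
    rw [← Finset.sum_filter, Finset.sum_const, nsmul_eq_mul]
  rw [Finset.mul_sum, Finset.sum_congr rfl h1, Finset.sum_comm]
  refine Finset.sum_congr rfl fun k hk => ?_
  rw [Finset.mem_Icc] at hk
  rw [Finset.sum_comm]
  unfold kloostermanExt
  rw [Finset.sum_mul]
  refine Finset.sum_congr rfl fun x _ => ?_
  have hd := natDegree_minpolyPow_galoisField (p := p) (k := k) (by omega) x
  rw [← Finset.sum_filter, sum_kloostermanWeight_dvd ψ b (monic_minpolyPow x) (by omega), hd]

end NewtonIdentity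

section LFunctionCoefficients

open Polynomial

variable {K : Type*} [Field K] [Finite K]

theorem sum_monicOfDegree_zero (ψ : AddChar K ℂ) (b : K) :
    ∑ h ∈ monicOfDegree K 0, kloostermanWeight ψ b h = 1 := by
  have : monicOfDegree K 0 = {1} := by
    ext h
    rw [mem_monicOfDegree, Finset.mem_singleton]
    exact ⟨fun h => eq_one_of_monic_natDegree_zero h.1 h.2, fun h => by simp [h]⟩
  rw [this, Finset.sum_singleton, kloostermanWeight_one]

theorem sum_monicOfDegree_one [Fintype K] [DecidableEq K] (ψ : AddChar K ℂ) (b : K) :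
    ∑ h ∈ monicOfDegree K 1, kloostermanWeight ψ b h =
      ∑ u : Kˣ, ψ (u + b * (u⁻¹ : Kˣ)) := by
  classical
  have h1 : ∑ h ∈ monicOfDegree K 1, kloostermanWeight ψ b h =
      ∑ c : K, kloostermanWeight ψ b (X - C c) := by
    symm
    refine Finset.sum_bij (fun c _ => X - C c) ?_ ?_ ?_ ?_
    · intro c _
      rw [mem_monicOfDegree]
      exact ⟨monic_X_sub_C c, natDegree_X_sub_C c⟩
    · intro c _ d _ h
      simpa using h
    · intro h hh
      rw [mem_monicOfDegree] at hh
      refine ⟨-h.coeff 0, Finset.mem_univ _, ?_⟩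
      rw [map_neg, sub_neg_eq_add]
      exact (hh.1.eq_X_add_C hh.2).symm
    · intros; rfl
  rw [h1, ← Finset.sum_subset (Finset.subset_univ (Finset.univ.filter fun c : K => c ≠ 0))]
  · symm
    refine Finset.sum_bij (fun u _ => (u : K)) ?_ ?_ ?_ ?_
    · intro u _; simp
    · intro u _ v _ h; exact Units.ext h
    · intro c hc
      rw [Finset.mem_filter] at hc
      exact ⟨Units.mk0 c hc.2, Finset.mem_univ _, rfl⟩
    · intro u _
      rw [kloostermanWeight, if_neg (by simp), nextCoeff_X_sub_C]
      congr 1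
      simp [coeff_X, coeff_C]
      field_simp
      ring
  · intro c _ hc
    simp only [ne_eq, Finset.mem_filter, Finset.mem_univ, true_and, not_not] at hc
    simp [kloostermanWeight, hc]

theorem sum_monicOfDegree_two [Fintype K] (ψ : AddChar K ℂ) (hψ : ψ ≠ 1) {b : K} (hb : b ≠ 0) :
    ∑ h ∈ monicOfDegree K 2, kloostermanWeight ψ b h = Fintype.card K := by
  classical
  have hdeg : ∀ x : K × K, (X ^ 2 + C x.1 * X + C x.2 : K[X]).natDegree = 2 := by
    intro x; compute_degree!
  have hc0 : ∀ x : K × K, (X ^ 2 + C x.1 * X + C x.2 : K[X]).coeff 0 = x.2 := by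
    intro x; simp
  have hc1 : ∀ x : K × K, (X ^ 2 + C x.1 * X + C x.2 : K[X]).coeff 1 = x.1 := by
    intro x; simp [coeff_X_pow, coeff_C]
  have h1 : ∑ h ∈ monicOfDegree K 2, kloostermanWeight ψ b h =
      ∑ x : K × K, kloostermanWeight ψ b (X ^ 2 + C x.1 * X + C x.2) := by
    symm
    refine Finset.sum_bij (fun x _ => X ^ 2 + C x.1 * X + C x.2) ?_ ?_ ?_ ?_
    · intro x _
      rw [mem_monicOfDegree]
      refine ⟨?_, hdeg x⟩
      monicity!
    · intro x _ y _ h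
      refine Prod.ext ?_ ?_
      · rw [← hc1 x, ← hc1 y, h]
      · rw [← hc0 x, ← hc0 y, h]
    · intro h hh
      rw [mem_monicOfDegree] at hh
      refine ⟨(h.coeff 1, h.coeff 0), Finset.mem_univ _, ?_⟩
      have h3 : h.coeff 2 = 1 := by rw [← hh.2]; exact hh.1
      conv_rhs => rw [h.as_sum_range_C_mul_X_pow, hh.2]
      simp [Finset.sum_range_succ, h3]
      ring
    · intros; rfl
  rw [h1, Fintype.sum_prod_type, Finset.sum_comm]
  have h2 : ∀ y : K, ∑ x : K, kloostermanWeight ψ b (X ^ 2 + C x * X + C y) =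
      if y = -b then (Fintype.card K : ℂ) else 0 := by
    intro y
    have h3 : ∀ x : K, kloostermanWeight ψ b (X ^ 2 + C x * X + C y) =
        if y = 0 then 0 else ψ (x * (-(1 + b / y))) := by
      intro x
      have e0 := hc0 (x, y)
      have e1 := hc1 (x, y)
      have e2 := hdeg (x, y)
      simp only at e0 e1 e2
      have e3 : (X ^ 2 + C x * X + C y : K[X]).nextCoeff = x := by
        rw [nextCoeff_of_natDegree_pos (by omega), e2]; exact e1
      rw [kloostermanWeight, e0, e1, e3]
      split_ifs with h0
      · rfl
      · congr 1; field_simp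
    simp_rw [h3]
    by_cases hy : y = 0
    · rw [if_neg (by rw [hy]; intro h; exact hb (neg_eq_zero.1 h.symm))]
      simp [hy]
    · simp only [hy, if_false]
      split_ifs with h4
      · have : -(1 + b / y) = 0 := by rw [h4]; field_simp; ring
        simp [this]
      · have h5 : -(1 + b / y) ≠ 0 := by
          intro h5
          apply h4
          field_simp at h5
          linear_combination -h5
        have h6 := AddChar.sum_mulShift (-(1 + b / y)) (ψ := ψ)
          (AddChar.IsPrimitive.of_ne_one hψ)
        rw [if_neg h5] at h6
        exact_mod_cast h6
  simp_rw [h2]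
  simp

theorem sum_monicOfDegree_of_three_le (ψ : AddChar K ℂ) (hψ : ψ ≠ 1) (b : K)
    {n : ℕ} (hn : 3 ≤ n) : ∑ h ∈ monicOfDegree K n, kloostermanWeight ψ b h = 0 := by
  obtain ⟨t, ht⟩ : ∃ t, ψ (-t) ≠ 1 := by
    obtain ⟨t, ht⟩ := AddChar.ne_one_iff.1 hψ
    exact ⟨-t, by rwa [neg_neg]⟩
  have hdl : ∀ h : K[X], ∀ s : K, h.Monic → h.natDegree = n →
      (C s * X ^ (n - 1)).degree < h.degree := by
    intro h s h1 h2
    refine lt_of_le_of_lt (degree_C_mul_X_pow_le _ _) ?_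
    rw [degree_eq_natDegree h1.ne_zero, h2]
    exact_mod_cast (by omega : n - 1 < n)
  have hmem : ∀ h ∈ monicOfDegree K n, ∀ s : K, h + C s * X ^ (n - 1) ∈ monicOfDegree K n := by
    intro h hh s
    rw [mem_monicOfDegree] at hh ⊢
    have h3 := hdl h s hh.1 hh.2
    exact ⟨hh.1.add_of_left h3, by rw [natDegree_add_eq_left_of_degree_lt h3, hh.2]⟩
  have key : ∑ h ∈ monicOfDegree K n, kloostermanWeight ψ b h =
      ∑ h ∈ monicOfDegree K n, ψ (-t) * kloostermanWeight ψ b h := by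
    symm
    refine Finset.sum_bij (fun h _ => h + C t * X ^ (n - 1)) (fun h hh => hmem h hh t) ?_ ?_ ?_
    · intro h _ g _ he
      exact add_right_cancel he
    · intro h hh
      refine ⟨h + C (-t) * X ^ (n - 1), hmem h hh (-t), ?_⟩
      simp
    · intro h hh
      have h1 := hmem h hh t
      rw [mem_monicOfDegree] at hh h1
      have e0 : (h + C t * X ^ (n - 1)).coeff 0 = h.coeff 0 := by
        rw [coeff_add, coeff_C_mul, coeff_X_pow, if_neg (by omega)]; simp
      have e1 : (h + C t * X ^ (n - 1)).coeff 1 = h.coeff 1 := by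
        rw [coeff_add, coeff_C_mul, coeff_X_pow, if_neg (by omega)]; simp
      have e2 : (h + C t * X ^ (n - 1)).nextCoeff = h.nextCoeff + t := by
        rw [nextCoeff_of_natDegree_pos (by omega), nextCoeff_of_natDegree_pos (by omega), h1.2,
          hh.2, coeff_add, coeff_C_mul, coeff_X_pow, if_pos rfl, mul_one]
      unfold kloostermanWeight
      rw [e0, e1, e2]
      split_ifs
      · simp
      · rw [← AddChar.map_add_eq_mul]; congr 1; ring
  rw [← Finset.mul_sum] at key
  have h3 : (1 - ψ (-t)) * ∑ h ∈ monicOfDegree K n, kloostermanWeight ψ b h = 0 := by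
    linear_combination key
  rcases mul_eq_zero.1 h3 with h | h
  · exact absurd (sub_eq_zero.1 h).symm ht
  · exact h

end LFunctionCoefficients

section WeilBound

variable {p : ℕ} [Fact p.Prime]

theorem kloostermanExt_one (ψ : AddChar (ZMod p) ℂ) (b : ZMod p) :
    kloostermanExt ψ b 1 = ∑ u : (ZMod p)ˣ, ψ (u + b * (u⁻¹ : (ZMod p)ˣ)) := by
  have h := newton_kloosterman ψ b 1
  simp only [Nat.cast_one, one_mul, Finset.Icc_self, Finset.sum_singleton, Nat.sub_self,
    sum_monicOfDegree_zero, mul_one] at h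
  rw [← h, sum_monicOfDegree_one]

theorem kloostermanExt_two (ψ : AddChar (ZMod p) ℂ) (hψ : ψ ≠ 1) {b : ZMod p} (hb : b ≠ 0) :
    kloostermanExt ψ b 2 = 2 * p - kloostermanExt ψ b 1 ^ 2 := by
  have h := newton_kloosterman ψ b 2
  rw [sum_monicOfDegree_two ψ hψ hb, ZMod.card, Finset.sum_Icc_succ_top (by norm_num),
    Finset.Icc_self, Finset.sum_singleton, Nat.sub_self, sum_monicOfDegree_zero] at h
  rw [show (2 - 1 : ℕ) = 1 from rfl, sum_monicOfDegree_one, ← kloostermanExt_one] at h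
  push_cast at h
  linear_combination -h

theorem kloostermanExt_add_three (ψ : AddChar (ZMod p) ℂ) (hψ : ψ ≠ 1) {b : ZMod p} (hb : b ≠ 0)
    (n : ℕ) : kloostermanExt ψ b (n + 3) =
      - kloostermanExt ψ b 1 * kloostermanExt ψ b (n + 2) - p * kloostermanExt ψ b (n + 1) := by
  have h := newton_kloosterman ψ b (n + 3)
  rw [sum_monicOfDegree_of_three_le ψ hψ b (by omega), mul_zero,
    Finset.sum_Icc_succ_top (by omega), Finset.sum_Icc_succ_top (by omega),
    Finset.sum_Icc_succ_top (by omega), Finset.sum_eq_zero, Nat.sub_self,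
    sum_monicOfDegree_zero, show n + 3 - (n + 2) = 1 by omega, show n + 3 - (n + 1) = 2 by omega,
    sum_monicOfDegree_one, ← kloostermanExt_one, sum_monicOfDegree_two ψ hψ hb, ZMod.card] at h
  · linear_combination -h
  · intro k hk
    rw [Finset.mem_Icc] at hk
    rw [sum_monicOfDegree_of_three_le ψ hψ b (by omega), mul_zero]

theorem kloostermanExt_eq_neg_add_pow (ψ : AddChar (ZMod p) ℂ) (hψ : ψ ≠ 1) {b : ZMod p}
    (hb : b ≠ 0) {α β : ℂ} (h1 : α + β = - kloostermanExt ψ b 1) (h2 : α * β = p) (n : ℕ) :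
    kloostermanExt ψ b (n + 1) = - (α ^ (n + 1) + β ^ (n + 1)) := by
  induction n using Nat.strong_induction_on with
  | _ n ih =>
  match n, ih with
  | 0, _ => simp [h1]
  | 1, _ =>
    rw [kloostermanExt_two ψ hψ hb, ← h2]
    have : kloostermanExt ψ b 1 = -(α + β) := by rw [h1, neg_neg]
    rw [this]; ring
  | n + 2, ih =>
    rw [kloostermanExt_add_three ψ hψ hb n, ih n (by omega), ih (n + 1) (by omega), ← h2]
    have : kloostermanExt ψ b 1 = -(α + β) := by rw [h1, neg_neg]
    rw [this]; ring

theorem norm_kloostermanExt_two_mul_le (hp : p ≠ 2) (ψ : AddChar (ZMod p) ℂ) (hψ : ψ ≠ 1)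
    {b : ZMod p} (hb : b ≠ 0) {k : ℕ} (hk : 3 ≤ k) :
    ‖kloostermanExt ψ b (2 * k)‖ ≤ 4 * p * p ^ k + 2 * p + 9 := by
  classical
  have hp3 : 3 ≤ p := by
    have := (Fact.out : p.Prime).two_le
    omega
  set L := GaloisField p (2 * k)
  let Ψ : AddChar L ℂ := ψ.compAddMonoidHom (Algebra.trace (ZMod p) L).toAddMonoidHom
  have hΨ : ∀ x, Ψ x = ψ (Algebra.trace (ZMod p) L x) := fun _ => rfl
  have hcard : Fintype.card L = (p ^ k) ^ 2 := by
    rw [← Nat.card_eq_fintype_card, GaloisField.card p _ (by omega), ← pow_mul, mul_comm]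
  have hb' : algebraMap (ZMod p) L b ≠ 0 := by
    rw [Ne, map_eq_zero]; exact hb
  have hlarge : 2 * p + 4 < p ^ k := by
    have : p ^ 3 ≤ p ^ k := Nat.pow_le_pow_right (by omega) hk
    nlinarith [sq_nonneg (p - 3 : ℤ)]
  have hΨ1 : Ψ ≠ 1 := by
    obtain ⟨t, ht⟩ := AddChar.ne_one_iff.1 hψ
    obtain ⟨x, hx⟩ := Algebra.trace_surjective (ZMod p) L t
    rw [AddChar.ne_one_iff]
    exact ⟨x, by rw [hΨ, hx]; exact ht⟩
  have hfrob : ∀ y, Ψ (y ^ p) = Ψ y := by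
    intro y
    rw [hΨ, hΨ]
    congr 1
    have h := Algebra.trace_eq_of_algEquiv (FiniteField.frobeniusAlgEquiv (ZMod p) L p) y
    rw [← h]
    congr 1
    simp [FiniteField.frobeniusAlgEquiv]
  have h := norm_sum_kloosterman_le_of_card hp hcard hb' hlarge Ψ hΨ1 hfrob
  refine le_trans (le_of_eq ?_) h
  congr 1
  unfold kloostermanExt
  rw [← Finset.sum_subset (Finset.subset_univ (Finset.univ.filter fun c : L => c ≠ 0))]
  · symm
    refine Finset.sum_bij (fun u _ => (u : L)) ?_ ?_ ?_ ?_
    · intro u _; simp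
    · intro u _ v _ h; exact Units.ext h
    · intro c hc
      rw [Finset.mem_filter] at hc
      exact ⟨Units.mk0 c hc.2, Finset.mem_univ _, rfl⟩
    · intro u _
      rw [kloostermanWeight_minpolyPow ψ b u.ne_zero, hΨ, Units.val_inv_eq_inv_val]
  · intro c _ hc
    simp only [ne_eq, Finset.mem_filter, Finset.mem_univ, true_and, not_not] at hc
    rw [hc, kloostermanWeight_minpolyPow_zero]

theorem norm_sq_le_of_norm_add_pow_le {α β : ℂ} {r D : ℝ} (hr : 0 < r) (h2 : ‖α * β‖ = r)
    (h : ∀ k : ℕ, 3 ≤ k → ‖α ^ (2 * k) + β ^ (2 * k)‖ ≤ D * r ^ k) : ‖α‖ ^ 2 ≤ r := by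
  by_contra! hc
  have hβ : ‖β‖ ^ 2 ≤ r := by
    have h3 : ‖α‖ ^ 2 * ‖β‖ ^ 2 = r ^ 2 := by rw [← mul_pow, ← norm_mul, h2]
    by_contra! h4
    nlinarith
  have h5 : 1 < ‖α‖ ^ 2 / r := by rw [one_lt_div hr]; exact hc
  obtain ⟨k, hk⟩ := pow_unbounded_of_one_lt (D + 1) h5
  have h6 : (‖α‖ ^ 2 / r) ^ k ≤ (‖α‖ ^ 2 / r) ^ (k + 3) := pow_le_pow_right₀ h5.le (by omega)
  have h7 := h (k + 3) (by omega)
  have h8 : ‖α ^ (2 * (k + 3))‖ ≤ D * r ^ (k + 3) + r ^ (k + 3) := by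
    calc ‖α ^ (2 * (k + 3))‖ = ‖(α ^ (2 * (k + 3)) + β ^ (2 * (k + 3))) - β ^ (2 * (k + 3))‖ := by
          ring_nf
      _ ≤ _ := norm_sub_le _ _
      _ ≤ D * r ^ (k + 3) + r ^ (k + 3) := by
          gcongr
          rw [norm_pow, pow_mul]
          gcongr
  rw [norm_pow, pow_mul] at h8
  have h9 : (‖α‖ ^ 2 / r) ^ (k + 3) ≤ D + 1 := by
    rw [div_pow, div_le_iff₀ (by positivity)]; linarith
  linarith

/-- Weil's bound for Kloosterman sums over a prime field. -/
theorem norm_sum_kloosterman_zmod_le (ψ : AddChar (ZMod p) ℂ) (hψ : ψ ≠ 1) {b : ZMod p}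
    (hb : b ≠ 0) : ‖∑ u : (ZMod p)ˣ, ψ (u + b * (u⁻¹ : (ZMod p)ˣ))‖ ≤ 2 * √p := by
  have hpos : (0 : ℝ) < p := by exact_mod_cast (Fact.out : p.Prime).pos
  by_cases hp : p = 2
  · refine (norm_sum_le _ _).trans ?_
    simp only [AddChar.norm_apply, Finset.sum_const, Finset.card_univ, ZMod.card_units_eq_totient,
      nsmul_eq_mul, mul_one]
    have h1 : (1 : ℝ) ≤ √p := by
      rw [Real.one_le_sqrt]; exact_mod_cast (Fact.out : p.Prime).one_lt.le
    rw [hp] at h1 ⊢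
    simp only [Nat.totient_two, Nat.cast_one]
    linarith
  · rw [← kloostermanExt_one]
    obtain ⟨α, hα⟩ : ∃ α : ℂ, α ^ 2 + kloostermanExt ψ b 1 * α + p = 0 := by
      obtain ⟨s, hs⟩ := IsAlgClosed.exists_pow_nat_eq (kloostermanExt ψ b 1 ^ 2 - 4 * p)
        (n := 2) (by norm_num)
      refine ⟨(-kloostermanExt ψ b 1 + s) / 2, ?_⟩
      linear_combination hs / 4
    set β := - kloostermanExt ψ b 1 - α with hβ
    have h1 : α + β = - kloostermanExt ψ b 1 := by rw [hβ]; ring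
    have h2 : α * β = p := by rw [hβ]; linear_combination -hα
    have hn : ‖α * β‖ = p := by rw [h2]; simp
    have hbd : ∀ k : ℕ, 3 ≤ k → ‖α ^ (2 * k) + β ^ (2 * k)‖ ≤ (6 * p + 9) * (p : ℝ) ^ k := by
      intro k hk
      have h3 := norm_kloostermanExt_two_mul_le hp ψ hψ hb hk
      have h4 := kloostermanExt_eq_neg_add_pow ψ hψ hb h1 h2 (2 * k - 1)
      rw [show 2 * k - 1 + 1 = 2 * k by omega] at h4
      rw [h4, norm_neg] at h3
      have h5 : (1 : ℝ) ≤ p ^ k := one_le_pow₀ (by exact_mod_cast (Fact.out : p.Prime).one_lt.le)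
      nlinarith
    have hA := norm_sq_le_of_norm_add_pow_le hpos hn hbd
    have hB := norm_sq_le_of_norm_add_pow_le (α := β) (β := α) hpos (by rw [mul_comm]; exact hn)
      (fun k hk => by rw [add_comm]; exact hbd k hk)
    have hA' := Real.le_sqrt_of_sq_le hA
    have hB' := Real.le_sqrt_of_sq_le hB
    have : kloostermanExt ψ b 1 = -(α + β) := by rw [h1, neg_neg]
    rw [this, norm_neg]
    linarith [norm_add_le α β]

end WeilBound

section KloostermanRing

/-- The Kloosterman sum of two additive characters of a finite ring. -/
noncomputable def kloostermanSum {R : Type*} [CommRing R] [Fintype Rˣ] (ψ χ : AddChar R ℂ) : ℂ :=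
  ∑ u : Rˣ, ψ u * χ (u⁻¹ : Rˣ)

/-- The ideal on which two additive characters are jointly trivial. -/
def commonAnnihilator {R : Type*} [CommRing R] (ψ χ : AddChar R ℂ) : Set R :=
  {a | ∀ x, ψ (a * x) = 1 ∧ χ (a * x) = 1}

/-- A bound `C` for Kloosterman sums relative to the size of the common annihilator. -/
def KloostermanBound (R : Type*) [CommRing R] [Fintype Rˣ] (C : ℝ) : Prop :=
  ∀ ψ χ : AddChar R ℂ, ‖kloostermanSum ψ χ‖ ≤ C * Nat.card (commonAnnihilator ψ χ)

variable {R S : Type*} [CommRing R] [CommRing S] [Fintype Rˣ] [Fintype Sˣ]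

theorem KloostermanBound.of_ringEquiv {C : ℝ} (h : KloostermanBound S C) (e : R ≃+* S) :
    KloostermanBound R C := by
  intro ψ χ
  let ψ' : AddChar S ℂ := ψ.compAddMonoidHom (e.symm : S →+ R)
  let χ' : AddChar S ℂ := χ.compAddMonoidHom (e.symm : S →+ R)
  have hψ : ∀ y, ψ' y = ψ (e.symm y) := fun _ => rfl
  have hχ : ∀ y, χ' y = χ (e.symm y) := fun _ => rfl
  have h1 : kloostermanSum ψ χ = kloostermanSum ψ' χ' := by
    refine Fintype.sum_equiv (Units.mapEquiv e.toMulEquiv).toEquiv _ _ fun u => ?_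
    rw [hψ, hχ]
    congr 2
    · simp
    · have : ((Units.mapEquiv e.toMulEquiv).toEquiv u)⁻¹ = Units.mapEquiv e.toMulEquiv u⁻¹ :=
        (map_inv (Units.mapEquiv e.toMulEquiv) u).symm
      rw [this]; exact (e.symm_apply_apply _).symm
  have h2 : Nat.card (commonAnnihilator ψ χ) = Nat.card (commonAnnihilator ψ' χ') := by
    refine Nat.card_congr (e.toEquiv.subtypeEquiv fun a => ?_)
    simp only [commonAnnihilator, Set.mem_ofPred_eq, hψ, hχ]
    constructor
    · intro ha x
      simpa using ha (e.symm x)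
    · intro ha x
      simpa using ha (e x)
  rw [h1, h2]
  exact h ψ' χ'

theorem KloostermanBound.prod [Finite R] [Finite S] [Fintype (R × S)ˣ] {C D : ℝ}
    (h : KloostermanBound R C) (h' : KloostermanBound S D) :
    KloostermanBound (R × S) (C * D) := by
  intro ψ χ
  let f₁ (ψ : AddChar (R × S) ℂ) : AddChar R ℂ := ψ.compAddMonoidHom (AddMonoidHom.inl R S)
  let f₂ (ψ : AddChar (R × S) ℂ) : AddChar S ℂ := ψ.compAddMonoidHom (AddMonoidHom.inr R S)
  have hf : ∀ ψ : AddChar (R × S) ℂ, ∀ x y, ψ (x, y) = f₁ ψ x * f₂ ψ y := by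
    intro ψ x y
    change _ = ψ (x, 0) * ψ (0, y)
    rw [← AddChar.map_add_eq_mul]; simp
  have h1 : kloostermanSum ψ χ =
      kloostermanSum (f₁ ψ) (f₁ χ) * kloostermanSum (f₂ ψ) (f₂ χ) := by
    unfold kloostermanSum
    rw [Finset.sum_mul_sum, ← Finset.sum_product', Finset.univ_product_univ]
    refine Fintype.sum_equiv MulEquiv.prodUnits.toEquiv _ _ fun u => ?_
    have e1 : (u : R × S) = (((MulEquiv.prodUnits u).1 : R), ((MulEquiv.prodUnits u).2 : S)) := rfl
    have e2 : ((u⁻¹ : (R × S)ˣ) : R × S) =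
      ((((MulEquiv.prodUnits u).1⁻¹ : Rˣ) : R), (((MulEquiv.prodUnits u).2⁻¹ : Sˣ) : S)) := rfl
    rw [e1, e2, hf ψ, hf χ]
    exact mul_mul_mul_comm _ _ _ _
  have h2 : commonAnnihilator ψ χ =
      commonAnnihilator (f₁ ψ) (f₁ χ) ×ˢ commonAnnihilator (f₂ ψ) (f₂ χ) := by
    ext ⟨a, b⟩
    simp only [commonAnnihilator, Set.mem_ofPred_eq, Set.mem_prod]
    constructor
    · intro ha
      constructor
      · intro x; have := ha (x, 0); simpa [hf] using this
      · intro x; have := ha (0, x); simpa [hf] using this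
    · rintro ⟨ha, hb⟩ ⟨x, y⟩
      rw [Prod.mk_mul_mk, hf, hf, (ha x).1, (ha x).2, (hb y).1, (hb y).2]
      simp
  rw [h1, h2, norm_mul, Nat.card_congr (Equiv.Set.prod _ _), Nat.card_prod]
  push_cast
  calc _ ≤ (C * Nat.card (commonAnnihilator (f₁ ψ) (f₁ χ))) *
        (D * Nat.card (commonAnnihilator (f₂ ψ) (f₂ χ))) :=
        mul_le_mul (h _ _) (h' _ _) (norm_nonneg _) ((norm_nonneg _).trans (h _ _))
    _ = _ := by ring

theorem one_le_card_commonAnnihilator {R : Type*} [CommRing R] [Finite R] (ψ χ : AddChar R ℂ) :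
    1 ≤ Nat.card (commonAnnihilator ψ χ) := by
  have : Nonempty (commonAnnihilator ψ χ) := ⟨⟨0, fun x => by simp⟩⟩
  exact Nat.card_pos

theorem norm_kloostermanSum_le [Finite R] (ψ χ : AddChar R ℂ) :
    ‖kloostermanSum ψ χ‖ ≤ Nat.card R := by
  refine (norm_sum_le _ _).trans ?_
  simp only [norm_mul, AddChar.norm_apply, mul_one, Finset.sum_const, Finset.card_univ,
    nsmul_eq_mul]
  rw [← Nat.card_eq_fintype_card]
  exact_mod_cast Nat.card_le_card_of_injective (fun u : Rˣ => (u : R)) Units.val_injective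

theorem kloostermanBound_card [Finite R] : KloostermanBound R (Nat.card R) := by
  intro ψ χ
  refine (norm_kloostermanSum_le ψ χ).trans ?_
  have : (1 : ℝ) ≤ Nat.card (commonAnnihilator ψ χ) := by
    exact_mod_cast one_le_card_commonAnnihilator ψ χ
  exact le_mul_of_one_le_right (by positivity) this

theorem kloostermanSum_comm (ψ χ : AddChar R ℂ) : kloostermanSum ψ χ = kloostermanSum χ ψ := by
  refine Fintype.sum_equiv (Equiv.inv _) _ _ fun u => ?_
  rw [Equiv.inv_apply, inv_inv, mul_comm]

theorem norm_kloostermanSum_le_of_ne_one {p : ℕ} [Fact p.Prime] {ψ : AddChar (ZMod p) ℂ}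
    (hψ : ψ ≠ 1) (χ : AddChar (ZMod p) ℂ) : ‖kloostermanSum ψ χ‖ ≤ 2 * √p := by
  have hprim : ψ.IsPrimitive := AddChar.IsPrimitive.of_ne_one hψ
  have hp1 : (1 : ℝ) ≤ √p := by
    rw [Real.one_le_sqrt]; exact_mod_cast (Fact.out : p.Prime).one_lt.le
  have hinj : Function.Injective (fun b : ZMod p => AddChar.mulShift ψ b) :=
    AddChar.to_mulShift_inj_of_isPrimitive hprim
  obtain ⟨b, rfl⟩ : ∃ b, AddChar.mulShift ψ b = χ := by
    have hc : Fintype.card (ZMod p) = Fintype.card (AddChar (ZMod p) ℂ) :=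
      (AddChar.card_eq (α := ZMod p)).symm
    exact ((Fintype.bijective_iff_injective_and_card _).2 ⟨hinj, hc⟩).2 χ
  have h1 : kloostermanSum ψ (AddChar.mulShift ψ b) =
      ∑ u : (ZMod p)ˣ, ψ (u + b * (u⁻¹ : (ZMod p)ˣ)) := by
    refine Finset.sum_congr rfl fun u _ => ?_
    rw [AddChar.mulShift_apply, AddChar.map_add_eq_mul]
  rw [h1]
  by_cases hb : b = 0
  · simp only [hb, zero_mul, add_zero]
    have h2 : ∑ u : (ZMod p)ˣ, ψ u = -1 := by
      have h3 := AddChar.sum_eq_zero_of_ne_one hψ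
      rw [← Finset.add_sum_erase _ _ (Finset.mem_univ (0 : ZMod p)), AddChar.map_zero_eq_one] at h3
      have h4 : ∑ u : (ZMod p)ˣ, ψ u = ∑ x ∈ Finset.univ.erase (0 : ZMod p), ψ x := by
        refine Finset.sum_bij (fun u _ => (u : ZMod p)) ?_ ?_ ?_ ?_
        · intro u _; simp
        · intro u _ v _ h; exact Units.ext h
        · intro c hc
          rw [Finset.mem_erase] at hc
          exact ⟨Units.mk0 c hc.1, Finset.mem_univ _, rfl⟩
        · intros; rfl
      rw [h4]; linear_combination h3
    rw [h2]; simp; linarith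
  · exact norm_sum_kloosterman_zmod_le ψ hψ hb

theorem kloostermanBound_prime {p : ℕ} [Fact p.Prime] : KloostermanBound (ZMod p) (2 * √p) := by
  intro ψ χ
  have hp1 : (1 : ℝ) ≤ √p := by
    rw [Real.one_le_sqrt]; exact_mod_cast (Fact.out : p.Prime).one_lt.le
  have h1 : (1 : ℝ) ≤ Nat.card (commonAnnihilator ψ χ) := by
    exact_mod_cast one_le_card_commonAnnihilator ψ χ
  by_cases hψ : ψ = 1
  · by_cases hχ : χ = 1
    · have h2 : commonAnnihilator ψ χ = Set.univ := by
        ext a; simp [commonAnnihilator, hψ, hχ]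
      refine (norm_kloostermanSum_le ψ χ).trans ?_
      rw [h2, Nat.card_univ]
      exact le_mul_of_one_le_left (by positivity) (by linarith)
    · rw [kloostermanSum_comm]
      exact (norm_kloostermanSum_le_of_ne_one hχ ψ).trans
        (le_mul_of_one_le_right (by positivity) h1)
  · exact (norm_kloostermanSum_le_of_ne_one hψ χ).trans
      (le_mul_of_one_le_right (by positivity) h1)

theorem kloostermanBound_mul {a b : ℕ} [NeZero a] [NeZero b] [NeZero (a * b)] (hab : a.Coprime b)
    {C D : ℝ} (h : KloostermanBound (ZMod a) C) (h' : KloostermanBound (ZMod b) D) :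
    KloostermanBound (ZMod (a * b)) (C * D) :=
  (h.prod h').of_ringEquiv (ZMod.chineseRemainder hab)

theorem kloostermanBound_squarefree {m : ℕ} [NeZero m] (hm : Squarefree m) :
    KloostermanBound (ZMod m) (m.divisors.card * √m) := by
  suffices H : ∀ m : ℕ, ∀ _ : NeZero m, Squarefree m →
      KloostermanBound (ZMod m) (m.divisors.card * √m) from H m _ hm
  clear hm
  intro m
  induction m using Nat.recOnPosPrimePosCoprime with
  | zero => intro h; exact absurd rfl h.out
  | one =>
    intro _ _
    have := kloostermanBound_card (R := ZMod 1)
    simpa using this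
  | prime_pow p n hp hn =>
    intro _ hsq
    have hn1 : n = 1 := by
      by_contra h
      have := (Nat.squarefree_pow_iff hp.ne_one hn.ne').1 hsq
      exact h this.2
    subst hn1
    have : Fact p.Prime := ⟨hp⟩
    obtain ⟨q, hq⟩ : ∃ q, q = p ^ 1 := ⟨_, rfl⟩
    have hqp : q = p := by rw [hq, pow_one]
    revert hsq
    revert ‹NeZero (p ^ 1)›
    rw [← hq]
    subst hqp
    intro _ _
    rw [hp.divisors, Finset.card_pair hp.ne_one.symm]
    exact kloostermanBound_prime
  | coprime a b ha hb hab iha ihb =>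
    intro _ hsq
    have : NeZero a := ⟨by omega⟩
    have : NeZero b := ⟨by omega⟩
    have h := kloostermanBound_mul hab (iha ‹_› (hsq.of_mul_left)) (ihb ‹_› hsq.of_mul_right)
    convert h using 1
    rw [hab.card_divisors_mul]
    push_cast
    rw [Real.sqrt_mul (by positivity)]
    ring

end KloostermanRing

section ExponentialSums

variable {q : ℕ} [NeZero q]

/-- The exponential sum of a finite set of naturals modulo `q`. -/
noncomputable def expSum (q : ℕ) [NeZero q] (J : Finset ℕ) (m : ZMod q) : ℂ :=
  ∑ b ∈ J, ZMod.stdAddChar (m * (b : ZMod q))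

theorem norm_expSum_le_card (J : Finset ℕ) (m : ZMod q) : ‖expSum q J m‖ ≤ J.card := by
  refine (norm_sum_le _ _).trans ?_
  simp [AddChar.norm_apply]

theorem norm_stdAddChar_sub_one_ge {m : ZMod q} :
    4 * (min (m.val : ℝ) (q - m.val)) / q ≤ ‖ZMod.stdAddChar m - 1‖ := by
  have hq : (0 : ℝ) < q := by exact_mod_cast Nat.pos_of_ne_zero (NeZero.ne q)
  have hm : (m.val : ℝ) ≤ q := by exact_mod_cast (ZMod.val_lt m).le
  have h1 : (ZMod.stdAddChar m : ℂ) =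
      Complex.exp (Complex.I * ((2 * Real.pi * m.val / q : ℝ) : ℂ)) := by
    rw [ZMod.stdAddChar_apply, ZMod.toCircle_apply]
    congr 1; push_cast; ring
  rw [h1, Complex.norm_exp_I_mul_ofReal_sub_one, show 2 * Real.pi * m.val / q / 2 =
    Real.pi * m.val / q by ring, Real.norm_eq_abs]
  refine le_trans ?_ (le_abs_self _)
  have hpi := Real.pi_pos
  rcases le_total (m.val : ℝ) (q / 2) with h | h
  · have h2 := Real.mul_le_sin (x := Real.pi * m.val / q) (by positivity) (by
      rw [div_le_div_iff₀ hq two_pos]; nlinarith)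
    have h3 : 2 / Real.pi * (Real.pi * m.val / q) = 2 * m.val / q := by field_simp
    rw [h3] at h2
    calc _ ≤ 4 * (m.val : ℝ) / q := by gcongr; exact min_le_left _ _
      _ = 2 * (2 * m.val / q) := by ring
      _ ≤ _ := by gcongr
  · have h2 := Real.mul_le_sin (x := Real.pi * (q - m.val) / q)
      (div_nonneg (mul_nonneg hpi.le (by linarith)) hq.le) (by
      rw [div_le_div_iff₀ hq two_pos]; nlinarith)
    have h3 : 2 / Real.pi * (Real.pi * (q - m.val) / q) = 2 * (q - m.val) / q := by field_simp
    have h4 : Real.sin (Real.pi * (q - m.val) / q) = Real.sin (Real.pi * m.val / q) := by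
      rw [← Real.sin_pi_sub]; congr 1; field_simp; ring
    rw [h3, h4] at h2
    calc _ ≤ 4 * ((q : ℝ) - m.val) / q := by gcongr; exact min_le_right _ _
      _ = 2 * (2 * (q - m.val) / q) := by ring
      _ ≤ _ := by gcongr

/-- The weight bounding exponential sums over intervals. -/
noncomputable def expWeight (q : ℕ) (k : ℕ) : ℝ := q / 2 * (1 / k + 1 / (q - k))

theorem norm_expSum_Ico_le {m : ZMod q} (hm : m ≠ 0) (a c : ℕ) :
    ‖expSum q (Finset.Ico a c) m‖ ≤ expWeight q m.val := by
  have hq : (0 : ℝ) < q := by exact_mod_cast Nat.pos_of_ne_zero (NeZero.ne q)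
  have hm0 : (0 : ℝ) < m.val := by
    have : m.val ≠ 0 := by rwa [Ne, ZMod.val_eq_zero]
    exact_mod_cast Nat.pos_of_ne_zero this
  have hmq : (0 : ℝ) < q - m.val := by
    have := ZMod.val_lt m
    rw [sub_pos]; exact_mod_cast this
  have hmin : 0 < min (m.val : ℝ) (q - m.val) := lt_min hm0 hmq
  have hW : q / (2 * min (m.val : ℝ) (q - m.val)) ≤ expWeight q m.val := by
    unfold expWeight
    rcases min_choice (m.val : ℝ) (q - m.val) with h | h
    · rw [h]
      have : 0 ≤ (q : ℝ) / 2 * (1 / (q - m.val)) := by positivity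
      calc _ = (q : ℝ) / 2 * (1 / m.val) := by field_simp
        _ ≤ _ := by rw [mul_add]; linarith
    · rw [h]
      have : 0 ≤ (q : ℝ) / 2 * (1 / m.val) := by positivity
      calc _ = (q : ℝ) / 2 * (1 / (q - m.val)) := by field_simp
        _ ≤ _ := by rw [mul_add]; linarith
  refine le_trans ?_ hW
  rcases lt_or_ge c a with hac | hac
  · rw [Finset.Ico_eq_empty (by omega)]
    simp only [expSum, Finset.sum_empty, norm_zero]
    exact div_nonneg hq.le (by linarith)
  have h0 := norm_stdAddChar_sub_one_ge (m := m)
  set z : ℂ := ZMod.stdAddChar m with hz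
  have hzn : ‖z‖ = 1 := AddChar.norm_apply _ _
  have hz1 : 0 < ‖z - 1‖ := lt_of_lt_of_le (by positivity) h0
  have hne : z ≠ 1 := by
    intro h; rw [h] at hz1; simp at hz1
  have h1 : expSum q (Finset.Ico a c) m = (z ^ c - z ^ a) / (z - 1) := by
    rw [← geom_sum_Ico hne hac]
    refine Finset.sum_congr rfl fun b _ => ?_
    rw [mul_comm, ← nsmul_eq_mul, AddChar.map_nsmul_eq_pow]
  rw [h1, norm_div]
  have h2 : ‖z ^ c - z ^ a‖ ≤ 2 := by
    refine (norm_sub_le _ _).trans ?_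
    rw [norm_pow, norm_pow, hzn]; norm_num
  calc ‖z ^ c - z ^ a‖ / ‖z - 1‖ ≤ 2 / (4 * (min (m.val : ℝ) (q - m.val)) / q) := by gcongr
    _ = _ := by field_simp; norm_num

theorem sum_inv_Icc_le (n : ℕ) : ∑ k ∈ Finset.Icc 1 n, (1 / (k : ℝ)) ≤ 1 + Real.log n := by
  have h := harmonic_le_one_add_log n
  rw [harmonic_eq_sum_Icc] at h
  push_cast at h
  simpa using h

theorem sum_gcd_div_le (q : ℕ) :
    ∑ k ∈ Finset.Ico 1 q, ((k.gcd q : ℕ) : ℝ) / k ≤ q.divisors.card * (1 + Real.log q) := by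
  rcases Nat.eq_zero_or_pos q with rfl | hq
  · simp
  have h1 : ∀ k ∈ Finset.Ico 1 q, ((k.gcd q : ℕ) : ℝ) / k ≤
      ∑ d ∈ q.divisors, if d ∣ k then (d : ℝ) / k else 0 := by
    intro k hk
    have hmem : k.gcd q ∈ q.divisors := by
      rw [Nat.mem_divisors]; exact ⟨Nat.gcd_dvd_right _ _, hq.ne'⟩
    refine le_trans ?_ (Finset.single_le_sum (f := fun d : ℕ => if d ∣ k then (d : ℝ) / k else 0)
      (fun d _ => ?_) hmem)
    · simp only [Nat.gcd_dvd_left, if_true]; exact le_rfl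
    · split_ifs <;> positivity
  refine (Finset.sum_le_sum h1).trans ?_
  rw [Finset.sum_comm, ← nsmul_eq_mul]
  refine Finset.sum_le_card_nsmul _ _ _ fun d hd => ?_
  rw [Nat.mem_divisors] at hd
  have hd0 : 0 < d := Nat.pos_of_dvd_of_pos hd.1 hq
  rw [← Finset.sum_filter]
  refine le_trans ?_ (sum_inv_Icc_le q)
  have h2 : ∑ k ∈ (Finset.Ico 1 q).filter (d ∣ ·), (d : ℝ) / k =
      ∑ j ∈ ((Finset.Ico 1 q).filter (d ∣ ·)).image (· / d), 1 / (j : ℝ) := by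
    rw [Finset.sum_image]
    · refine Finset.sum_congr rfl fun k hk => ?_
      rw [Finset.mem_filter, Finset.mem_Ico] at hk
      rw [Nat.cast_div hk.2 (by positivity)]
      have : (0 : ℝ) < k := by exact_mod_cast (by omega : 0 < k)
      have : (0 : ℝ) < d := by exact_mod_cast hd0
      field_simp
    · intro x hx y hy hxy
      simp only [Finset.coe_filter, Set.mem_ofPred_eq] at hx hy
      obtain ⟨u, rfl⟩ := hx.2
      obtain ⟨v, rfl⟩ := hy.2
      simp only [Nat.mul_div_cancel_left _ hd0] at hxy
      rw [hxy]
  rw [h2]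
  refine Finset.sum_le_sum_of_subset_of_nonneg ?_ (fun _ _ _ => by positivity)
  intro j hj
  rw [Finset.mem_image] at hj
  obtain ⟨k, hk, rfl⟩ := hj
  rw [Finset.mem_filter, Finset.mem_Ico] at hk
  rw [Finset.mem_Icc]
  exact ⟨Nat.div_pos (Nat.le_of_dvd (by omega) hk.2) hd0,
    (Nat.div_le_self _ _).trans (by omega)⟩

theorem sum_expWeight_mul_gcd_le (q : ℕ) :
    ∑ k ∈ Finset.Ico 1 q, expWeight q k * (k.gcd q : ℕ) ≤
      q * (q.divisors.card * (1 + Real.log q)) := by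
  have h1 : ∑ k ∈ Finset.Ico 1 q, ((k.gcd q : ℕ) : ℝ) / (q - k) =
      ∑ k ∈ Finset.Ico 1 q, ((k.gcd q : ℕ) : ℝ) / k := by
    refine Finset.sum_bij' (fun k _ => q - k) (fun k _ => q - k) ?_ ?_ ?_ ?_ ?_
    · intro k hk; rw [Finset.mem_Ico] at *; omega
    · intro k hk; rw [Finset.mem_Ico] at *; omega
    · intro k hk; rw [Finset.mem_Ico] at *; omega
    · intro k hk; rw [Finset.mem_Ico] at *; omega
    · intro k hk
      rw [Finset.mem_Ico] at hk
      rw [Nat.cast_sub hk.2.le]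
      congr 2
      rw [Nat.gcd_comm (q - k) q, Nat.gcd_self_sub_right hk.2.le, Nat.gcd_comm]
  have h2 := sum_gcd_div_le q
  calc ∑ k ∈ Finset.Ico 1 q, expWeight q k * (k.gcd q : ℕ)
      = q / 2 * (∑ k ∈ Finset.Ico 1 q, ((k.gcd q : ℕ) : ℝ) / k +
        ∑ k ∈ Finset.Ico 1 q, ((k.gcd q : ℕ) : ℝ) / (q - k)) := by
        rw [← Finset.sum_add_distrib, Finset.mul_sum]
        refine Finset.sum_congr rfl fun k _ => ?_
        unfold expWeight; ring
    _ = q * ∑ k ∈ Finset.Ico 1 q, ((k.gcd q : ℕ) : ℝ) / k := by rw [h1]; ring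
    _ ≤ _ := by gcongr

theorem sum_expWeight_le (q : ℕ) :
    ∑ k ∈ Finset.Ico 1 q, expWeight q k ≤ q * (1 + Real.log q) := by
  have h1 : ∑ k ∈ Finset.Ico 1 q, 1 / ((q : ℝ) - k) = ∑ k ∈ Finset.Ico 1 q, 1 / (k : ℝ) := by
    refine Finset.sum_bij' (fun k _ => q - k) (fun k _ => q - k) ?_ ?_ ?_ ?_ ?_
    · intro k hk; rw [Finset.mem_Ico] at *; omega
    · intro k hk; rw [Finset.mem_Ico] at *; omega
    · intro k hk; rw [Finset.mem_Ico] at *; omega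
    · intro k hk; rw [Finset.mem_Ico] at *; omega
    · intro k hk
      rw [Finset.mem_Ico] at hk
      rw [Nat.cast_sub hk.2.le]
  have h2 : ∑ k ∈ Finset.Ico 1 q, 1 / (k : ℝ) ≤ 1 + Real.log q := by
    refine le_trans ?_ (sum_inv_Icc_le q)
    exact Finset.sum_le_sum_of_subset_of_nonneg Finset.Ico_subset_Icc_self
      (fun _ _ _ => by positivity)
  calc ∑ k ∈ Finset.Ico 1 q, expWeight q k
      = q / 2 * (∑ k ∈ Finset.Ico 1 q, 1 / (k : ℝ) + ∑ k ∈ Finset.Ico 1 q, 1 / ((q : ℝ) - k)) := by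
        rw [← Finset.sum_add_distrib, Finset.mul_sum]
        rfl
    _ = q * ∑ k ∈ Finset.Ico 1 q, 1 / (k : ℝ) := by rw [h1]; ring
    _ ≤ _ := by gcongr

theorem sum_zmod_erase_zero (f : ℕ → ℝ) :
    ∑ m ∈ Finset.univ.erase (0 : ZMod q), f m.val = ∑ k ∈ Finset.Ico 1 q, f k := by
  refine Finset.sum_bij' (fun m _ => m.val) (fun k _ => (k : ZMod q)) ?_ ?_ ?_ ?_ ?_
  · intro m hm
    rw [Finset.mem_erase] at hm
    have : m.val ≠ 0 := by rw [Ne, ZMod.val_eq_zero]; exact hm.1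
    have := ZMod.val_lt m
    rw [Finset.mem_Ico]; omega
  · intro k hk
    rw [Finset.mem_Ico] at hk
    rw [Finset.mem_erase]
    refine ⟨?_, Finset.mem_univ _⟩
    rw [Ne, ZMod.natCast_eq_zero_iff]
    intro h; have := Nat.le_of_dvd (by omega) h; omega
  · intro m _; simp
  · intro k hk
    rw [Finset.mem_Ico] at hk
    exact ZMod.val_cast_of_lt hk.2
  · intros; rfl

theorem card_mul_eq_zero_le (n : ZMod q) :
    Nat.card {a : ZMod q | a * n = 0} ≤ n.val.gcd q := by
  classical
  have hpos : 0 < n.val.gcd q :=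
    Nat.gcd_pos_of_pos_right _ (Nat.pos_of_ne_zero (NeZero.ne q))
  have h := IsAddCyclic.card_nsmul_eq_zero_le (α := ZMod q) hpos
  refine le_trans ?_ h
  rw [Nat.card_eq_fintype_card, ← Set.toFinset_card]
  refine Finset.card_le_card fun a ha => ?_
  simp only [Set.mem_toFinset, Set.mem_ofPred_eq, Finset.mem_filter, Finset.mem_univ,
    true_and] at ha ⊢
  have h1 : (n.val : ZMod q) * a = 0 := by rw [ZMod.natCast_zmod_val, mul_comm]; exact ha
  rw [← addOrderOf_dvd_iff_nsmul_eq_zero]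
  apply Nat.dvd_gcd
  · rw [addOrderOf_dvd_iff_nsmul_eq_zero, nsmul_eq_mul]; exact h1
  · rw [addOrderOf_dvd_iff_nsmul_eq_zero, nsmul_eq_mul]; simp

end ExponentialSums

section ModularHyperbola

variable {q : ℕ} [NeZero q]

theorem sum_stdAddChar_mul (z : ZMod q) :
    ∑ m : ZMod q, (ZMod.stdAddChar (m * z) : ℂ) = if z = 0 then (q : ℂ) else 0 := by
  rw [AddChar.sum_mulShift z (ZMod.isPrimitive_stdAddChar q), ZMod.card]
  split_ifs <;> simp

theorem sum_expSum_mul_stdAddChar (J : Finset ℕ) (w : ZMod q) :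
    ∑ m : ZMod q, expSum q J m * ZMod.stdAddChar (-m * w) =
      ∑ b ∈ J, if (b : ZMod q) = w then (q : ℂ) else 0 := by
  unfold expSum
  simp_rw [Finset.sum_mul]
  rw [Finset.sum_comm]
  refine Finset.sum_congr rfl fun b _ => ?_
  have : ∀ m : ZMod q, (ZMod.stdAddChar (m * (b : ZMod q)) : ℂ) * ZMod.stdAddChar (-m * w) =
      ZMod.stdAddChar (m * ((b : ZMod q) - w)) := by
    intro m
    rw [← AddChar.map_add_eq_mul]; congr 1; ring
  simp_rw [this, sum_stdAddChar_mul, sub_eq_zero]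

theorem sum_units_ite (s : (ZMod q)ˣ) (x y : ZMod q) :
    ∑ u : (ZMod q)ˣ, (if x = ((s⁻¹ : (ZMod q)ˣ) : ZMod q) * u then (q : ℂ) else 0) *
      (if y = (u⁻¹ : (ZMod q)ˣ) then (q : ℂ) else 0) =
      if s * x * y = 1 then (q : ℂ) ^ 2 else 0 := by
  split_ifs with h
  · let u₀ : (ZMod q)ˣ := ⟨s * x, y, h, by rw [mul_comm]; exact h⟩
    rw [Finset.sum_eq_single u₀]
    · have e1 : x = ((s⁻¹ : (ZMod q)ˣ) : ZMod q) * u₀ := by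
        change x = ((s⁻¹ : (ZMod q)ˣ) : ZMod q) * (s * x)
        rw [← mul_assoc, Units.inv_mul, one_mul]
      have e2 : y = (u₀⁻¹ : (ZMod q)ˣ) := rfl
      rw [if_pos e1, if_pos e2]; ring
    · intro u _ hu
      split_ifs with h1 h2
      · exfalso
        apply hu
        ext
        change (u : ZMod q) = s * x
        rw [h1, ← mul_assoc, Units.mul_inv, one_mul]
      all_goals simp
    · simp
  · refine Finset.sum_eq_zero fun u _ => ?_
    split_ifs with h1 h2
    · exfalso
      apply h
      rw [h1, h2, ← mul_assoc, Units.mul_inv, one_mul, Units.mul_inv]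
    all_goals simp

/-- Number of points of a modular hyperbola in a box. -/
def hyperbolaCount (q : ℕ) (s : ZMod q) (J Y : Finset ℕ) : ℕ :=
  ∑ y ∈ Y, (J.filter fun b : ℕ => s * b * y = 1).card

theorem hyperbolaCount_fourier (s : (ZMod q)ˣ) (J Y : Finset ℕ) :
    (q : ℂ) ^ 2 * hyperbolaCount q s J Y =
      ∑ m : ZMod q, ∑ n : ZMod q, expSum q J m * expSum q Y n *
        kloostermanSum (AddChar.mulShift ZMod.stdAddChar (-m * ((s⁻¹ : (ZMod q)ˣ) : ZMod q)))
          (AddChar.mulShift ZMod.stdAddChar (-n)) := by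
  have h1 : ∑ m : ZMod q, ∑ n : ZMod q, expSum q J m * expSum q Y n *
        kloostermanSum (AddChar.mulShift ZMod.stdAddChar (-m * ((s⁻¹ : (ZMod q)ˣ) : ZMod q)))
          (AddChar.mulShift ZMod.stdAddChar (-n)) =
      ∑ u : (ZMod q)ˣ,
        (∑ m : ZMod q, expSum q J m *
          ZMod.stdAddChar (-m * (((s⁻¹ : (ZMod q)ˣ) : ZMod q) * (u : ZMod q)))) *
        (∑ n : ZMod q, expSum q Y n * ZMod.stdAddChar (-n * ((u⁻¹ : (ZMod q)ˣ) : ZMod q))) := by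
    simp_rw [Finset.sum_mul_sum]
    rw [Finset.sum_comm]
    conv_rhs => rw [Finset.sum_comm]
    rw [Finset.sum_comm]
    refine Finset.sum_congr rfl fun m _ => ?_
    rw [Finset.sum_comm]
    refine Finset.sum_congr rfl fun n _ => ?_
    unfold kloostermanSum
    rw [Finset.mul_sum]
    refine Finset.sum_congr rfl fun u _ => ?_
    rw [AddChar.mulShift_apply, AddChar.mulShift_apply, mul_assoc (-m)]
    ring
  rw [h1]
  simp_rw [sum_expSum_mul_stdAddChar, Finset.sum_mul_sum]
  rw [Finset.sum_comm]
  have h2 : ∀ b ∈ J, ∑ u : (ZMod q)ˣ, ∑ y ∈ Y,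
      (if (b : ZMod q) = ((s⁻¹ : (ZMod q)ˣ) : ZMod q) * u then (q : ℂ) else 0) *
      (if (y : ZMod q) = (u⁻¹ : (ZMod q)ˣ) then (q : ℂ) else 0) =
      ∑ y ∈ Y, if s * (b : ZMod q) * y = 1 then (q : ℂ) ^ 2 else 0 := by
    intro b _
    rw [Finset.sum_comm]
    exact Finset.sum_congr rfl fun y _ => sum_units_ite s b y
  rw [Finset.sum_congr rfl h2, Finset.sum_comm]
  unfold hyperbolaCount
  push_cast
  rw [Finset.mul_sum]
  refine Finset.sum_congr rfl fun y _ => ?_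
  rw [← Finset.sum_filter, Finset.sum_const, nsmul_eq_mul, mul_comm]

theorem norm_kloosterman_mulShift_le {B : ℝ} (hB : KloostermanBound (ZMod q) B) (hB0 : 0 ≤ B)
    (s : (ZMod q)ˣ) (m n : ZMod q) :
    ‖kloostermanSum (AddChar.mulShift ZMod.stdAddChar (-m * ((s⁻¹ : (ZMod q)ˣ) : ZMod q)))
      (AddChar.mulShift ZMod.stdAddChar (-n))‖ ≤ B * (min (m.val.gcd q) (n.val.gcd q) : ℕ) := by
  refine (hB _ _).trans (mul_le_mul_of_nonneg_left ?_ hB0)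
  have hprim := ZMod.isPrimitive_stdAddChar q
  have key : ∀ (c a : ZMod q), (∀ x, (ZMod.stdAddChar (c * (a * x)) : ℂ) = 1) → c * a = 0 := by
    intro c a h
    by_contra h0
    apply hprim h0
    rw [AddChar.eq_one_iff]
    intro x
    rw [AddChar.mulShift_apply, mul_assoc]; exact h x
  rw [Nat.cast_le]
  refine le_min ?_ ?_
  · refine le_trans (Nat.card_mono (Set.toFinite _) ?_) (card_mul_eq_zero_le m)
    intro a ha
    have := key _ a fun x => by have := (ha x).1; rwa [AddChar.mulShift_apply] at this
    rw [Set.mem_ofPred_eq]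
    have h2 : ((s⁻¹ : (ZMod q)ˣ) : ZMod q) * (a * m) = 0 := by linear_combination -this
    exact (Units.mul_right_eq_zero _).1 h2
  · refine le_trans (Nat.card_mono (Set.toFinite _) ?_) (card_mul_eq_zero_le n)
    intro a ha
    have := key _ a fun x => by have := (ha x).2; rwa [AddChar.mulShift_apply] at this
    rw [Set.mem_ofPred_eq]
    linear_combination -this

theorem abs_hyperbolaCount_sub_le {B : ℝ} (hB : KloostermanBound (ZMod q) B) (hB0 : 0 ≤ B)
    (s : (ZMod q)ˣ) {a c a' c' : ℕ} (hJ : c ≤ a + q) (hY : c' ≤ a' + q) :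
    |(hyperbolaCount q s (Finset.Ico a c) (Finset.Ico a' c') : ℝ) -
      (Finset.Ico a c).card * (Finset.Ico a' c').card * q.totient / q ^ 2| ≤
      4 * B * q.divisors.card * (1 + Real.log q) ^ 2 := by
  have hq : (0 : ℝ) < q := by exact_mod_cast Nat.pos_of_ne_zero (NeZero.ne q)
  have hq1 : (1 : ℝ) ≤ q := by exact_mod_cast Nat.pos_of_ne_zero (NeZero.ne q)
  have hL : 1 ≤ 1 + Real.log q := by linarith [Real.log_nonneg hq1]
  have hτ : (1 : ℝ) ≤ q.divisors.card := by
    exact_mod_cast Finset.card_pos.2 ⟨1, Nat.one_mem_divisors.2 (NeZero.ne q)⟩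
  set J := Finset.Ico a c with hJdef
  set Y := Finset.Ico a' c' with hYdef
  set T : ZMod q → ZMod q → ℂ := fun m n => expSum q J m * expSum q Y n *
        kloostermanSum (AddChar.mulShift ZMod.stdAddChar (-m * ((s⁻¹ : (ZMod q)ˣ) : ZMod q)))
          (AddChar.mulShift ZMod.stdAddChar (-n)) with hT
  let W : ZMod q → ℝ := fun m => if m = 0 then (q : ℝ) else expWeight q m.val
  have hWJ : ∀ m, ‖expSum q J m‖ ≤ W m := by
    intro m
    simp only [W]
    split_ifs with h
    · refine (norm_expSum_le_card _ _).trans ?_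
      rw [hJdef, Nat.card_Ico]; exact_mod_cast (by omega : c - a ≤ q)
    · exact norm_expSum_Ico_le h a c
  have hWY : ∀ m, ‖expSum q Y m‖ ≤ W m := by
    intro m
    simp only [W]
    split_ifs with h
    · refine (norm_expSum_le_card _ _).trans ?_
      rw [hYdef, Nat.card_Ico]; exact_mod_cast (by omega : c' - a' ≤ q)
    · exact norm_expSum_Ico_le h a' c'
  have hW0 : ∀ m, 0 ≤ W m := fun m => (norm_nonneg _).trans (hWJ m)
  have hTb : ∀ m n, ‖T m n‖ ≤ W m * W n * (B * (min (m.val.gcd q) (n.val.gcd q) : ℕ)) := by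
    intro m n
    rw [hT, norm_mul, norm_mul]
    exact mul_le_mul (mul_le_mul (hWJ m) (hWY n) (norm_nonneg _) (hW0 m))
      (norm_kloosterman_mulShift_le hB hB0 s m n) (norm_nonneg _)
      (mul_nonneg (hW0 m) (hW0 n))
  have hsumW : ∑ m, W m ≤ 2 * q * (1 + Real.log q) := by
    rw [← Finset.add_sum_erase _ _ (Finset.mem_univ (0 : ZMod q))]
    have h1 : ∑ m ∈ Finset.univ.erase (0 : ZMod q), W m =
        ∑ m ∈ Finset.univ.erase (0 : ZMod q), expWeight q m.val := by
      refine Finset.sum_congr rfl fun m hm => ?_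
      simp only [W, if_neg (Finset.ne_of_mem_erase hm)]
    have h2 := sum_expWeight_le q
    rw [h1, sum_zmod_erase_zero (fun k => expWeight q k)]
    simp only [W, if_true]
    nlinarith
  have hsumG : ∑ m ∈ Finset.univ.erase (0 : ZMod q), W m * (m.val.gcd q : ℕ) ≤
      q * (q.divisors.card * (1 + Real.log q)) := by
    have h1 : ∑ m ∈ Finset.univ.erase (0 : ZMod q), W m * (m.val.gcd q : ℕ) =
        ∑ m ∈ Finset.univ.erase (0 : ZMod q), expWeight q m.val * (m.val.gcd q : ℕ) := by
      refine Finset.sum_congr rfl fun m hm => ?_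
      simp only [W, if_neg (Finset.ne_of_mem_erase hm)]
    rw [h1, sum_zmod_erase_zero (fun k => expWeight q k * (k.gcd q : ℕ))]
    exact sum_expWeight_mul_gcd_le q
  have h00 : T 0 0 = J.card * Y.card * q.totient := by
    simp only [hT, expSum, zero_mul, AddChar.map_zero_eq_one, Finset.sum_const, nsmul_eq_mul,
      mul_one, neg_zero, AddChar.mulShift_zero, kloostermanSum, AddChar.one_apply,
      Finset.card_univ, ZMod.card_units_eq_totient]
  have hmain : (q : ℂ) ^ 2 * hyperbolaCount q s J Y - J.card * Y.card * q.totient =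
      ∑ m ∈ Finset.univ.erase (0 : ZMod q), T m 0 +
      ∑ m, ∑ n ∈ Finset.univ.erase (0 : ZMod q), T m n := by
    rw [hyperbolaCount_fourier, ← h00]
    have h3 : ∀ m, ∑ n, T m n = T m 0 + ∑ n ∈ Finset.univ.erase (0 : ZMod q), T m n :=
      fun m => (Finset.add_sum_erase _ _ (Finset.mem_univ (0 : ZMod q))).symm
    have h4 : ∑ m, T m 0 = T 0 0 + ∑ m ∈ Finset.univ.erase (0 : ZMod q), T m 0 :=
      (Finset.add_sum_erase _ (fun m => T m 0) (Finset.mem_univ (0 : ZMod q))).symm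
    change ∑ m, ∑ n, T m n - T 0 0 = _
    simp_rw [h3]
    rw [Finset.sum_add_distrib, h4]; ring
  have hn1 : ‖∑ m ∈ Finset.univ.erase (0 : ZMod q), T m 0‖ ≤
      q * B * (q * (q.divisors.card * (1 + Real.log q))) := by
    refine (norm_sum_le _ _).trans ?_
    calc _ ≤ ∑ m ∈ Finset.univ.erase (0 : ZMod q), q * B * (W m * (m.val.gcd q : ℕ)) := by
          refine Finset.sum_le_sum fun m _ => (hTb m 0).trans ?_
          have : W 0 = q := by simp [W]
          rw [this]
          calc W m * q * (B * (min (m.val.gcd q) ((0 : ZMod q).val.gcd q) : ℕ))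
              ≤ W m * q * (B * (m.val.gcd q : ℕ)) := by
                have := hW0 m
                gcongr; exact min_le_left _ _
            _ = _ := by ring
      _ ≤ _ := by rw [← Finset.mul_sum]; gcongr
  have hn2 : ‖∑ m, ∑ n ∈ Finset.univ.erase (0 : ZMod q), T m n‖ ≤
      (2 * q * (1 + Real.log q)) * (B * (q * (q.divisors.card * (1 + Real.log q)))) := by
    refine (norm_sum_le _ _).trans ?_
    calc _ ≤ ∑ m, W m * (B * (q * (q.divisors.card * (1 + Real.log q)))) := by
          refine Finset.sum_le_sum fun m _ => (norm_sum_le _ _).trans ?_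
          calc _ ≤ ∑ n ∈ Finset.univ.erase (0 : ZMod q), W m * (B * (W n * (n.val.gcd q : ℕ))) := by
                refine Finset.sum_le_sum fun n _ => (hTb m n).trans ?_
                calc W m * W n * (B * (min (m.val.gcd q) (n.val.gcd q) : ℕ))
                    ≤ W m * W n * (B * (n.val.gcd q : ℕ)) := by
                      have := hW0 m
                      have := hW0 n
                      gcongr; exact min_le_right _ _
                  _ = _ := by ring
            _ ≤ _ := by
                rw [← Finset.mul_sum, ← Finset.mul_sum]
                have := hW0 m
                gcongr
      _ ≤ _ := by rw [← Finset.sum_mul]; gcongr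
  have hfin : ‖(q : ℂ) ^ 2 * hyperbolaCount q s J Y - J.card * Y.card * q.totient‖ ≤
      q ^ 2 * (4 * B * q.divisors.card * (1 + Real.log q) ^ 2) := by
    rw [hmain]
    refine (norm_add_le _ _).trans ((add_le_add hn1 hn2).trans ?_)
    have h5 : 0 ≤ (q : ℝ) ^ 2 * B * q.divisors.card * (1 + Real.log q) := by positivity
    nlinarith [mul_le_mul_of_nonneg_left hL h5]
  have hreal : ‖(q : ℂ) ^ 2 * hyperbolaCount q s J Y - J.card * Y.card * q.totient‖ =
      q ^ 2 * |(hyperbolaCount q s J Y : ℝ) - J.card * Y.card * q.totient / q ^ 2| := by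
    rw [← abs_of_pos (by positivity : (0 : ℝ) < q ^ 2), ← abs_mul, ← Real.norm_eq_abs,
      ← Complex.norm_real, abs_of_pos (by positivity : (0 : ℝ) < q ^ 2)]
    congr 1
    push_cast
    have : (q : ℂ) ≠ 0 := by exact_mod_cast NeZero.ne q
    field_simp
  rw [hreal] at hfin
  exact le_of_mul_le_mul_left hfin (by positivity)

end ModularHyperbola

section DivisorBounds

theorem kloostermanBound_mono {R : Type*} [CommRing R] [Fintype Rˣ] [Finite R] {C D : ℝ}
    (h : KloostermanBound R C) (hCD : C ≤ D) : KloostermanBound R D := fun ψ χ =>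
  (h ψ χ).trans (mul_le_mul_of_nonneg_right hCD (Nat.cast_nonneg _))

theorem exists_kloostermanBound (q : ℕ) [NeZero q] :
    ∃ s t : ℕ, 0 < s ∧ t ∣ s ∧ s ^ 2 * t ∣ q ∧
      KloostermanBound (ZMod q) (q.divisors.card * (√q * √((s ^ 2 * t : ℕ) : ℝ))) := by
  obtain ⟨f, s, hq, hf⟩ := Nat.sq_mul_squarefree q
  have hq0 := NeZero.ne q
  have hs : s ≠ 0 := by rintro rfl; simp at hq; exact hq0 hq.symm
  have hf0 : f ≠ 0 := by rintro rfl; simp at hq; exact hq0 hq.symm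
  set t := f.gcd s with ht
  obtain ⟨m, hm⟩ : t ∣ f := Nat.gcd_dvd_left f s
  have htm : t.Coprime m := by
    rw [hm] at hf; exact Nat.coprime_of_squarefree_mul hf
  have hsm : s.Coprime m := by
    refine Nat.Coprime.symm (Nat.coprime_of_dvd fun p hp hpm hps => ?_)
    have : p ∣ t := Nat.dvd_gcd (hm ▸ hpm.mul_left t) hps
    exact hp.one_lt.ne' (Nat.dvd_one.1 (htm ▸ Nat.dvd_gcd this hpm))
  have hcop : (s ^ 2 * t).Coprime m := Nat.Coprime.mul_left (hsm.pow_left 2) htm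
  have hqe : q = s ^ 2 * t * m := by rw [← hq, hm]; ring
  have ht0 : t ≠ 0 := by rintro h; rw [h] at hm; simp at hm; exact hf0 hm
  have hm0 : m ≠ 0 := by rintro rfl; simp at hm; exact hf0 hm
  have hmsq : Squarefree m := hf.squarefree_of_dvd ⟨t, by rw [hm]; ring⟩
  refine ⟨s, t, Nat.pos_of_ne_zero hs, Nat.gcd_dvd_right f s, ⟨m, hqe⟩, ?_⟩
  clear_value t
  subst hqe
  have : NeZero m := ⟨hm0⟩
  have : NeZero (s ^ 2 * t) := ⟨mul_ne_zero (pow_ne_zero 2 hs) ht0⟩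
  refine kloostermanBound_mono
    (kloostermanBound_mul hcop kloostermanBound_card (kloostermanBound_squarefree hmsq)) ?_
  rw [Nat.card_zmod]
  have h1 : (m.divisors.card : ℝ) ≤ (s ^ 2 * t * m).divisors.card := by
    exact_mod_cast Finset.card_le_card
      (Nat.divisors_subset_of_dvd hq0 ⟨s ^ 2 * t, by ring⟩)
  have h2 : √((s ^ 2 * t * m : ℕ) : ℝ) = √((s ^ 2 * t : ℕ) : ℝ) * √m := by
    rw [Nat.cast_mul (s ^ 2 * t) m, Real.sqrt_mul (Nat.cast_nonneg _)]
  rw [h2]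
  have h3 : √((s ^ 2 * t : ℕ) : ℝ) * √((s ^ 2 * t : ℕ) : ℝ) = ((s ^ 2 * t : ℕ) : ℝ) :=
    Real.mul_self_sqrt (Nat.cast_nonneg _)
  calc ((s ^ 2 * t : ℕ) : ℝ) * (m.divisors.card * √m)
      = m.divisors.card * ((√((s ^ 2 * t : ℕ) : ℝ) * √((s ^ 2 * t : ℕ) : ℝ)) * √m) := by
        rw [h3]; ring
    _ ≤ (s ^ 2 * t * m).divisors.card *
        ((√((s ^ 2 * t : ℕ) : ℝ) * √((s ^ 2 * t : ℕ) : ℝ)) * √m) := by gcongr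
    _ = _ := by ring

theorem card_divisors_le_rpow {δ : ℝ} (hδ : 0 < δ) :
    ∃ C : ℝ, 1 ≤ C ∧ ∀ n : ℕ, n ≠ 0 → (n.divisors.card : ℝ) ≤ C * (n : ℝ) ^ δ := by
  set K : ℝ := max 1 (1 / (δ * Real.log 2)) with hK
  have hK1 : 1 ≤ K := le_max_left _ _
  have hlog : 0 < Real.log 2 := Real.log_pos (by norm_num)
  set N : ℕ := ⌈(2 : ℝ) ^ (1 / δ)⌉₊ with hN
  refine ⟨K ^ N, one_le_pow₀ hK1, fun n hn => ?_⟩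
  have hpt : ∀ p ∈ n.primeFactors, ((n.factorization p + 1 : ℕ) : ℝ) ≤
      (if p < N then K else 1) * ((p : ℝ) ^ n.factorization p) ^ δ := by
    intro p hp
    have hp2 : (2 : ℝ) ≤ p := by exact_mod_cast (Nat.prime_of_mem_primeFactors hp).two_le
    set a := n.factorization p
    rw [← Real.rpow_natCast_mul (by positivity), mul_comm (a : ℝ) δ,
      Real.rpow_mul_natCast (by positivity)]
    split_ifs with h
    · have h1 : 1 + δ * a * Real.log 2 ≤ ((p : ℝ) ^ δ) ^ a := by
        calc 1 + δ * a * Real.log 2 ≤ Real.exp (Real.log 2 * (δ * a)) := by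
              have := Real.add_one_le_exp (Real.log 2 * (δ * a)); linarith
          _ = (2 : ℝ) ^ (δ * a) := by rw [Real.rpow_def_of_pos (by norm_num)]
          _ ≤ (p : ℝ) ^ (δ * a) := Real.rpow_le_rpow (by norm_num) hp2 (by positivity)
          _ = _ := Real.rpow_mul_natCast (by positivity) _ _
      have h2 : (a : ℝ) ≤ K * (δ * a * Real.log 2) := by
        have : 1 / (δ * Real.log 2) ≤ K := le_max_right _ _
        rw [div_le_iff₀ (by positivity)] at this
        have := mul_le_mul_of_nonneg_right this (Nat.cast_nonneg (α := ℝ) a)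
        nlinarith
      push_cast
      nlinarith [mul_le_mul_of_nonneg_left h1 (by linarith : (0 : ℝ) ≤ K)]
    · rw [one_mul]
      have h1 : (2 : ℝ) ≤ (p : ℝ) ^ δ := by
        have : (2 : ℝ) ^ (1 / δ) ≤ p := by
          refine (Nat.le_ceil _).trans ?_
          exact_mod_cast not_lt.1 h
        calc (2 : ℝ) = ((2 : ℝ) ^ (1 / δ)) ^ δ := by
              rw [← Real.rpow_mul (by norm_num)]; field_simp; simp
          _ ≤ _ := Real.rpow_le_rpow (by positivity) this hδ.le
      calc ((a + 1 : ℕ) : ℝ) ≤ (2 : ℝ) ^ a := by exact_mod_cast Nat.lt_two_pow_self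
        _ ≤ _ := pow_le_pow_left₀ (by norm_num) h1 a
  rw [Nat.card_divisors hn, Nat.cast_prod]
  refine (Finset.prod_le_prod (fun _ _ => Nat.cast_nonneg _) hpt).trans ?_
  rw [Finset.prod_mul_distrib]
  refine mul_le_mul ?_ (le_of_eq ?_) (Finset.prod_nonneg fun _ _ => by positivity) (by positivity)
  · rw [← Finset.prod_filter, Finset.prod_const]
    refine pow_le_pow_right₀ hK1 ?_
    calc _ ≤ (Finset.range N).card := Finset.card_le_card fun p hp => by
          rw [Finset.mem_filter] at hp; exact Finset.mem_range.2 hp.2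
      _ = N := Finset.card_range N
  · rw [Real.finsetProd_rpow _ _ (fun _ _ => by positivity)]
    congr 1
    have := Nat.prod_factorization_pow_eq_self hn
    conv_rhs => rw [← this]
    rw [Finsupp.prod, Nat.support_factorization]
    push_cast
    rfl

end DivisorBounds

section SumOverModuli

/-- The saving for a single modulus `q` with powerful part `r`. -/
noncomputable def modulusError (Q r q : ℕ) : ℝ := min (1 / (q : ℝ)) (√r / (√q * (Q + 1 - q)))

theorem modulusError_nonneg {Q r q : ℕ} (h : q ≤ Q) : 0 ≤ modulusError Q r q := by
  have : (q : ℝ) ≤ Q := by exact_mod_cast h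
  refine le_min (by positivity) (div_nonneg (by positivity) (mul_nonneg (by positivity) ?_))
  linarith

theorem sum_modulusError_le {Q r : ℕ} (hr : 0 < r) :
    ∑ q ∈ (Finset.Icc 1 Q).filter (r ∣ ·), modulusError Q r q ≤
      5 * (1 + Real.log Q) / (√Q * √r) := by
  set n := Q / r with hn
  have hset : (Finset.Icc 1 Q).filter (r ∣ ·) = (Finset.Icc 1 n).image (r * ·) := by
    ext q
    simp only [Finset.mem_filter, Finset.mem_Icc, Finset.mem_image]
    constructor
    · rintro ⟨⟨h1, h2⟩, k, rfl⟩
      exact ⟨k, ⟨Nat.pos_of_mul_pos_left h1, (Nat.le_div_iff_mul_le hr).2 (by linarith)⟩, rfl⟩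
    · rintro ⟨k, ⟨h1, h2⟩, rfl⟩
      have := (Nat.le_div_iff_mul_le hr).1 h2
      exact ⟨⟨Nat.mul_pos hr h1, by linarith⟩, k, rfl⟩
  rw [hset, Finset.sum_image (fun a _ b _ h => Nat.eq_of_mul_eq_mul_left hr h)]
  have hr' : (0 : ℝ) < r := by exact_mod_cast hr
  have hr1 : (1 : ℝ) ≤ r := by exact_mod_cast hr
  rcases Nat.eq_zero_or_pos n with h0 | hnpos
  · rw [h0]; simp
    have : 0 ≤ Real.log Q := Real.log_natCast_nonneg _
    positivity
  have hrn : r * n ≤ Q := Nat.mul_div_le Q r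
  have hQn : Q < r * (n + 1) := by
    have := Nat.lt_mul_div_succ Q hr; simpa using this
  have hn1 : (1 : ℝ) ≤ n := by exact_mod_cast hnpos
  have hrnR : (r : ℝ) * n ≤ Q := by exact_mod_cast hrn
  have hQnR : (Q : ℝ) < r * (n + 1) := by exact_mod_cast hQn
  have hQ1 : (1 : ℝ) ≤ Q := by nlinarith
  have hrQ : (r : ℝ) ≤ Q := by nlinarith
  have hL : 0 ≤ Real.log Q := Real.log_nonneg hQ1
  obtain ⟨k, hk⟩ : ∃ k, n = k + 1 := ⟨n - 1, by omega⟩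
  have hsplit : Finset.Icc 1 n = insert n (Finset.Ico 1 n) := by
    ext x; simp only [Finset.mem_Icc, Finset.mem_insert, Finset.mem_Ico]; omega
  rw [hsplit, Finset.sum_insert (by simp)]
  have hsq : √(Q : ℝ) * √r ≤ Q := by
    calc √(Q : ℝ) * √r ≤ √(Q : ℝ) * √Q := by gcongr
      _ = Q := Real.mul_self_sqrt (by positivity)
  have hpos : 0 < √(Q : ℝ) * √r := by positivity
  have hfirst : modulusError Q r (r * n) ≤ 2 / (√Q * √r) := by
    refine (min_le_left _ _).trans ?_
    push_cast
    rw [div_le_div_iff₀ (by positivity) hpos]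
    nlinarith
  have hsqn : 1 / (r * √n) ≤ √2 / (√Q * √r) := by
    rw [div_le_div_iff₀ (by positivity) hpos]
    have h1 : √(Q : ℝ) ≤ √2 * √r * √n := by
      rw [← Real.sqrt_mul (by norm_num), ← Real.sqrt_mul (by positivity)]
      exact Real.sqrt_le_sqrt (by nlinarith)
    calc 1 * (√(Q : ℝ) * √r) ≤ √2 * √r * √n * √r := by rw [one_mul]; gcongr
      _ = √2 * ((√r * √r) * √n) := by ring
      _ = _ := by rw [Real.mul_self_sqrt hr'.le]
  have hterm : ∀ k ∈ Finset.Ico 1 n, modulusError Q r (r * k) ≤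
      1 / (r * √n) * (1 / (k : ℝ) + 1 / ((n - k : ℕ) : ℝ)) := by
    intro k hk
    rw [Finset.mem_Ico] at hk
    have hk1 : (1 : ℝ) ≤ k := by exact_mod_cast hk.1
    have hkn : (k : ℝ) < n := by exact_mod_cast hk.2
    refine (min_le_right _ _).trans ?_
    rw [Nat.cast_sub hk.2.le]
    push_cast
    rw [Real.sqrt_mul hr'.le]
    have h1 : (r : ℝ) * (n - k) ≤ Q + 1 - r * k := by linarith
    have h2 : (0 : ℝ) < n - k := by linarith
    have hsr : 0 < √(r : ℝ) := by positivity
    have hsk : 0 < √(k : ℝ) := by positivity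
    have hsn : 0 < √(n : ℝ) := by positivity
    calc √(r : ℝ) / (√r * √k * (Q + 1 - r * k)) ≤ √(r : ℝ) / (√r * √k * (r * (n - k))) := by
          gcongr
      _ = √k / (r * (k * (n - k))) := by
          have : (k : ℝ) = √k * √k := (Real.mul_self_sqrt (by positivity)).symm
          rw [div_eq_div_iff (by positivity) (by positivity)]
          calc √(r : ℝ) * (r * (k * (n - k))) = √(r : ℝ) * (r * (n - k)) * k := by ring
            _ = √(r : ℝ) * (r * (n - k)) * (√k * √k) := by rw [← this]
            _ = _ := by ring
      _ ≤ √n / (r * (k * (n - k))) := by gcongr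
      _ = _ := by
          have : (n : ℝ) = √n * √n := (Real.mul_self_sqrt (by positivity)).symm
          have e : 1 / (k : ℝ) + 1 / (n - k) = n / (k * (n - k)) := by field_simp; ring
          rw [e]
          rw [div_mul_div_comm, one_mul, div_eq_div_iff (by positivity) (by positivity)]
          calc √(n : ℝ) * (r * √n * (k * (n - k))) = (√n * √n) * (r * (k * (n - k))) := by ring
            _ = _ := by rw [← this]
  have hharm : ∑ k ∈ Finset.Ico 1 n, (1 / (k : ℝ) + 1 / ((n - k : ℕ) : ℝ)) ≤
      2 * (1 + Real.log Q) := by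
    have h1 : ∑ k ∈ Finset.Ico 1 n, 1 / (k : ℝ) ≤ 1 + Real.log Q := by
      calc _ ≤ ∑ k ∈ Finset.Icc 1 n, 1 / (k : ℝ) :=
            Finset.sum_le_sum_of_subset_of_nonneg Finset.Ico_subset_Icc_self
              (fun _ _ _ => by positivity)
        _ ≤ 1 + Real.log n := sum_inv_Icc_le n
        _ ≤ _ := by
          have : (n : ℝ) ≤ Q := by nlinarith
          have := Real.log_le_log (by linarith) this
          linarith
    have h2 : ∑ k ∈ Finset.Ico 1 n, 1 / ((n - k : ℕ) : ℝ) = ∑ k ∈ Finset.Ico 1 n, 1 / (k : ℝ) := by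
      refine Finset.sum_nbij' (fun k => n - k) (fun k => n - k) ?_ ?_ ?_ ?_ ?_ <;>
        intro a ha <;> simp only [Finset.mem_Ico] at ha ⊢ <;> omega
    rw [Finset.sum_add_distrib, h2]; linarith
  have hrest : ∑ k ∈ Finset.Ico 1 n, modulusError Q r (r * k) ≤
      √2 / (√Q * √r) * (2 * (1 + Real.log Q)) := by
    refine (Finset.sum_le_sum hterm).trans ?_
    rw [← Finset.mul_sum]
    exact mul_le_mul hsqn hharm (Finset.sum_nonneg fun _ _ => by positivity) (by positivity)
  refine (add_le_add hfirst hrest).trans ?_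
  rw [div_mul_eq_mul_div, ← add_div]
  gcongr
  have : √2 ≤ 3 / 2 := by
    rw [Real.sqrt_le_left (by norm_num)]; norm_num
  nlinarith

theorem sum_le_of_le_modulusError {Q : ℕ} {M A : ℝ} (hA : 0 ≤ A) {f : ℕ → ℝ}
    (hM : 1 + Real.log Q ≤ M) (hτ : ∀ n, n ≠ 0 → n ≤ Q → (n.divisors.card : ℝ) ≤ M)
    (hf : ∀ q ∈ Finset.Icc 1 Q, ∃ s t : ℕ, 0 < s ∧ t ∣ s ∧ s ^ 2 * t ∣ q ∧
      f q ≤ A * modulusError Q (s ^ 2 * t) q) :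
    ∑ q ∈ Finset.Icc 1 Q, f q ≤ A * (5 * M ^ 3 / √Q) := by
  have hL : 0 ≤ Real.log Q := Real.log_natCast_nonneg _
  have hM0 : 0 ≤ M := by linarith
  have h1 : ∀ q ∈ Finset.Icc 1 Q, f q ≤ A * ∑ s ∈ Finset.Icc 1 Q, ∑ t ∈ s.divisors,
      if s ^ 2 * t ∣ q then modulusError Q (s ^ 2 * t) q else 0 := by
    intro q hq
    obtain ⟨s, t, hs, ht, hd, hle⟩ := hf q hq
    rw [Finset.mem_Icc] at hq
    have hnn : ∀ s t, 0 ≤ (if s ^ 2 * t ∣ q then modulusError Q (s ^ 2 * t) q else 0) := by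
      intro s t
      split_ifs
      · exact modulusError_nonneg hq.2
      · exact le_rfl
    refine hle.trans (mul_le_mul_of_nonneg_left ?_ hA)
    have hsQ : s ∈ Finset.Icc 1 Q := by
      rw [Finset.mem_Icc]
      refine ⟨hs, (Nat.le_of_dvd (by omega) ?_).trans hq.2⟩
      exact (Dvd.intro (s * t) (by ring)).trans hd
    refine le_trans ?_ (Finset.single_le_sum (f := fun s => ∑ t ∈ s.divisors,
      if s ^ 2 * t ∣ q then modulusError Q (s ^ 2 * t) q else 0)
      (fun s _ => Finset.sum_nonneg fun t _ => hnn s t) hsQ)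
    refine le_trans ?_ (Finset.single_le_sum (f := fun t =>
      if s ^ 2 * t ∣ q then modulusError Q (s ^ 2 * t) q else 0)
      (fun t _ => hnn s t) (Nat.mem_divisors.2 ⟨ht, hs.ne'⟩))
    simp [hd]
  refine (Finset.sum_le_sum h1).trans ?_
  rw [← Finset.mul_sum]
  refine mul_le_mul_of_nonneg_left ?_ hA
  rw [Finset.sum_comm]
  calc ∑ s ∈ Finset.Icc 1 Q, ∑ q ∈ Finset.Icc 1 Q, ∑ t ∈ s.divisors,
      (if s ^ 2 * t ∣ q then modulusError Q (s ^ 2 * t) q else 0)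
      ≤ ∑ s ∈ Finset.Icc 1 Q, (5 * M ^ 2 / √Q) * (1 / (s : ℝ)) := by
        refine Finset.sum_le_sum fun s hs => ?_
        rw [Finset.mem_Icc] at hs
        have hs0 : (0 : ℝ) < s := by exact_mod_cast hs.1
        rw [Finset.sum_comm]
        calc _ ≤ ∑ t ∈ s.divisors, 5 * M / (√Q * s) := by
              refine Finset.sum_le_sum fun t ht => ?_
              have htp : 0 < t := Nat.pos_of_mem_divisors ht
              have ht1 : (1 : ℝ) ≤ t := by exact_mod_cast htp
              have hQ0 : (0 : ℝ) < Q := by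
                exact_mod_cast (show 0 < Q by omega)
              rw [← Finset.sum_filter]
              refine (sum_modulusError_le (Nat.mul_pos (pow_pos hs.1 2) htp)).trans ?_
              push_cast
              have : (s : ℝ) ≤ √(s ^ 2 * t) := by
                refine Real.le_sqrt_of_sq_le ?_
                nlinarith [sq_nonneg (s : ℝ)]
              gcongr
          _ = s.divisors.card * (5 * M / (√Q * s)) := by rw [Finset.sum_const, nsmul_eq_mul]
          _ ≤ M * (5 * M / (√Q * s)) := by
              have := hτ s (by omega) hs.2
              gcongr
          _ = _ := by
            have hQ0 : (0 : ℝ) < √Q := by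
              rw [Real.sqrt_pos]
              exact_mod_cast (show 0 < Q by omega)
            field_simp
    _ = (5 * M ^ 2 / √Q) * ∑ s ∈ Finset.Icc 1 Q, 1 / (s : ℝ) := by rw [Finset.mul_sum]
    _ ≤ (5 * M ^ 2 / √Q) * M := by
        gcongr
        exact (sum_inv_Icc_le Q).trans hM
    _ = _ := by ring

end SumOverModuli

section WeightedHyperbola

theorem abs_sum_range_mul_le_of_antitone {f d : ℕ → ℝ} {E : ℝ} (hf : Antitone f)
    (hf0 : ∀ i, 0 ≤ f i) (n : ℕ) (hd : ∀ k ≤ n, |∑ i ∈ Finset.range k, d i| ≤ E) :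
    |∑ i ∈ Finset.range n, f i * d i| ≤ f 0 * E := by
  have key : ∀ n, ∑ i ∈ Finset.range n, f i * d i =
      ∑ i ∈ Finset.range n, (f i - f (i + 1)) * (∑ j ∈ Finset.range (i + 1), d j) +
        f n * ∑ j ∈ Finset.range n, d j := by
    intro n
    induction n with
    | zero => simp
    | succ n ih => rw [Finset.sum_range_succ, ih, Finset.sum_range_succ _ n,
        Finset.sum_range_succ _ n]; ring
  have tel : ∀ n, ∑ i ∈ Finset.range n, (f i - f (i + 1)) = f 0 - f n := fun n =>
    Finset.sum_range_sub' f n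
  rw [key]
  calc _ ≤ ∑ i ∈ Finset.range n, (f i - f (i + 1)) * E + f n * E := by
        refine (abs_add_le _ _).trans (add_le_add ?_ ?_)
        · refine (Finset.abs_sum_le_sum_abs _ _).trans (Finset.sum_le_sum fun i hi => ?_)
          have h0 : 0 ≤ f i - f (i + 1) := sub_nonneg.2 (hf (Nat.le_succ i))
          rw [abs_mul, abs_of_nonneg h0]
          exact mul_le_mul_of_nonneg_left (hd _ (Finset.mem_range.1 hi)) h0
        · rw [abs_mul, abs_of_nonneg (hf0 n)]
          exact mul_le_mul_of_nonneg_left (hd n le_rfl) (hf0 n)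
    _ = _ := by rw [← Finset.sum_mul, tel]; ring

theorem abs_sum_Ico_mul_le_of_antitone {f d : ℕ → ℝ} {E : ℝ} {A : ℕ} (hf : ∀ i j, A ≤ i → i ≤ j →
    f j ≤ f i) (hf0 : ∀ i, A ≤ i → 0 ≤ f i) (n : ℕ)
    (hd : ∀ k, k ≤ n → |∑ i ∈ Finset.Ico A k, d i| ≤ E) :
    |∑ i ∈ Finset.Ico A n, f i * d i| ≤ f A * E := by
  rw [Finset.sum_Ico_eq_sum_range]
  refine abs_sum_range_mul_le_of_antitone (f := fun i => f (A + i)) (d := fun i => d (A + i))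
    (fun i j h => hf _ _ (by omega) (by omega)) (fun i => hf0 _ (by omega)) _ fun k hk => ?_
  rcases Nat.eq_zero_or_pos k with rfl | hkp
  · simpa using (abs_nonneg _).trans (hd 0 (by omega))
  have := hd (A + k) (by omega)
  rwa [Finset.sum_Ico_eq_sum_range, Nat.add_sub_cancel_left] at this

/-- Length of the part of a Farey gap, with denominators `q` and `y`, that survives. -/
noncomputable def gapLength (ε X : ℝ) (q y : ℕ) : ℝ :=
  1 / (y : ℝ) * (1 / (q : ℝ) - if (y : ℝ) ≤ X then ε else 0)

theorem gapLength_nonneg {ε X : ℝ} {q y : ℕ} (hε0 : 0 ≤ ε) (hε : ε ≤ 1 / q) :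
    0 ≤ gapLength ε X q y := by
  refine mul_nonneg (by positivity) ?_
  split_ifs <;> linarith

theorem gapLength_le {ε X : ℝ} {q y : ℕ} (hε0 : 0 ≤ ε) :
    gapLength ε X q y ≤ 1 / q * (1 / (y : ℝ)) := by
  rw [gapLength, mul_comm]
  refine mul_le_mul_of_nonneg_right ?_ (by positivity)
  split_ifs <;> linarith

theorem sum_gapLength_le_log {ε X : ℝ} {Q q : ℕ} (hε0 : 0 ≤ ε) :
    ∑ y ∈ Finset.Ico (Q - q + 1) (Q + 1), gapLength ε X q y ≤ 1 / q * (1 + Real.log Q) := by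
  refine (Finset.sum_le_sum fun y _ => gapLength_le hε0).trans ?_
  rw [← Finset.mul_sum]
  refine mul_le_mul_of_nonneg_left ?_ (by positivity)
  refine le_trans ?_ (sum_inv_Icc_le Q)
  refine Finset.sum_le_sum_of_subset_of_nonneg (fun y hy => ?_) (fun _ _ _ => by positivity)
  rw [Finset.mem_Ico] at hy; rw [Finset.mem_Icc]; omega

theorem sum_gapLength_le {ε X : ℝ} {Q q : ℕ} (hq : 1 ≤ q) (hqQ : q ≤ Q) (hε0 : 0 ≤ ε) :
    ∑ y ∈ Finset.Ico (Q - q + 1) (Q + 1), gapLength ε X q y ≤ 1 / ((Q - q + 1 : ℕ) : ℝ) := by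
  have hq0 : (0 : ℝ) < q := by exact_mod_cast hq
  calc _ ≤ ∑ y ∈ Finset.Ico (Q - q + 1) (Q + 1), 1 / (q : ℝ) * (1 / ((Q - q + 1 : ℕ) : ℝ)) := by
        refine Finset.sum_le_sum fun y hy => (gapLength_le hε0).trans ?_
        rw [Finset.mem_Ico] at hy
        have : ((Q - q + 1 : ℕ) : ℝ) ≤ y := by exact_mod_cast hy.1
        gcongr
    _ = _ := by
      rw [Finset.sum_const, Nat.card_Ico, nsmul_eq_mul]
      have : Q + 1 - (Q - q + 1) = q := by omega
      rw [this]; field_simp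

variable {q : ℕ}

theorem card_filter_hyperbola_le_one (s y : ZMod q) {a c : ℕ} (hc : c ≤ q) :
    ((Finset.Ico a c).filter fun b : ℕ => s * b * y = 1).card ≤ 1 := by
  rw [Finset.card_le_one]
  intro b hb b' hb'
  rw [Finset.mem_filter, Finset.mem_Ico] at hb hb'
  have h : (b : ZMod q) = b' := by
    linear_combination (b' : ZMod q) * hb.2 - (b : ZMod q) * hb'.2
  rw [ZMod.natCast_eq_natCast_iff] at h
  exact Nat.ModEq.eq_of_lt_of_lt h (by omega) (by omega)

variable [NeZero q]

theorem abs_sum_gapLength_mul_sub_le {B : ℝ} (hB : KloostermanBound (ZMod q) B) (hB0 : 0 ≤ B)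
    (s : (ZMod q)ˣ) {a c Q : ℕ} (hc : c ≤ q) (hqQ : q ≤ Q) {ε X : ℝ} (hε0 : 0 ≤ ε)
    (hε : ε ≤ 1 / q) :
    |∑ y ∈ Finset.Ico (Q - q + 1) (Q + 1), gapLength ε X q y *
        (((Finset.Ico a c).filter fun b : ℕ => (s : ZMod q) * b * y = 1).card : ℝ) -
      (Finset.Ico a c).card * q.totient / (q : ℝ) ^ 2 *
        ∑ y ∈ Finset.Ico (Q - q + 1) (Q + 1), gapLength ε X q y| ≤
      min (1 / q * (1 + Real.log Q))
        (2 * (4 * B * q.divisors.card * (1 + Real.log q) ^ 2) / (q * (Q + 1 - q))) := by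
  have hq1 : 1 ≤ q := Nat.pos_of_ne_zero (NeZero.ne q)
  have hq : (0 : ℝ) < q := by exact_mod_cast hq1
  set N : ℕ → ℝ := fun y =>
    (((Finset.Ico a c).filter fun b : ℕ => (s : ZMod q) * b * y = 1).card : ℝ) with hN
  set ρ : ℝ := (Finset.Ico a c).card * q.totient / (q : ℝ) ^ 2 with hρ
  set A := Q - q + 1 with hA
  have hN1 : ∀ y, N y ≤ 1 := fun y => by
    rw [hN, Nat.cast_le_one]
    exact card_filter_hyperbola_le_one (s : ZMod q) (y : ZMod q) hc
  have hN0 : ∀ y, 0 ≤ N y := fun y => Nat.cast_nonneg _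
  have hρ0 : 0 ≤ ρ := by positivity
  have hρ1 : ρ ≤ 1 := by
    rw [hρ, div_le_one (by positivity), Nat.card_Ico, sq]
    have h1 : ((c - a : ℕ) : ℝ) ≤ q := by exact_mod_cast (by omega : c - a ≤ q)
    have h2 : (q.totient : ℝ) ≤ q := by exact_mod_cast Nat.totient_le q
    gcongr
  have hh0 : ∀ y, 0 ≤ gapLength ε X q y := fun y => gapLength_nonneg hε0 hε
  have hlog := sum_gapLength_le_log (X := X) (Q := Q) (q := q) hε0
  have hsum0 : 0 ≤ ∑ y ∈ Finset.Ico A (Q + 1), gapLength ε X q y :=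
    Finset.sum_nonneg fun y _ => hh0 y
  refine le_min ?_ ?_
  · rw [abs_le]
    have h1 : 0 ≤ ∑ y ∈ Finset.Ico A (Q + 1), gapLength ε X q y * N y :=
      Finset.sum_nonneg fun y _ => mul_nonneg (hh0 y) (hN0 y)
    have h2 : ∑ y ∈ Finset.Ico A (Q + 1), gapLength ε X q y * N y ≤
        ∑ y ∈ Finset.Ico A (Q + 1), gapLength ε X q y :=
      Finset.sum_le_sum fun y _ => mul_le_of_le_one_right (hh0 y) (hN1 y)
    have h3 := mul_le_of_le_one_left hsum0 hρ1
    have h4 := mul_nonneg hρ0 hsum0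
    constructor <;> linarith
  · set E := 4 * B * q.divisors.card * (1 + Real.log q) ^ 2 with hE
    have hA1 : (1 : ℝ) ≤ A := by rw [hA]; push_cast; linarith [Nat.cast_nonneg (α := ℝ) (Q - q)]
    have hAR : (A : ℝ) = Q + 1 - q := by rw [hA, Nat.cast_add, Nat.cast_sub hqQ]; push_cast; ring
    have hd : ∀ k, k ≤ Q + 1 → |∑ y ∈ Finset.Ico A k, (N y - ρ)| ≤ E := by
      intro k hk
      have := abs_hyperbolaCount_sub_le hB hB0 s (a := a) (c := c) (a' := A) (c' := k)
        (by omega) (by omega)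
      rw [Finset.sum_sub_distrib, Finset.sum_const, nsmul_eq_mul]
      unfold hyperbolaCount at this
      push_cast at this
      rw [hρ]
      convert this using 3
      ring
    have hE0 : 0 ≤ E := (abs_nonneg _).trans (hd 0 (by omega))
    have e1 := abs_sum_Ico_mul_le_of_antitone (f := fun y : ℕ => 1 / (q : ℝ) * (1 / (y : ℝ)))
      (A := A) (d := fun y => N y - ρ) (fun i j hi hij => by
        have : (0 : ℝ) < i := lt_of_lt_of_le (by linarith) (Nat.cast_le.2 hi)
        have : (i : ℝ) ≤ j := by exact_mod_cast hij
        gcongr) (fun i _ => by positivity) (Q + 1) hd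
    have e2 := abs_sum_Ico_mul_le_of_antitone
      (f := fun y : ℕ => if (y : ℝ) ≤ X then ε * (1 / (y : ℝ)) else 0)
      (A := A) (d := fun y => N y - ρ) (fun i j hi hij => by
        have : (0 : ℝ) < i := lt_of_lt_of_le (by linarith) (Nat.cast_le.2 hi)
        have hij' : (i : ℝ) ≤ j := by exact_mod_cast hij
        by_cases hj : (j : ℝ) ≤ X
        · rw [if_pos hj, if_pos (hij'.trans hj)]; gcongr
        · rw [if_neg hj]; split_ifs <;> positivity) (fun i _ => by
        split_ifs <;> positivity) (Q + 1) hd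
    have e3 : ∑ y ∈ Finset.Ico A (Q + 1), gapLength ε X q y * N y -
        ρ * ∑ y ∈ Finset.Ico A (Q + 1), gapLength ε X q y =
        ∑ y ∈ Finset.Ico A (Q + 1), 1 / (q : ℝ) * (1 / (y : ℝ)) * (N y - ρ) -
        ∑ y ∈ Finset.Ico A (Q + 1), (if (y : ℝ) ≤ X then ε * (1 / (y : ℝ)) else 0) *
          (N y - ρ) := by
      rw [Finset.mul_sum, ← Finset.sum_sub_distrib, ← Finset.sum_sub_distrib]
      refine Finset.sum_congr rfl fun y _ => ?_
      unfold gapLength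
      split_ifs <;> ring
    rw [e3]
    refine (abs_sub _ _).trans ((add_le_add e1 e2).trans ?_)
    have h5 : (if (A : ℝ) ≤ X then ε * (1 / (A : ℝ)) else 0) ≤ 1 / (q : ℝ) * (1 / A) := by
      split_ifs
      · gcongr
      · positivity
    calc _ ≤ 1 / (q : ℝ) * (1 / A) * E + 1 / (q : ℝ) * (1 / A) * E := by
          have := mul_le_mul_of_nonneg_right h5 hE0
          linarith
      _ = _ := by rw [← hAR]; field_simp; ring

end WeightedHyperbola

theorem sum_inv_mul_inv_le {Q : ℕ} (hQ : 1 ≤ Q) :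
    ∑ q ∈ Finset.Icc 1 Q, 1 / (q : ℝ) * (1 / ((Q - q + 1 : ℕ) : ℝ)) ≤
      2 * (1 + Real.log Q) / Q := by
  have hQ0 : (0 : ℝ) < Q := by exact_mod_cast hQ
  have h2 : ∑ q ∈ Finset.Icc 1 Q, 1 / ((Q - q + 1 : ℕ) : ℝ) =
      ∑ k ∈ Finset.Icc 1 Q, 1 / (k : ℝ) := by
    refine Finset.sum_nbij' (fun k => Q - k + 1) (fun k => Q - k + 1) ?_ ?_ ?_ ?_ ?_ <;>
      intro a ha <;> simp only [Finset.mem_Icc] at ha ⊢ <;> omega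
  calc _ = ∑ q ∈ Finset.Icc 1 Q, 1 / ((Q : ℝ) + 1) * (1 / (q : ℝ) + 1 / ((Q - q + 1 : ℕ) : ℝ)) := by
        refine Finset.sum_congr rfl fun q hq => ?_
        rw [Finset.mem_Icc] at hq
        have h1 : (0 : ℝ) < q := by exact_mod_cast hq.1
        have h3 : (0 : ℝ) < ((Q - q + 1 : ℕ) : ℝ) := by positivity
        have h4 : (Q : ℝ) + 1 = q + ((Q - q + 1 : ℕ) : ℝ) := by
          exact_mod_cast (show Q + 1 = q + (Q - q + 1) by omega)
        rw [h4]
        field_simp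
        ring
    _ = 1 / ((Q : ℝ) + 1) * (2 * ∑ k ∈ Finset.Icc 1 Q, 1 / (k : ℝ)) := by
        rw [← Finset.mul_sum, Finset.sum_add_distrib, h2]; ring
    _ ≤ 1 / (Q : ℝ) * (2 * (1 + Real.log Q)) := by
        gcongr
        · linarith
        · exact sum_inv_Icc_le Q
    _ = _ := by ring

/-- The sum of the surviving gap lengths over all gaps with left (or right) endpoint
`1 - l b / q`, where `b` lies in `J q`. -/
noncomputable def gapSum (l : ℕ) (s : ℤ) (ε X : ℝ) (Q : ℕ) (J : ℕ → Finset ℕ) : ℝ :=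
  ∑ q ∈ (Finset.Icc 1 Q).filter (Nat.Coprime l),
    ∑ y ∈ Finset.Ico (Q - q + 1) (Q + 1), gapLength ε X q y *
      (((J q).filter fun b : ℕ => ((s : ZMod q)) * b * y = 1).card : ℝ)

theorem abs_gapSum_sub_le {l : ℕ} {s : ℤ} (hs : s.natAbs = l) {Q : ℕ} (hQ : 1 ≤ Q) {M : ℝ}
    (hM : 1 + Real.log Q ≤ M) (hτ : ∀ n, n ≠ 0 → n ≤ Q → (n.divisors.card : ℝ) ≤ M)
    {ε X Z : ℝ} (hε0 : 0 ≤ ε) (hε : ε ≤ 1 / Q) {a c : ℕ → ℕ} {J : ℕ → Finset ℕ}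
    (hJ : ∀ q ∈ Finset.Icc 1 Q, J q = Finset.Ico (a q) (c q) ∧ c q ≤ q ∧
      |((J q).card : ℝ) - q * Z| ≤ 2) :
    |gapSum l s ε X Q J - Z * ∑ q ∈ (Finset.Icc 1 Q).filter (Nat.Coprime l),
      (q.totient / q : ℝ) * ∑ y ∈ Finset.Ico (Q - q + 1) (Q + 1), gapLength ε X q y| ≤
      44 * M ^ 7 / √Q := by
  have hL : 0 ≤ Real.log Q := Real.log_natCast_nonneg _
  have hM1 : 1 ≤ M := by linarith
  have hQ0 : (0 : ℝ) < Q := by exact_mod_cast hQ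
  have hQ1 : (1 : ℝ) ≤ Q := by exact_mod_cast hQ
  set H : ℕ → ℝ := fun q => ∑ y ∈ Finset.Ico (Q - q + 1) (Q + 1), gapLength ε X q y with hH
  set U : ℕ → ℝ := fun q => ∑ y ∈ Finset.Ico (Q - q + 1) (Q + 1), gapLength ε X q y *
      (((J q).filter fun b : ℕ => ((s : ZMod q)) * b * y = 1).card : ℝ) with hU
  set V : ℕ → ℝ := fun q => (J q).card * q.totient / (q : ℝ) ^ 2 * H q with hV
  have hεq : ∀ q ∈ Finset.Icc 1 Q, ε ≤ 1 / (q : ℝ) := by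
    intro q hq
    rw [Finset.mem_Icc] at hq
    have h1 : (0 : ℝ) < q := by exact_mod_cast hq.1
    have h2 : (q : ℝ) ≤ Q := by exact_mod_cast hq.2
    exact hε.trans (by gcongr)
  have hUV : ∑ q ∈ Finset.Icc 1 Q, (if l.Coprime q then |U q - V q| else 0) ≤
      (8 * M ^ 4) * (5 * M ^ 3 / √Q) := by
    refine sum_le_of_le_modulusError (by positivity) hM hτ fun q hq => ?_
    obtain ⟨hJ1, hJ2, -⟩ := hJ q hq
    have hq' := Finset.mem_Icc.1 hq
    have hqne : q ≠ 0 := by omega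
    have : NeZero q := ⟨hqne⟩
    obtain ⟨s₀, t, hs₀, ht, hd, hB⟩ := exists_kloostermanBound q
    refine ⟨s₀, t, hs₀, ht, hd, ?_⟩
    split_ifs with hcop
    swap
    · exact mul_nonneg (by positivity) (modulusError_nonneg hq'.2)
    have hunit : IsUnit (s : ZMod q) := by
      rw [ZMod.coe_int_isUnit_iff_isCoprime, Int.isCoprime_iff_gcd_eq_one, Int.gcd,
        Int.natAbs_natCast, hs]
      exact hcop.symm
    obtain ⟨u, hu⟩ := hunit
    have key := abs_sum_gapLength_mul_sub_le hB (by positivity) u (a := a q) (X := X) hJ2 hq'.2 hε0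
      (hεq q hq)
    rw [hu, ← hJ1] at key
    refine key.trans ?_
    unfold modulusError
    rw [mul_min_of_nonneg _ _ (by positivity)]
    have hq0 : (0 : ℝ) < q := by exact_mod_cast hq'.1
    have hqQ : (q : ℝ) ≤ Q := by exact_mod_cast hq'.2
    have hlq : 1 + Real.log q ≤ M := by
      have := Real.log_le_log hq0 hqQ; linarith
    have hlq0 : 0 ≤ Real.log q := Real.log_natCast_nonneg _
    have hτq := hτ q hqne hq'.2
    refine min_le_min ?_ ?_
    · rw [mul_comm]
      refine mul_le_mul_of_nonneg_right (hM.trans ?_) (by positivity)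
      have : M ^ 1 ≤ M ^ 4 := pow_le_pow_right₀ hM1 (by norm_num)
      linarith
    · have hx : (0 : ℝ) < Q + 1 - q := by linarith
      calc _ = 8 * ((q.divisors.card : ℝ) * q.divisors.card * (1 + Real.log q) ^ 2) *
            (√((s₀ ^ 2 * t : ℕ) : ℝ) / (√q * (Q + 1 - q))) := by
            have : (q : ℝ) = √q * √q := (Real.mul_self_sqrt hq0.le).symm
            have hsq : 0 < √(q : ℝ) := by positivity
            rw [mul_div_assoc', div_eq_div_iff (by positivity) (by positivity)]
            linear_combination (8 * q.divisors.card ^ 2 * (1 + Real.log q) ^ 2 *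
              √((s₀ ^ 2 * t : ℕ) : ℝ) * (Q + 1 - q)) * (-this)
        _ ≤ 8 * (M * M * M ^ 2) * (√((s₀ ^ 2 * t : ℕ) : ℝ) / (√q * (Q + 1 - q))) := by
            gcongr
        _ = _ := by ring
  have hVZ : ∑ q ∈ Finset.Icc 1 Q, (if l.Coprime q then
      |V q - Z * ((q.totient / q : ℝ) * H q)| else 0) ≤ 4 * M / √Q := by
    have hle : ∀ q ∈ Finset.Icc 1 Q, (if l.Coprime q then
      |V q - Z * ((q.totient / q : ℝ) * H q)| else 0) ≤
        2 * (1 / (q : ℝ) * (1 / ((Q - q + 1 : ℕ) : ℝ))) := by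
      intro q hq
      obtain ⟨-, -, hJ3⟩ := hJ q hq
      have hq' := Finset.mem_Icc.1 hq
      have hq0 : (0 : ℝ) < q := by exact_mod_cast hq'.1
      split_ifs
      swap
      · positivity
      have hH0 : 0 ≤ H q := Finset.sum_nonneg fun y _ => gapLength_nonneg hε0 (hεq q hq)
      have hH1 : H q ≤ 1 / ((Q - q + 1 : ℕ) : ℝ) := sum_gapLength_le hq'.1 hq'.2 hε0
      have e : V q - Z * ((q.totient / q : ℝ) * H q) =
          ((J q).card - q * Z) * (q.totient / (q : ℝ) ^ 2 * H q) := by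
        simp only [hV]; field_simp
      have hφ : (q.totient : ℝ) / (q : ℝ) ^ 2 ≤ 1 / q := by
        rw [div_le_div_iff₀ (by positivity) hq0]
        have : (q.totient : ℝ) ≤ q := by exact_mod_cast Nat.totient_le q
        nlinarith
      rw [e, abs_mul, abs_of_nonneg (by positivity : 0 ≤ (q.totient : ℝ) / (q : ℝ) ^ 2 * H q)]
      gcongr
    refine (Finset.sum_le_sum hle).trans ?_
    rw [← Finset.mul_sum]
    refine (mul_le_mul_of_nonneg_left (sum_inv_mul_inv_le hQ) (by norm_num)).trans ?_
    have hsq : √(Q : ℝ) ≤ Q := by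
      rw [Real.sqrt_le_left hQ0.le]; nlinarith
    have hsq0 : 0 < √(Q : ℝ) := by positivity
    calc 2 * (2 * (1 + Real.log Q) / Q) = 4 * (1 + Real.log Q) / Q := by ring
      _ ≤ 4 * M / √Q := by gcongr
  have hfin : |∑ q ∈ (Finset.Icc 1 Q).filter (Nat.Coprime l), U q -
      Z * ∑ q ∈ (Finset.Icc 1 Q).filter (Nat.Coprime l), (q.totient / q : ℝ) * H q| ≤
      ∑ q ∈ Finset.Icc 1 Q, (if l.Coprime q then |U q - V q| else 0) +
      ∑ q ∈ Finset.Icc 1 Q, (if l.Coprime q then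
      |V q - Z * ((q.totient / q : ℝ) * H q)| else 0) := by
    rw [← Finset.sum_filter, ← Finset.sum_filter, Finset.mul_sum, ← Finset.sum_sub_distrib,
      ← Finset.sum_add_distrib]
    refine (Finset.abs_sum_le_sum_abs _ _).trans (Finset.sum_le_sum fun q _ => ?_)
    exact abs_sub_le _ _ _
  refine hfin.trans ((add_le_add hUV hVZ).trans ?_)
  have : M ^ 1 ≤ M ^ 7 := pow_le_pow_right₀ hM1 (by norm_num)
  rw [pow_one] at this
  calc _ = (40 * M ^ 7 + 4 * M) / √Q := by ring
    _ ≤ _ := by gcongr; linarith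

section CoprimeTotientAverage

open ArithmeticFunction

/-- `μ(d)/d²` restricted to `d` coprime to `l`. -/
noncomputable def coprimeMoebiusSq (l d : ℕ) : ℝ :=
  if l.Coprime d then (moebius d : ℝ) / (d : ℝ) ^ 2 else 0

theorem abs_moebius_cast_le_one (d : ℕ) : |(moebius d : ℝ)| ≤ 1 := by
  exact_mod_cast abs_moebius_le_one (n := d)

theorem abs_coprimeMoebiusSq_le (l d : ℕ) : |coprimeMoebiusSq l d| ≤ 1 / (d : ℝ) ^ 2 := by
  unfold coprimeMoebiusSq
  split_ifs
  · rw [abs_div, abs_of_nonneg (by positivity : (0 : ℝ) ≤ (d : ℝ) ^ 2)]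
    gcongr
    exact abs_moebius_cast_le_one d
  · rw [abs_zero]; positivity

theorem summable_coprimeMoebiusSq (l : ℕ) : Summable (fun d => ‖coprimeMoebiusSq l d‖) :=
  Summable.of_nonneg_of_le (fun _ => norm_nonneg _) (fun d => abs_coprimeMoebiusSq_le l d)
    hasSum_zeta_two.summable

theorem coprimeMoebiusSq_prime_pow (l : ℕ) {p : ℕ} (hp : p.Prime) :
    ∑' e, coprimeMoebiusSq l (p ^ e) = if p ∣ l then 1 else 1 - 1 / (p : ℝ) ^ 2 := by
  have h1 : coprimeMoebiusSq l (p ^ 0) = 1 := by simp [coprimeMoebiusSq]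
  have h2 : ∀ e, 2 ≤ e → coprimeMoebiusSq l (p ^ e) = 0 := by
    intro e he
    have h3 : moebius (p ^ e) = 0 := by
      rw [moebius_apply_prime_pow hp (by omega), if_neg (by omega)]
    simp [coprimeMoebiusSq, h3]
  rw [tsum_eq_sum (s := Finset.range 2) (fun e he => h2 e (by rw [Finset.mem_range] at he; omega)),
    Finset.sum_range_succ, Finset.sum_range_one, h1, pow_one]
  unfold coprimeMoebiusSq
  have h3 : l.Coprime p ↔ ¬ p ∣ l := by rw [Nat.coprime_comm, hp.coprime_iff_not_dvd]
  rw [moebius_apply_prime hp]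
  by_cases h : p ∣ l
  · rw [if_neg (fun h' => h3.1 h' h), if_pos h, add_zero]
  · rw [if_pos (h3.2 h), if_neg h]; push_cast; ring

theorem tsum_coprimeMoebiusSq (l : ℕ) :
    ∑' d, coprimeMoebiusSq l d =
      ∏' p : {p : ℕ // p.Prime ∧ ¬ p ∣ l}, (1 - 1 / (p.1 : ℝ) ^ 2) := by
  have h := EulerProduct.eulerProduct_hasProd_mulIndicator (f := coprimeMoebiusSq l)
    (by simp [coprimeMoebiusSq]) (by
      intro m n hmn
      unfold coprimeMoebiusSq
      rw [isMultiplicative_moebius.map_mul_of_coprime hmn]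
      by_cases h1 : l.Coprime m
      · by_cases h2 : l.Coprime n
        · rw [if_pos (Nat.Coprime.mul_right h1 h2), if_pos h1, if_pos h2]
          push_cast
          rw [div_mul_div_comm, mul_pow]
        · rw [if_neg (fun h => h2 (Nat.Coprime.coprime_mul_left_right h)), if_neg h2, mul_zero]
      · rw [if_neg (fun h => h1 (Nat.Coprime.coprime_mul_right_right h)), if_neg h1, zero_mul])
    (summable_coprimeMoebiusSq l) (by simp [coprimeMoebiusSq])
  rw [← h.tprod_eq]
  symm
  refine (tprod_subtype {p : ℕ | p.Prime ∧ ¬ p ∣ l} (fun p : ℕ => 1 - 1 / (p : ℝ) ^ 2)).trans ?_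
  refine tprod_congr fun p => ?_
  by_cases hp : p.Prime
  · rw [Set.mulIndicator_of_mem (show p ∈ {p | Nat.Prime p} from hp),
      coprimeMoebiusSq_prime_pow l hp]
    by_cases hpl : p ∣ l
    · rw [Set.mulIndicator_of_notMem (fun h => h.2 hpl), if_pos hpl]
    · rw [Set.mulIndicator_of_mem (show p ∈ {p : ℕ | p.Prime ∧ ¬ p ∣ l} from ⟨hp, hpl⟩),
        if_neg hpl]
  · rw [Set.mulIndicator_of_notMem (show p ∉ {p | Nat.Prime p} from hp),
      Set.mulIndicator_of_notMem (fun h => hp h.1)]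

theorem abs_tsum_sub_sum_coprimeMoebiusSq_le (l : ℕ) {x : ℕ} (hx : x ≠ 0) :
    |∑ d ∈ Finset.Ioc 0 x, coprimeMoebiusSq l d - ∑' d, coprimeMoebiusSq l d| ≤ 1 / x := by
  have hs : Summable (coprimeMoebiusSq l) := (summable_coprimeMoebiusSq l).of_norm
  have ht := hs.hasSum.tendsto_sum_nat
  have ht2 : Tendsto (fun n => |∑ d ∈ Finset.Ioc 0 x, coprimeMoebiusSq l d -
      ∑ d ∈ Finset.range n, coprimeMoebiusSq l d|) atTop
      (nhds |∑ d ∈ Finset.Ioc 0 x, coprimeMoebiusSq l d - ∑' d, coprimeMoebiusSq l d|) :=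
    (tendsto_const_nhds.sub ht).abs
  refine le_of_tendsto ht2 ?_
  filter_upwards [eventually_ge_atTop (x + 1)] with n hn
  have h0 : coprimeMoebiusSq l 0 = 0 := by simp [coprimeMoebiusSq]
  have h1 : ∑ d ∈ Finset.range n, coprimeMoebiusSq l d =
      ∑ d ∈ Finset.Ioc 0 x, coprimeMoebiusSq l d +
      ∑ d ∈ Finset.Ioc x (n - 1), coprimeMoebiusSq l d := by
    obtain ⟨m, rfl⟩ : ∃ m, n = m + 1 := ⟨n - 1, by omega⟩
    rw [Nat.add_sub_cancel, Finset.sum_Ioc_consecutive _ (Nat.zero_le _) (by omega),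
      Finset.range_eq_Ico, Finset.sum_eq_sum_Ico_succ_bot (by omega), h0, zero_add]
    rfl
  rw [h1, sub_add_cancel_left, abs_neg]
  refine (Finset.abs_sum_le_sum_abs _ _).trans ?_
  calc _ ≤ ∑ d ∈ Finset.Ioc x (n - 1), ((d : ℝ) ^ 2)⁻¹ :=
        Finset.sum_le_sum fun d _ => by rw [← one_div]; exact abs_coprimeMoebiusSq_le l d
    _ ≤ (x : ℝ)⁻¹ - ((n - 1 : ℕ) : ℝ)⁻¹ := sum_Ioc_inv_sq_le_sub hx (by omega)
    _ ≤ 1 / x := by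
      rw [one_div]
      have : 0 ≤ ((n - 1 : ℕ) : ℝ)⁻¹ := by positivity
      linarith

theorem abs_card_coprime_sub_le {l : ℕ} (hl : 1 ≤ l) (n : ℕ) :
    |(((Finset.Ioc 0 n).filter l.Coprime).card : ℝ) - n * (l.totient / l)| ≤ l := by
  have hl0 : (0 : ℝ) < l := by exact_mod_cast hl
  induction n using Nat.strong_induction_on with
  | _ n ih =>
    by_cases h : n < l
    · have h1 : ((Finset.Ioc 0 n).filter l.Coprime).card ≤ n := by
        refine (Finset.card_filter_le _ _).trans ?_
        simp
      have h1' : (((Finset.Ioc 0 n).filter l.Coprime).card : ℝ) ≤ n := by exact_mod_cast h1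
      have h2 : (n : ℝ) ≤ l := by exact_mod_cast h.le
      have h3 : (l.totient : ℝ) / l ≤ 1 := by
        rw [div_le_one hl0]; exact_mod_cast Nat.totient_le l
      have h4 : 0 ≤ (l.totient : ℝ) / l := by positivity
      have h5 : (n : ℝ) * (l.totient / l) ≤ n := mul_le_of_le_one_right (by positivity) h3
      have h6 : 0 ≤ (n : ℝ) * (l.totient / l) := by positivity
      have h7 : (0 : ℝ) ≤ ((Finset.Ioc 0 n).filter l.Coprime).card := by positivity
      rw [abs_le]; constructor <;> linarith
    · obtain ⟨m, rfl⟩ : ∃ m, n = m + l := ⟨n - l, by omega⟩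
      have hunion : ((Finset.Ioc 0 (m + l)).filter l.Coprime).card =
          ((Finset.Ioc 0 m).filter l.Coprime).card + l.totient := by
        rw [← Nat.filter_coprime_Ico_eq_totient l (m + 1), ← Finset.card_union_of_disjoint]
        · congr 1
          ext x
          simp only [Finset.mem_filter, Finset.mem_Ioc, Finset.mem_union, Finset.mem_Ico]
          constructor
          · rintro ⟨h1, h2⟩
            rcases le_or_gt x m with h | h
            · exact Or.inl ⟨⟨h1.1, h⟩, h2⟩
            · exact Or.inr ⟨⟨h, by omega⟩, h2⟩
          · rintro (⟨h1, h2⟩ | ⟨h1, h2⟩)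
            · exact ⟨⟨h1.1, by omega⟩, h2⟩
            · exact ⟨⟨by omega, by omega⟩, h2⟩
        · rw [Finset.disjoint_left]
          intro x hx hx'
          simp only [Finset.mem_filter, Finset.mem_Ioc, Finset.mem_Ico] at hx hx'
          omega
      have := ih m (by omega)
      rw [hunion]
      push_cast
      convert this using 2
      field_simp
      ring

/-- `μ(d)/d` restricted to `d` coprime to `l`. -/
noncomputable def coprimeMoebius (l : ℕ) : ArithmeticFunction ℝ :=
  ⟨fun d => if l.Coprime d then (moebius d : ℝ) / d else 0, by simp⟩

/-- The indicator function of the positive integers coprime to `l`. -/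
noncomputable def coprimeInd (l : ℕ) : ArithmeticFunction ℝ :=
  ⟨fun d => if d = 0 then 0 else if l.Coprime d then 1 else 0, by simp⟩

theorem coprimeMoebius_mul_coprimeInd (l : ℕ) {n : ℕ} (hn : 0 < n) :
    (coprimeMoebius l * coprimeInd l) n = if l.Coprime n then (n.totient : ℝ) / n else 0 := by
  have hn0 : (n : ℝ) ≠ 0 := by exact_mod_cast hn.ne'
  rw [mul_apply]
  split_ifs with h
  · have h1 : ∀ n > 0, ∑ x ∈ n.divisorsAntidiagonal, (moebius x.1 : ℝ) * (x.2 : ℝ) =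
        (n.totient : ℝ) := by
      refine (sum_eq_iff_sum_mul_moebius_eq (f := fun n => (n.totient : ℝ))
        (g := fun n => (n : ℝ))).1 fun n _ => ?_
      exact_mod_cast Nat.sum_totient n
    rw [← h1 n hn, Finset.sum_div]
    refine Finset.sum_congr rfl fun x hx => ?_
    rw [Nat.mem_divisorsAntidiagonal] at hx
    have hc1 : l.Coprime x.1 := Nat.Coprime.coprime_dvd_right ⟨x.2, hx.1.symm⟩ h
    have hc2 : l.Coprime x.2 := Nat.Coprime.coprime_dvd_right ⟨x.1, by rw [mul_comm, hx.1]⟩ h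
    have hx1 : x.1 ≠ 0 := fun h => by rw [h, zero_mul] at hx; exact hx.2 hx.1.symm
    have hx2 : x.2 ≠ 0 := fun h => by rw [h, mul_zero] at hx; exact hx.2 hx.1.symm
    have hx1' : (x.1 : ℝ) ≠ 0 := by exact_mod_cast hx1
    have hx2' : (x.2 : ℝ) ≠ 0 := by exact_mod_cast hx2
    have e : (n : ℝ) = x.1 * x.2 := by exact_mod_cast hx.1.symm
    simp only [coprimeMoebius, coprimeInd, coe_mk, if_pos hc1, if_pos hc2, if_neg hx2]
    rw [e]; field_simp
  · refine Finset.sum_eq_zero fun x hx => ?_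
    rw [Nat.mem_divisorsAntidiagonal] at hx
    simp only [coprimeMoebius, coprimeInd, coe_mk]
    by_cases hc1 : l.Coprime x.1 <;> by_cases hc2 : l.Coprime x.2
    · exact absurd (hx.1 ▸ Nat.Coprime.mul_right hc1 hc2) h
    all_goals simp [hc1, hc2]

theorem abs_sum_totient_div_sub_le {l : ℕ} (hl : 1 ≤ l) (x : ℕ) :
    |∑ q ∈ Finset.Ioc 0 x, (if l.Coprime q then (q.totient : ℝ) / q else 0) - Cconst l * x| ≤
      (l + 2) * (1 + Real.log x) := by
  have hl0 : (0 : ℝ) < l := by exact_mod_cast hl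
  have hlx : 0 ≤ Real.log x := Real.log_natCast_nonneg _
  rcases Nat.eq_zero_or_pos x with rfl | hx
  · simp; linarith
  have hx0 : (0 : ℝ) < x := by exact_mod_cast hx
  have e1 : ∑ q ∈ Finset.Ioc 0 x, (if l.Coprime q then (q.totient : ℝ) / q else 0) =
      ∑ d ∈ Finset.Ioc 0 x, coprimeMoebius l d *
        (((Finset.Ioc 0 (x / d)).filter l.Coprime).card : ℝ) := by
    rw [Finset.sum_congr rfl fun q hq => (coprimeMoebius_mul_coprimeInd l
      (Finset.mem_Ioc.1 hq).1).symm, sum_Ioc_mul_eq_sum_sum]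
    refine Finset.sum_congr rfl fun d _ => ?_
    congr 1
    rw [Finset.card_filter]
    push_cast
    refine Finset.sum_congr rfl fun k hk => ?_
    simp only [coprimeInd, coe_mk, if_neg (Finset.mem_Ioc.1 hk).1.ne']
  set c := (l.totient : ℝ) / l with hc
  have hc0 : 0 ≤ c := by positivity
  have hc1 : c ≤ 1 := by
    rw [hc, div_le_one hl0]; exact_mod_cast Nat.totient_le l
  have e2 : c * x * ∑ d ∈ Finset.Ioc 0 x, coprimeMoebiusSq l d =
      ∑ d ∈ Finset.Ioc 0 x, coprimeMoebius l d * ((x : ℝ) / d * c) := by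
    rw [Finset.mul_sum]
    refine Finset.sum_congr rfl fun d hd => ?_
    simp only [coprimeMoebius, coprimeMoebiusSq, coe_mk]
    split_ifs
    · field_simp
    · simp
  have e3 : Cconst l = c * ∑' d, coprimeMoebiusSq l d := by
    rw [Cconst, tsum_coprimeMoebiusSq]
  have b1 : |∑ d ∈ Finset.Ioc 0 x, coprimeMoebius l d *
        (((Finset.Ioc 0 (x / d)).filter l.Coprime).card : ℝ) -
        ∑ d ∈ Finset.Ioc 0 x, coprimeMoebius l d * ((x : ℝ) / d * c)| ≤
      (l + 1) * (1 + Real.log x) := by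
    rw [← Finset.sum_sub_distrib]
    refine (Finset.abs_sum_le_sum_abs _ _).trans ?_
    calc _ ≤ ∑ d ∈ Finset.Ioc 0 x, (l + 1) * (1 / (d : ℝ)) := by
          refine Finset.sum_le_sum fun d hd => ?_
          have hd0 : (0 : ℝ) < d := by exact_mod_cast (Finset.mem_Ioc.1 hd).1
          rw [← mul_sub, abs_mul, mul_comm]
          have h1 : |coprimeMoebius l d| ≤ 1 / d := by
            simp only [coprimeMoebius, coe_mk]
            split_ifs
            · rw [abs_div, abs_of_pos hd0]
              gcongr
              exact abs_moebius_cast_le_one d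
            · simp
          have h2 := abs_card_coprime_sub_le hl (x / d)
          have h3 : ((x / d : ℕ) : ℝ) ≤ (x : ℝ) / d := Nat.cast_div_le
          have h4 : (x : ℝ) / d ≤ ((x / d : ℕ) : ℝ) + 1 := by
            rw [← Nat.floor_div_eq_div (K := ℝ)]
            exact (Nat.lt_floor_add_one _).le
          have h5 : |(((Finset.Ioc 0 (x / d)).filter l.Coprime).card : ℝ) - (x : ℝ) / d * c| ≤
              l + 1 := by
            rw [abs_le] at h2 ⊢
            constructor <;> nlinarith
          exact mul_le_mul h5 h1 (abs_nonneg _) (by positivity)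
      _ ≤ _ := by
          rw [← Finset.mul_sum]
          refine mul_le_mul_of_nonneg_left ?_ (by positivity)
          exact sum_inv_Icc_le x
  have b2 : |c * x * ∑ d ∈ Finset.Ioc 0 x, coprimeMoebiusSq l d - Cconst l * x| ≤ 1 := by
    have := abs_tsum_sub_sum_coprimeMoebiusSq_le l hx.ne'
    rw [e3, show c * x * ∑ d ∈ Finset.Ioc 0 x, coprimeMoebiusSq l d -
      c * (∑' d, coprimeMoebiusSq l d) * x = (c * x) *
      (∑ d ∈ Finset.Ioc 0 x, coprimeMoebiusSq l d - ∑' d, coprimeMoebiusSq l d) by ring,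
      abs_mul, abs_of_nonneg (by positivity : 0 ≤ c * x)]
    calc c * x * _ ≤ 1 * x * (1 / x) := by gcongr
      _ = 1 := by field_simp
  rw [e1]
  refine (abs_sub_le _ _ _).trans ((add_le_add b1 (e2 ▸ b2)).trans ?_)
  linarith

end CoprimeTotientAverage

section MainTerm

theorem abs_sum_range_mul_le_of_monotone {f d : ℕ → ℝ} {E : ℝ} (n : ℕ)
    (hf : ∀ i < n, f i ≤ f (i + 1)) (hf0 : 0 ≤ f 0)
    (hd : ∀ k ≤ n + 1, |∑ i ∈ Finset.range k, d i| ≤ E) :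
    |∑ i ∈ Finset.range (n + 1), f i * d i| ≤ 2 * f n * E := by
  have key : ∀ n, ∑ i ∈ Finset.range (n + 1), f i * d i =
      f n * (∑ j ∈ Finset.range (n + 1), d j) -
      ∑ i ∈ Finset.range n, (f (i + 1) - f i) * ∑ j ∈ Finset.range (i + 1), d j := by
    intro n
    induction n with
    | zero => simp
    | succ n ih =>
      have h1 := Finset.sum_range_succ d (n + 1)
      have h2 := Finset.sum_range_succ
        (fun i => (f (i + 1) - f i) * ∑ j ∈ Finset.range (i + 1), d j) n
      rw [Finset.sum_range_succ, ih, h2, h1]; ring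
  have hfn : ∀ k ≤ n, f 0 ≤ f k := by
    intro k hk
    induction k with
    | zero => exact le_rfl
    | succ k ih => exact (ih (by omega)).trans (hf k (by omega))
  have hE : 0 ≤ E := (abs_nonneg _).trans (hd 0 (by omega))
  rw [key]
  calc _ ≤ f n * E + ∑ i ∈ Finset.range n, (f (i + 1) - f i) * E := by
        refine (abs_sub _ _).trans (add_le_add ?_ ?_)
        · rw [abs_mul, abs_of_nonneg (hf0.trans (hfn n le_rfl))]
          exact mul_le_mul_of_nonneg_left (hd _ le_rfl) (hf0.trans (hfn n le_rfl))
        · refine (Finset.abs_sum_le_sum_abs _ _).trans (Finset.sum_le_sum fun i hi => ?_)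
          have hi' := Finset.mem_range.1 hi
          have h0 : 0 ≤ f (i + 1) - f i := sub_nonneg.2 (hf i hi')
          rw [abs_mul, abs_of_nonneg h0]
          exact mul_le_mul_of_nonneg_left (hd _ (by omega)) h0
    _ = f n * E + (f n - f 0) * E := by
        rw [← Finset.sum_mul, Finset.sum_range_sub]
    _ ≤ _ := by nlinarith [mul_nonneg hf0 hE]

theorem abs_sum_Ioc_mul_le_of_monotone {f d : ℕ → ℝ} {E : ℝ} {n : ℕ} (hn : 1 ≤ n)
    (hf : ∀ i, 1 ≤ i → i < n → f i ≤ f (i + 1)) (hf0 : 0 ≤ f 1)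
    (hd : ∀ k ≤ n, |∑ i ∈ Finset.Ioc 0 k, d i| ≤ E) :
    |∑ i ∈ Finset.Ioc 0 n, f i * d i| ≤ 2 * f n * E := by
  have hshift : ∀ (g : ℕ → ℝ) k, ∑ i ∈ Finset.Ioc 0 k, g i = ∑ i ∈ Finset.range k, g (i + 1) := by
    intro g k
    rw [show Finset.Ioc 0 k = Finset.Ico (0 + 1) (k + 1) from rfl, Finset.range_eq_Ico,
      Finset.sum_Ico_add' g]
  obtain ⟨m, rfl⟩ : ∃ m, n = m + 1 := ⟨n - 1, by omega⟩
  rw [hshift]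
  exact abs_sum_range_mul_le_of_monotone (f := fun i => f (i + 1)) (d := fun i => d (i + 1)) m
    (fun i hi => hf _ (by omega) (by omega)) hf0 fun k hk => by rw [← hshift]; exact hd k hk

theorem sum_inv_mul_inv_eq (Q : ℕ) :
    ∑ q ∈ Finset.Ioc 0 Q, 1 / (q : ℝ) * ∑ y ∈ Finset.Ico (Q - q + 1) (Q + 1), 1 / (y : ℝ) =
      ∑ n ∈ Finset.Ioc 0 Q, 1 / (n : ℝ) ^ 2 := by
  set h : ℕ → ℝ := fun n => ∑ y ∈ Finset.Ioc 0 n, 1 / (y : ℝ) with hh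
  have hsub : ∀ Q q : ℕ, q ≤ Q → ∑ y ∈ Finset.Ico (Q - q + 1) (Q + 1), 1 / (y : ℝ) =
      h Q - h (Q - q) := by
    intro Q q hq
    have e : Finset.Ico (Q - q + 1) (Q + 1) = Finset.Ioc (Q - q) Q := by
      ext y; simp only [Finset.mem_Ico, Finset.mem_Ioc]; omega
    rw [eq_sub_iff_add_eq', e]
    exact Finset.sum_Ioc_consecutive (fun y : ℕ => 1 / (y : ℝ)) (Nat.zero_le (Q - q))
      (Nat.sub_le Q q)
  have hstep : ∀ n, h (n + 1) = h n + 1 / ((n : ℝ) + 1) := by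
    intro n
    simp only [hh]
    rw [Finset.sum_Ioc_succ_top (Nat.zero_le _)]; push_cast; rfl
  suffices H : ∑ q ∈ Finset.Ioc 0 Q, 1 / (q : ℝ) * (h Q - h (Q - q)) =
      ∑ n ∈ Finset.Ioc 0 Q, 1 / (n : ℝ) ^ 2 by
    rw [← H]
    refine Finset.sum_congr rfl fun q hq => ?_
    rw [hsub Q q (Finset.mem_Ioc.1 hq).2]
  induction Q with
  | zero => simp
  | succ Q ih =>
    rw [Finset.sum_Ioc_succ_top (Nat.zero_le _), Finset.sum_Ioc_succ_top (Nat.zero_le _), ← ih]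
    have h0 : h 0 = 0 := by simp [hh]
    have hQ : (0 : ℝ) < (Q : ℝ) + 1 := by positivity
    have hrefl : ∑ q ∈ Finset.Ioc 0 Q, 1 / ((Q + 1 - q : ℕ) : ℝ) = h Q := by
      refine Finset.sum_nbij' (fun k => Q + 1 - k) (fun k => Q + 1 - k) ?_ ?_ ?_ ?_ ?_ <;>
        intro a ha <;> simp only [Finset.mem_Ioc] at ha ⊢ <;> omega
    have hpf : ∀ q ∈ Finset.Ioc 0 Q, 1 / (q : ℝ) * (h (Q + 1) - h (Q + 1 - q)) =
        1 / (q : ℝ) * (h Q - h (Q - q)) + (1 / ((Q : ℝ) + 1) * (1 / (q : ℝ)) -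
        1 / ((Q : ℝ) + 1) * (1 / (q : ℝ) + 1 / ((Q + 1 - q : ℕ) : ℝ))) := by
      intro q hq
      rw [Finset.mem_Ioc] at hq
      have e : Q + 1 - q = (Q - q) + 1 := by omega
      have hq0 : (0 : ℝ) < q := by exact_mod_cast hq.1
      have hx : (0 : ℝ) < ((Q - q : ℕ) : ℝ) + 1 := by positivity
      have hsum : (Q : ℝ) + 1 = q + (((Q - q : ℕ) : ℝ) + 1) := by
        exact_mod_cast (show Q + 1 = q + ((Q - q) + 1) by omega)
      rw [e, hstep Q, hstep (Q - q)]
      push_cast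
      rw [hsum]
      field_simp
      ring
    rw [Finset.sum_congr rfl hpf, Finset.sum_add_distrib, Finset.sum_sub_distrib, ← Finset.mul_sum,
      ← Finset.mul_sum, Finset.sum_add_distrib, hrefl, Nat.sub_self, h0, hstep Q]
    change _ + (1 / ((Q : ℝ) + 1) * h Q - 1 / ((Q : ℝ) + 1) * (h Q + h Q)) + _ = _
    push_cast
    field_simp
    ring

theorem sum_truncated_inv_eq (Q N : ℕ) (hN : N ≤ Q) :
    ∑ q ∈ Finset.Ioc 0 Q, ∑ y ∈ Finset.Ico (Q - q + 1) (Q + 1),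
      (if y ≤ N then 1 / (y : ℝ) else 0) = N := by
  have h1 : ∀ q ∈ Finset.Ioc 0 Q, ∑ y ∈ Finset.Ico (Q - q + 1) (Q + 1),
      (if y ≤ N then 1 / (y : ℝ) else 0) =
      ∑ y ∈ Finset.Ioc 0 N, if Q - q + 1 ≤ y then 1 / (y : ℝ) else 0 := by
    intro q _
    rw [← Finset.sum_filter, ← Finset.sum_filter]
    refine Finset.sum_congr ?_ fun _ _ => rfl
    ext y
    simp only [Finset.mem_filter, Finset.mem_Ico, Finset.mem_Ioc]
    omega
  rw [Finset.sum_congr rfl h1, Finset.sum_comm]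
  have h2 : ∀ y ∈ Finset.Ioc 0 N, ∑ q ∈ Finset.Ioc 0 Q,
      (if Q - q + 1 ≤ y then 1 / (y : ℝ) else 0) = 1 := by
    intro y hy
    rw [Finset.mem_Ioc] at hy
    have hy0 : (0 : ℝ) < y := by exact_mod_cast hy.1
    rw [← Finset.sum_filter, Finset.sum_const, nsmul_eq_mul]
    have : (Finset.Ioc 0 Q).filter (fun q => Q - q + 1 ≤ y) = Finset.Ioc (Q - y) Q := by
      ext q; simp only [Finset.mem_filter, Finset.mem_Ioc]; omega
    rw [this, Nat.card_Ioc, show Q - (Q - y) = y by omega]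
    field_simp
  rw [Finset.sum_congr rfl h2]; simp

theorem abs_sum_totient_gapLength_sub_le {l : ℕ} (hl : 1 ≤ l) {Q : ℕ} (hQ : 1 ≤ Q) {ε lam : ℝ}
    (hε0 : 0 ≤ ε) (hε : ε ≤ 1 / Q) (hε1 : 1 ≤ ε * (Q + 1)) (hlam0 : 0 ≤ lam) (hlam1 : lam ≤ 1) :
    |∑ q ∈ (Finset.Icc 1 Q).filter (Nat.Coprime l), (q.totient / q : ℝ) *
        ∑ y ∈ Finset.Ico (Q - q + 1) (Q + 1), gapLength ε (lam * Q) q y -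
      Cconst l * (zeta2 - lam)| ≤ (4 * (l + 2) + 3 * |Cconst l|) * (1 + Real.log Q) ^ 2 / Q := by
  have hL : 0 ≤ Real.log Q := Real.log_natCast_nonneg _
  have hQ0 : (0 : ℝ) < Q := by exact_mod_cast hQ
  set a : ℕ → ℝ := fun q => if l.Coprime q then (q.totient : ℝ) / q else 0 with ha
  set g₁ : ℕ → ℝ := fun q => 1 / (q : ℝ) * ∑ y ∈ Finset.Ico (Q - q + 1) (Q + 1), 1 / (y : ℝ)
    with hg₁
  set g₂ : ℕ → ℝ := fun q => ε * ∑ y ∈ Finset.Ico (Q - q + 1) (Q + 1),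
    (if (y : ℝ) ≤ lam * Q then 1 / (y : ℝ) else 0) with hg₂
  have hH : ∀ q, ∑ y ∈ Finset.Ico (Q - q + 1) (Q + 1), gapLength ε (lam * Q) q y =
      g₁ q - g₂ q := by
    intro q
    simp only [hg₁, hg₂]
    rw [Finset.mul_sum, Finset.mul_sum, ← Finset.sum_sub_distrib]
    refine Finset.sum_congr rfl fun y _ => ?_
    unfold gapLength
    split_ifs <;> ring
  set N := ⌊lam * Q⌋₊ with hN
  have hNle : ∀ y : ℕ, (y : ℝ) ≤ lam * Q ↔ y ≤ N := fun y =>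
    (Nat.le_floor_iff (by positivity)).symm
  have hNQ : N ≤ Q := by
    refine Nat.floor_le_of_le ?_
    nlinarith
  have hdiff : ∀ k ≤ Q, |∑ q ∈ Finset.Ioc 0 k, (a q - Cconst l)| ≤
      (l + 2) * (1 + Real.log Q) := by
    intro k hk
    have := abs_sum_totient_div_sub_le hl k
    rw [Finset.sum_sub_distrib, Finset.sum_const, Nat.card_Ioc, nsmul_eq_mul, Nat.sub_zero,
      mul_comm (k : ℝ)]
    refine this.trans (mul_le_mul_of_nonneg_left ?_ (by positivity))
    rcases Nat.eq_zero_or_pos k with rfl | hk0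
    · simp; linarith
    have := Real.log_le_log (by exact_mod_cast hk0) (Nat.cast_le (α := ℝ).2 hk)
    linarith
  have hharm : ∑ y ∈ Finset.Ico (Q - Q + 1) (Q + 1), 1 / (y : ℝ) ≤ 1 + Real.log Q := by
    rw [Nat.sub_self]; exact sum_inv_Icc_le Q
  have b1 : |∑ q ∈ Finset.Ioc 0 Q, g₁ q * (a q - Cconst l)| ≤
      2 * g₁ Q * ((l + 2) * (1 + Real.log Q)) := by
    refine abs_sum_Ioc_mul_le_of_monotone hQ (fun i hi hiQ => ?_) ?_ hdiff
    · simp only [hg₁]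
      have hi0 : (0 : ℝ) < i := by exact_mod_cast hi
      have hx : (0 : ℝ) < ((Q - i : ℕ) : ℝ) := by exact_mod_cast (by omega : 0 < Q - i)
      have e1 : Q - (i + 1) + 1 = Q - i := by omega
      have e2 : ∑ y ∈ Finset.Ico (Q - i) (Q + 1), 1 / (y : ℝ) = 1 / ((Q - i : ℕ) : ℝ) +
          ∑ y ∈ Finset.Ico (Q - i + 1) (Q + 1), 1 / (y : ℝ) :=
        Finset.sum_eq_sum_Ico_succ_bot (by omega) _
      rw [e1, e2]
      set S := ∑ y ∈ Finset.Ico (Q - i + 1) (Q + 1), 1 / (y : ℝ) with hS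
      have hS1 : S ≤ i * (1 / ((Q - i : ℕ) : ℝ)) := by
        rw [hS]
        calc _ ≤ ∑ y ∈ Finset.Ico (Q - i + 1) (Q + 1), 1 / ((Q - i : ℕ) : ℝ) := by
              refine Finset.sum_le_sum fun y hy => ?_
              rw [Finset.mem_Ico] at hy
              have : ((Q - i : ℕ) : ℝ) ≤ y := by exact_mod_cast (by omega : Q - i ≤ y)
              gcongr
          _ = _ := by
            rw [Finset.sum_const, Nat.card_Ico, nsmul_eq_mul,
              show Q + 1 - (Q - i + 1) = i by omega]
      push_cast
      rw [one_div_mul_eq_div, one_div_mul_eq_div, div_le_div_iff₀ hi0 (by positivity)]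
      nlinarith
    · simp only [hg₁]; positivity
  have b2 : |∑ q ∈ Finset.Ioc 0 Q, g₂ q * (a q - Cconst l)| ≤
      2 * g₂ Q * ((l + 2) * (1 + Real.log Q)) := by
    refine abs_sum_Ioc_mul_le_of_monotone hQ (fun i hi hiQ => ?_) ?_ hdiff
    · simp only [hg₂]
      refine mul_le_mul_of_nonneg_left ?_ hε0
      refine Finset.sum_le_sum_of_subset_of_nonneg (Finset.Ico_subset_Ico_left (by omega)) ?_
      intro y _ _; split_ifs <;> positivity
    · simp only [hg₂]
      refine mul_nonneg hε0 (Finset.sum_nonneg fun y _ => ?_)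
      split_ifs <;> positivity
  have hg1Q : g₁ Q ≤ 1 / Q * (1 + Real.log Q) := by
    simp only [hg₁]; gcongr
  have hg2Q : g₂ Q ≤ 1 / Q * (1 + Real.log Q) := by
    simp only [hg₂]
    refine mul_le_mul hε (le_trans (Finset.sum_le_sum fun y _ => ?_) hharm)
      (Finset.sum_nonneg fun y _ => ?_) (by positivity)
    · split_ifs
      · exact le_rfl
      · positivity
    · split_ifs <;> positivity
  have s1 : ∑ q ∈ Finset.Ioc 0 Q, g₁ q = ∑ n ∈ Finset.Ioc 0 Q, 1 / (n : ℝ) ^ 2 :=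
    sum_inv_mul_inv_eq Q
  have s2 : ∑ q ∈ Finset.Ioc 0 Q, g₂ q = ε * N := by
    simp only [hg₂]
    rw [← Finset.mul_sum]
    simp only [hNle]
    rw [sum_truncated_inv_eq Q N hNQ]
  have hz : |∑ n ∈ Finset.Ioc 0 Q, 1 / (n : ℝ) ^ 2 - zeta2| ≤ 1 / Q := by
    have ht := hasSum_zeta_two.tendsto_sum_nat
    have ht2 : Tendsto (fun n => |∑ d ∈ Finset.Ioc 0 Q, 1 / (d : ℝ) ^ 2 -
        ∑ d ∈ Finset.range n, 1 / (d : ℝ) ^ 2|) atTop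
        (nhds |∑ d ∈ Finset.Ioc 0 Q, 1 / (d : ℝ) ^ 2 - zeta2|) :=
      (tendsto_const_nhds.sub ht).abs
    refine le_of_tendsto ht2 ?_
    filter_upwards [eventually_ge_atTop (Q + 1)] with n hn
    obtain ⟨m, rfl⟩ : ∃ m, n = m + 1 := ⟨n - 1, by omega⟩
    have h1 : ∑ d ∈ Finset.range (m + 1), 1 / (d : ℝ) ^ 2 =
        ∑ d ∈ Finset.Ioc 0 Q, 1 / (d : ℝ) ^ 2 + ∑ d ∈ Finset.Ioc Q m, 1 / (d : ℝ) ^ 2 := by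
      rw [Finset.sum_Ioc_consecutive _ (Nat.zero_le _) (by omega),
        Finset.range_eq_Ico, Finset.sum_eq_sum_Ico_succ_bot (by omega)]
      simp
      rfl
    rw [h1, sub_add_cancel_left, abs_neg,
      abs_of_nonneg (Finset.sum_nonneg fun _ _ => by positivity)]
    calc _ = ∑ d ∈ Finset.Ioc Q m, ((d : ℝ) ^ 2)⁻¹ := by simp_rw [one_div]
      _ ≤ (Q : ℝ)⁻¹ - (m : ℝ)⁻¹ := sum_Ioc_inv_sq_le_sub (by omega) (by omega)
      _ ≤ 1 / Q := by
        rw [one_div]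
        have : 0 ≤ (m : ℝ)⁻¹ := by positivity
        linarith
  have hNlam : |ε * N - lam| ≤ 2 * (1 / Q) := by
    have h1 : (N : ℝ) ≤ lam * Q := Nat.floor_le (by positivity)
    have h2 : lam * Q < N + 1 := Nat.lt_floor_add_one _
    have h3 : ε * Q ≤ 1 := by rwa [le_div_iff₀ hQ0] at hε
    rw [abs_le]
    constructor <;> nlinarith
  have hsplit : ∑ q ∈ (Finset.Icc 1 Q).filter (Nat.Coprime l), (q.totient / q : ℝ) *
        ∑ y ∈ Finset.Ico (Q - q + 1) (Q + 1), gapLength ε (lam * Q) q y -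
      Cconst l * (zeta2 - lam) =
      ∑ q ∈ Finset.Ioc 0 Q, g₁ q * (a q - Cconst l) -
      ∑ q ∈ Finset.Ioc 0 Q, g₂ q * (a q - Cconst l) +
      Cconst l * ((∑ n ∈ Finset.Ioc 0 Q, 1 / (n : ℝ) ^ 2 - zeta2) - (ε * N - lam)) := by
    rw [← s1, ← s2, Finset.sum_filter]
    simp only [hH]
    have h1 : ∀ q ∈ Finset.Icc 1 Q, (if l.Coprime q then (q.totient / q : ℝ) * (g₁ q - g₂ q) else 0)
        = g₁ q * (a q - Cconst l) - g₂ q * (a q - Cconst l) + Cconst l * (g₁ q - g₂ q) := by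
      intro q _
      simp only [ha]
      split_ifs <;> ring
    rw [Finset.sum_congr rfl h1, Finset.sum_add_distrib, Finset.sum_sub_distrib, ← Finset.mul_sum,
      Finset.sum_sub_distrib]
    change ∑ q ∈ Finset.Ioc 0 Q, g₁ q * (a q - Cconst l) -
      ∑ q ∈ Finset.Ioc 0 Q, g₂ q * (a q - Cconst l) +
      Cconst l * (∑ q ∈ Finset.Ioc 0 Q, g₁ q - ∑ q ∈ Finset.Ioc 0 Q, g₂ q) - _ = _
    ring
  rw [hsplit]
  have b3 : |Cconst l * ((∑ n ∈ Finset.Ioc 0 Q, 1 / (n : ℝ) ^ 2 - zeta2) - (ε * N - lam))| ≤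
      |Cconst l| * (3 * (1 / Q)) := by
    rw [abs_mul]
    refine mul_le_mul_of_nonneg_left ((abs_sub _ _).trans ?_) (abs_nonneg _)
    linarith
  refine (abs_add_le _ _).trans ((add_le_add ((abs_sub _ _).trans (add_le_add b1 b2)) b3).trans ?_)
  have hl2 : (0 : ℝ) ≤ (l + 2) * (1 + Real.log Q) := by positivity
  calc _ ≤ 2 * (1 / Q * (1 + Real.log Q)) * ((l + 2) * (1 + Real.log Q)) +
        2 * (1 / Q * (1 + Real.log Q)) * ((l + 2) * (1 + Real.log Q)) +
        |Cconst l| * (3 * (1 / Q)) * (1 + Real.log Q) ^ 2 := by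
        have : 1 ≤ (1 + Real.log Q) ^ 2 := by nlinarith
        have h3 : 0 ≤ |Cconst l| * (3 * (1 / (Q : ℝ))) := by positivity
        have := le_mul_of_one_le_right h3 this
        gcongr
    _ = _ := by ring

end MainTerm

section FareyArcs

/-- The fractions `a / q < a' / q'` form a unimodular pair whose mediant has denominator
exceeding `Q`. -/
structure FareyArc (Q : ℕ) (a : ℤ) (q : ℕ) (a' : ℤ) (q' : ℕ) : Prop where
  pos : 0 < q
  pos' : 0 < q'
  le : q ≤ Q
  le' : q' ≤ Q
  lt_add : Q < q + q'
  det : a' * q - a * q' = 1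

namespace FareyArc

variable {Q q q' : ℕ} {a a' : ℤ}

theorem reflect (h : FareyArc Q a q a' q') : FareyArc Q (-a') q' (-a) q :=
  ⟨h.pos', h.pos, h.le', h.le, by have := h.lt_add; omega, by linarith [h.det]⟩

theorem isCoprime (h : FareyArc Q a q a' q') : IsCoprime a q :=
  ⟨-q', a', by linarith [h.det]⟩

theorem sub_eq (h : FareyArc Q a q a' q') : (a' : ℝ) / q' - a / q = 1 / (q * q') := by
  have h1 : (0 : ℝ) < q := by exact_mod_cast h.pos
  have h2 : (0 : ℝ) < q' := by exact_mod_cast h.pos'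
  have h3 : (a' : ℝ) * q - a * q' = 1 := by exact_mod_cast h.det
  rw [div_sub_div _ _ h2.ne' h1.ne', div_eq_div_iff (by positivity) (by positivity)]
  linear_combination ((q : ℝ) * q') * h3

theorem one_div_mul_le (h : FareyArc Q a q a' q') : 1 / ((q : ℝ) * q') ≤ 1 / Q := by
  have h1 : 1 ≤ q := h.pos
  have h2 : 1 ≤ q' := h.pos'
  have h3 : Q ≤ q * q' := by have := h.lt_add; nlinarith
  have hQ : (0 : ℝ) < Q := by exact_mod_cast lt_of_lt_of_le h.pos h.le
  refine one_div_le_one_div_of_le hQ ?_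
  exact_mod_cast h3

theorem le_of_between (h : FareyArc Q a q a' q') {c : ℤ} {r : ℕ}
    (h1 : a * r < c * q) (h2 : c * q' < a' * r) : Q < r := by
  have hq : (0 : ℤ) < q := by exact_mod_cast h.pos
  have hq' : (0 : ℤ) < q' := by exact_mod_cast h.pos'
  have hlt : (Q : ℤ) < q + q' := by exact_mod_cast h.lt_add
  have e : (r : ℤ) = q * (a' * r - c * q') + q' * (c * q - a * r) := by
    linear_combination (-(r : ℤ)) * h.det
  have : (Q : ℤ) < r := by rw [e]; nlinarith
  exact_mod_cast this

theorem unique (h : FareyArc Q a q a' q') {c c' : ℤ} {r r' : ℕ} (k : FareyArc Q c r c' r')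
    {u : ℝ} (h1 : (a : ℝ) / q < u) (h2 : u < a' / q') (k1 : (c : ℝ) / r < u) (k2 : u < c' / r') :
    a = c ∧ q = r ∧ a' = c' ∧ q' = r' := by
  have hq : (0 : ℝ) < q := by exact_mod_cast h.pos
  have hq' : (0 : ℝ) < q' := by exact_mod_cast h.pos'
  have hr : (0 : ℝ) < r := by exact_mod_cast k.pos
  have hr' : (0 : ℝ) < r' := by exact_mod_cast k.pos'
  have key : ∀ {a a' c c' : ℤ} {q q' r r' : ℕ}, FareyArc Q a q a' q' → FareyArc Q c r c' r' →
      (a : ℝ) / q < u → u < a' / q' → (c : ℝ) / r < u → u < c' / r' →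
      c * q ≤ a * r ∧ a' * r' ≤ c' * q' := by
    intro a a' c c' q q' r r' h k h1 h2 k1 k2
    have hq : (0 : ℝ) < q := by exact_mod_cast h.pos
    have hq' : (0 : ℝ) < q' := by exact_mod_cast h.pos'
    have hr : (0 : ℝ) < r := by exact_mod_cast k.pos
    have hr' : (0 : ℝ) < r' := by exact_mod_cast k.pos'
    constructor
    · by_contra! hlt
      have h3 := k1.trans h2
      rw [div_lt_div_iff₀ hr hq'] at h3
      have := h.le_of_between hlt (by exact_mod_cast h3)
      exact absurd k.le (by omega)
    · by_contra! hlt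
      have h3 := h1.trans k2
      rw [div_lt_div_iff₀ hq hr'] at h3
      have := h.le_of_between (by exact_mod_cast h3) hlt
      exact absurd k.le' (by omega)
  obtain ⟨e1, e2⟩ := key h k h1 h2 k1 k2
  obtain ⟨e3, e4⟩ := key k h k1 k2 h1 h2
  have f1 : c * q = a * r := le_antisymm e1 e3
  have f2 : a' * r' = c' * q' := le_antisymm e2 e4
  have hqr : q = r := Nat.dvd_antisymm
    (Int.natCast_dvd_natCast.1 (h.isCoprime.symm.dvd_of_dvd_mul_left (f1 ▸ dvd_mul_left _ _)))
    (Int.natCast_dvd_natCast.1 (k.isCoprime.symm.dvd_of_dvd_mul_left (f1.symm ▸ dvd_mul_left _ _)))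
  have hqr' : q' = r' := Nat.dvd_antisymm
    (Int.natCast_dvd_natCast.1
      (h.reflect.isCoprime.neg_left.symm.dvd_of_dvd_mul_left
        (by rw [neg_neg]; exact f2.symm ▸ dvd_mul_left _ _)))
    (Int.natCast_dvd_natCast.1
      (k.reflect.isCoprime.neg_left.symm.dvd_of_dvd_mul_left
        (by rw [neg_neg]; exact f2 ▸ dvd_mul_left _ _)))
  subst hqr hqr'
  refine ⟨?_, rfl, ?_, rfl⟩
  · exact (mul_right_cancel₀ (by exact_mod_cast h.pos.ne') f1).symm
  · exact mul_right_cancel₀ (by exact_mod_cast h.pos'.ne') f2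

end FareyArc

theorem gapLength_lt_iff_of_arc {Q q q' : ℕ} {a a' : ℤ} (h : FareyArc Q a q a' q') {ε X u : ℝ}
    (hu : u < a' / q') :
    u - a / q < gapLength ε X q q' ↔ ¬ ((q' : ℝ) ≤ X ∧ a' - q' * u ≤ ε) := by
  have hq : (0 : ℝ) < q := by exact_mod_cast h.pos
  have hq' : (0 : ℝ) < q' := by exact_mod_cast h.pos'
  have e := h.sub_eq
  have e1 : 1 / (q' : ℝ) * (1 / q) = a' / q' - a / q := by rw [e]; field_simp
  unfold gapLength
  split_ifs with hX
  · rw [mul_sub, e1]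
    simp only [hX, true_and, not_le]
    have : (a' : ℝ) / q' - a / q - 1 / q' * ε - (u - a / q) = (a' - q' * u - ε) / q' := by
      field_simp; ring
    rw [← sub_pos, this, div_pos_iff_of_pos_right hq', sub_pos]
  · simp only [hX, false_and, not_false_iff, iff_true, sub_zero]
    rw [e1]; linarith

theorem hits_iff_of_arc {Q q q' : ℕ} {a a' : ℤ} (h : FareyArc Q a q a' q') (hQ : 2 ≤ Q)
    {ε X u : ℝ} (hε : ε ≤ 1 / Q) (hX : X ≤ Q) {l : ℕ} (hl : 2 ≤ l) {s : ℤ}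
    (hs : (l : ℤ) ∣ q - s * a) (h1 : (a : ℝ) / q < u) (h2 : u < a' / q') :
    (∀ m n : ℤ, 0 < m → (m : ℝ) ≤ X → |m * u - n| ≤ ε → (l : ℤ) ∣ m - s * n) ↔
      ¬ ((q' : ℝ) ≤ X ∧ a' - q' * u ≤ ε) := by
  have hq : (0 : ℝ) < q := by exact_mod_cast h.pos
  have hq' : (0 : ℝ) < q' := by exact_mod_cast h.pos'
  have hQ0 : (0 : ℝ) < Q := by positivity
  set x : ℝ := q * u - a with hx
  set y : ℝ := a' - q' * u with hy
  have hx0 : 0 < x := by rw [div_lt_iff₀ hq] at h1; linarith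
  have hy0 : 0 < y := by rw [lt_div_iff₀ hq'] at h2; linarith
  have hdet : (a' : ℝ) * q - a * q' = 1 := by exact_mod_cast h.det
  have hxy : q' * x + q * y = 1 := by rw [hx, hy]; linarith
  have hbig : ε < x + y := by
    by_contra! hle
    have hqQ : (q : ℝ) ≤ Q := by exact_mod_cast h.le
    have hqQ' : (q' : ℝ) ≤ Q := by exact_mod_cast h.le'
    have h3 : Q * (x + y) ≤ 1 := by
      have := hle.trans hε
      rw [le_div_iff₀ hQ0] at this
      linarith
    have h4 : (Q - q') * x + (Q - q) * y ≤ 0 := by linarith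
    have h5 : 0 ≤ ((Q : ℝ) - q') * x := mul_nonneg (by linarith) hx0.le
    have h6 : 0 ≤ ((Q : ℝ) - q) * y := mul_nonneg (by linarith) hy0.le
    have h7 : (Q : ℝ) = q' := by
      have : ((Q : ℝ) - q') * x = 0 := by linarith
      rcases mul_eq_zero.1 this with h | h <;> linarith
    have h8 : (Q : ℝ) = q := by
      have : ((Q : ℝ) - q) * y = 0 := by linarith
      rcases mul_eq_zero.1 this with h | h <;> linarith
    have h7' : Q = q' := by exact_mod_cast h7
    have h8' : Q = q := by exact_mod_cast h8
    have hd := h.det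
    rw [← h7', ← h8', ← sub_mul] at hd
    have := Int.isUnit_iff.1 (IsUnit.of_mul_eq_one_right _ hd)
    omega
  constructor
  · rintro H ⟨hX', hy'⟩
    have h3 := H q' a' (by exact_mod_cast h.pos') (by exact_mod_cast hX') (by
      rw [abs_le]; push_cast; constructor <;> linarith)
    have h4 : (l : ℤ) ∣ 1 := by
      have : (1 : ℤ) = a' * (q - s * a) - a * (q' - s * a') := by linear_combination -h.det
      rw [this]
      exact dvd_sub (hs.mul_left _) (h3.mul_left _)
    have := Int.le_of_dvd one_pos h4
    omega
  · intro H m n hm hmX hmn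
    set i := m * a' - n * q' with hi
    set j := n * q - m * a with hj
    have em : m = i * q + j * q' := by rw [hi, hj]; linear_combination (-m) * h.det
    have en : n = i * a + j * a' := by rw [hi, hj]; linear_combination (-n) * h.det
    have er : m * u - n = i * x - j * y := by
      rw [em, en, hx, hy]; push_cast; ring
    rw [er, abs_le] at hmn
    have hqz : (0 : ℤ) < q := by exact_mod_cast h.pos
    have hqz' : (0 : ℤ) < q' := by exact_mod_cast h.pos'
    have hlt : (Q : ℤ) < q + q' := by exact_mod_cast h.lt_add
    have hmQ : m ≤ Q := by exact_mod_cast hmX.trans hX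
    rcases lt_trichotomy j 0 with hj0 | hj0 | hj0
    · exfalso
      have hi0 : 1 ≤ i := by
        by_contra! hi0
        nlinarith
      have hi1 : (1 : ℝ) ≤ i := by exact_mod_cast hi0
      have hj1 : (j : ℝ) ≤ -1 := by exact_mod_cast (by omega : j ≤ -1)
      nlinarith [hmn.2]
    · have : m - s * n = i * (q - s * a) := by rw [em, en, hj0]; ring
      rw [this]; exact hs.mul_left _
    · exfalso
      have hj1 : (1 : ℝ) ≤ j := by exact_mod_cast hj0
      rcases lt_trichotomy i 0 with hi0 | hi0 | hi0
      · have hi1 : (i : ℝ) ≤ -1 := by exact_mod_cast (by omega : i ≤ -1)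
        nlinarith [hmn.1]
      · refine H ⟨le_trans ?_ hmX, ?_⟩
        · have : (q' : ℤ) ≤ m := by rw [em, hi0]; nlinarith
          exact_mod_cast this
        · rw [hi0] at hmn; push_cast at hmn; nlinarith [hmn.1]
      · have : (Q : ℤ) < m := by rw [em]; nlinarith
        omega

theorem FareyArc.of_dvd {Q q y : ℕ} (hq : 1 ≤ q) (hqQ : q ≤ Q)
    (hy : y ∈ Finset.Ico (Q - q + 1) (Q + 1))
    {a : ℤ} (h : (q : ℤ) ∣ a * y + 1) : ∃ a', FareyArc Q a q a' y := by
  obtain ⟨k, hk⟩ := h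
  rw [Finset.mem_Ico] at hy
  exact ⟨k, by omega, by omega, hqQ, by omega, by omega, by linarith⟩

theorem exists_mem_Ico_dvd {Q q : ℕ} (hq : 1 ≤ q) (hqQ : q ≤ Q) {a : ℤ} (ha : IsCoprime a (q : ℤ)) :
    ∃ y ∈ Finset.Ico (Q - q + 1) (Q + 1), (q : ℤ) ∣ a * y + 1 := by
  obtain ⟨r, t, hrt⟩ := ha
  have hq0 : (0 : ℤ) < q := by exact_mod_cast hq
  set z : ℤ := (-r - (Q - q + 1 : ℕ)) % q with hz
  have hz0 : 0 ≤ z := Int.emod_nonneg _ hq0.ne'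
  have hz1 : z < q := Int.emod_lt_of_pos _ hq0
  refine ⟨Q - q + 1 + z.toNat, ?_, ?_⟩
  · rw [Finset.mem_Ico]; omega
  · have h1 : (q : ℤ) ∣ (-r - (Q - q + 1 : ℕ)) - z := by
      rw [hz]; exact Int.dvd_self_sub_emod
    have h2 : ((Q - q + 1 + z.toNat : ℕ) : ℤ) = (Q - q + 1 : ℕ) + z := by
      push_cast [Int.toNat_of_nonneg hz0]; ring
    rw [h2]
    obtain ⟨k, hk⟩ := h1
    refine ⟨t - a * k, ?_⟩
    linear_combination -a * hk - hrt

end FareyArcs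

section FreePath

theorem ofReal_lt_qfree_iff {l : ℕ} {ε ω X : ℝ} (hX : 0 ≤ X) :
    ENNReal.ofReal X < qfree l ε ω ↔ ∀ m n : ℤ, 0 < m → (m : ℝ) ≤ X →
      |m * Real.tan ω - n| ≤ ε → (l : ℤ) ∣ m - n := by
  constructor
  · intro h m n hm hmX hmn
    by_contra hl
    have hm0 : (0 : ℝ) < m := by exact_mod_cast hm
    have hmem : ((m : ℝ), (m : ℝ) * Real.tan ω) ∈ Zl l + Vseg ε := by
      refine Set.mem_add.2 ⟨((m : ℝ), (n : ℝ)), ⟨m, n, rfl, hl⟩,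
        (0, m * Real.tan ω - n), ⟨rfl, abs_le.1 hmn⟩, ?_⟩
      ext <;> simp
    have h1 : qfree l ε ω ≤ ENNReal.ofReal m := iInf_le
      (fun q : {q : ℝ // 0 < q ∧ (q, q * Real.tan ω) ∈ Zl l + Vseg ε} => ENNReal.ofReal q.1)
      ⟨(m : ℝ), hm0, hmem⟩
    exact absurd (h.trans_le h1) (not_lt.2 (ENNReal.ofReal_le_ofReal hmX))
  · intro h
    refine lt_of_lt_of_le (b := ENNReal.ofReal (⌊X⌋ + 1)) ?_ (le_iInf ?_)
    · rw [ENNReal.ofReal_lt_ofReal_iff_of_nonneg hX]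
      exact Int.lt_floor_add_one X
    · rintro ⟨q, hq, hmem⟩
      obtain ⟨x, ⟨m, n, rfl, hl⟩, ⟨y1, y2⟩, ⟨hy1, hy2⟩, hxy⟩ := Set.mem_add.1 hmem
      simp only [Set.mem_singleton_iff] at hy1
      rw [Prod.mk_add_mk, Prod.mk.injEq, hy1, add_zero] at hxy
      obtain ⟨rfl, hy⟩ := hxy
      refine ENNReal.ofReal_le_ofReal ?_
      have hXm : X < m := by
        by_contra! hle
        refine hl (h m n (by exact_mod_cast hq) hle ?_)
        rw [← hy, add_sub_cancel_left]
        exact abs_le.2 hy2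
      have h1 : ⌊X⌋ + 1 ≤ m := Int.floor_lt.2 hXm
      change (⌊X⌋ : ℝ) + 1 ≤ m
      exact_mod_cast h1

theorem FareyArc.consecFarey {Q q q' : ℕ} {a a' : ℤ} (h : FareyArc Q a q a' q') (ha : 0 < a)
    (ha' : a' ≤ q') : ConsecFarey Q ((a : ℚ) / q) ((a' : ℚ) / q') := by
  have hq : (0 : ℚ) < q := by exact_mod_cast h.pos
  have hq' : (0 : ℚ) < q' := by exact_mod_cast h.pos'
  have hqz : (0 : ℤ) < q := by exact_mod_cast h.pos
  have hqz' : (0 : ℤ) < q' := by exact_mod_cast h.pos'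
  have hlt : a * q' < a' * q := by linarith [h.det]
  have ha'0 : 0 < a' := by
    by_contra! hle
    nlinarith [mul_pos ha hqz', mul_nonneg (neg_nonneg.2 hle) hqz.le]
  have haq : a ≤ q := by
    by_contra! hle
    nlinarith [mul_lt_mul_of_pos_right hle hqz']
  have hden : ∀ {b : ℤ} {r : ℕ}, 0 < r → r ≤ Q → 0 < b → b ≤ r → (b : ℚ) / r ∈ FareyQ Q := by
    intro b r hr hrQ hb hbr
    have hr0 : (0 : ℚ) < r := by exact_mod_cast hr
    have hb0 : (0 : ℚ) < b := by exact_mod_cast hb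
    refine ⟨by positivity, ?_, ?_⟩
    · rw [div_le_one hr0]; exact_mod_cast hbr
    · refine le_trans (Nat.le_of_dvd hr ?_) hrQ
      have := Rat.den_dvd b r
      rw [← Rat.intCast_div_eq_divInt, Int.cast_natCast] at this
      exact_mod_cast this
  refine ⟨hden h.pos h.le ha haq, hden h.pos' h.le' ha'0 ha', ?_, ?_⟩
  · rw [div_lt_div_iff₀ hq hq']; exact_mod_cast hlt
  · rintro z ⟨-, -, hz⟩ ⟨h1, h2⟩
    rw [← Rat.num_div_den z] at h1 h2
    have hz0 : (0 : ℚ) < z.den := by exact_mod_cast z.pos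
    rw [div_lt_div_iff₀ hq hz0] at h1
    rw [div_lt_div_iff₀ hz0 hq'] at h2
    have := h.le_of_between (by exact_mod_cast h1) (by exact_mod_cast h2)
    omega

theorem ConsecFarey.fareyArc {Q : ℕ} {γ γ' : ℚ} (h : ConsecFarey Q γ γ') :
    FareyArc Q γ.num γ.den γ'.num γ'.den := by
  obtain ⟨⟨h1, h2, h3⟩, ⟨h1', h2', h3'⟩, hlt, hno⟩ := h
  obtain ⟨y, hy, hdvd⟩ := exists_mem_Ico_dvd γ.pos h3 γ.isCoprime_num_den
  obtain ⟨x, harc⟩ := FareyArc.of_dvd γ.pos h3 hy hdvd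
  have hn : 0 < γ.num := Rat.num_pos.2 h1
  have hd : (0 : ℤ) < γ.den := by exact_mod_cast γ.pos
  have hyz : (0 : ℤ) < y := by exact_mod_cast harc.pos'
  have hγ1 : γ < 1 := hlt.trans_le h2'
  have hnd : γ.num < γ.den := Rat.num_lt_denom_iff.2 hγ1
  have hx : x ≤ y := by
    by_contra! hle
    have := harc.det
    nlinarith
  have hc := harc.consecFarey hn hx
  rw [show ((γ.num : ℚ) / (γ.den : ℕ)) = γ from Rat.num_div_den γ] at hc
  have heq : γ' = (x : ℚ) / y := by
    rcases lt_trichotomy γ' ((x : ℚ) / y) with h | h | h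
    · exact absurd ⟨hlt, h⟩ (hc.2.2.2 γ' ⟨h1', h2', h3'⟩)
    · exact h
    · exact absurd ⟨hc.2.2.1, h⟩ (hno _ hc.2.1)
  have hcop : Nat.Coprime x.natAbs y := by
    have := harc.reflect.isCoprime.neg_left
    rw [neg_neg] at this
    exact Int.isCoprime_iff_gcd_eq_one.1 this
  have hnum : γ'.num = x := by
    rw [heq]
    exact_mod_cast Rat.num_div_eq_of_coprime hyz hcop
  have hden : γ'.den = y := by
    rw [heq]
    exact_mod_cast Rat.den_div_eq_of_coprime hyz hcop
  rw [hnum, hden]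
  exact harc

end FreePath

section GoodSet

/-- The open interval of length `gapLength ε X q y` adjacent to `1 - l * b / q`, on its right
if `σ = 1` and on its left if `σ = -1`. -/
def arcSet (σ : ℤ) (l : ℕ) (ε X : ℝ) (q y b : ℕ) : Set ℝ :=
  {u | 0 < σ * (u - (1 - l * b / q)) ∧ σ * (u - (1 - l * b / q)) < gapLength ε X q y}

/-- Those `b` for which `s < 1 - l * b / q ≤ t`. -/
noncomputable def numRange (l : ℕ) (s t : ℝ) (q : ℕ) : Finset ℕ :=
  Finset.Ico ⌈q * (1 - t) / l⌉₊ ⌈q * (1 - s) / l⌉₊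

theorem mem_numRange {l q b : ℕ} {s t : ℝ} (hl : 0 < l) (hq : 0 < q) :
    b ∈ numRange l s t q ↔ s < 1 - l * b / q ∧ 1 - (l * b / q : ℝ) ≤ t := by
  have hl0 : (0 : ℝ) < l := by exact_mod_cast hl
  have hq0 : (0 : ℝ) < q := by exact_mod_cast hq
  rw [numRange, Finset.mem_Ico, Nat.ceil_le, Nat.lt_ceil, div_le_iff₀ hl0, lt_div_iff₀ hl0,
    lt_sub_comm, sub_le_comm, div_lt_iff₀ hq0, le_div_iff₀ hq0, and_comm]
  constructor <;> rintro ⟨h1, h2⟩ <;> constructor <;> linarith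

/-- The triples `(q, y, b)` enumerated by `gapSum`. -/
def arcIndex (l : ℕ) (s : ℤ) (Q : ℕ) (J : ℕ → Finset ℕ) : Finset (Σ _ : ℕ, Σ _ : ℕ, ℕ) :=
  ((Finset.Icc 1 Q).filter (Nat.Coprime l)).sigma fun q =>
    (Finset.Ico (Q - q + 1) (Q + 1)).sigma fun y =>
      (J q).filter fun b : ℕ => (s : ZMod q) * b * y = 1

/-- The points `u` of `I` that satisfy the conditions on `tan ω` in the definition of `Gmeas2`
(for `σ = 1`) or `Gmeas3` (for `σ = -1`). -/
def goodSet (σ : ℤ) (l : ℕ) (I : Set ℝ) (ε X : ℝ) (Q : ℕ) : Set ℝ :=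
  {u | u ∈ I ∧ (∀ m n : ℤ, 0 < m → (m : ℝ) ≤ X → |m * u - n| ≤ ε → (l : ℤ) ∣ m - n) ∧
    ∃ γ₁ γ₂ : ℚ, (σ = 1 ∧ ConsecFarey Q γ₁ γ₂ ∨ σ = -1 ∧ ConsecFarey Q γ₂ γ₁) ∧
      (γ₁ : ℝ) ∈ I ∧ (γ₂ : ℝ) ∈ I ∧ γ₁ ∈ FareyCong l ∧
      0 < σ * (u - γ₁) ∧ 0 < σ * (γ₂ - u)}

variable {σ : ℤ} {l Q : ℕ} {ε X : ℝ}

theorem arc_of_mem_arcSet (hε0 : 0 ≤ ε) {q y b : ℕ} (hq : 1 ≤ q)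
    (hqQ : q ≤ Q) (hy : y ∈ Finset.Ico (Q - q + 1) (Q + 1))
    (hb : ((σ * l : ℤ) : ZMod q) * b * y = 1) {u : ℝ} (hu : u ∈ arcSet σ l ε X q y b) :
    ∃ a', FareyArc Q (σ * (q - l * b)) q a' y ∧
      ((σ * (q - l * b) : ℤ) : ℝ) / q < σ * u ∧ σ * u < a' / y := by
  have hdvd : (q : ℤ) ∣ σ * (q - l * b) * y + 1 := by
    rw [← ZMod.intCast_zmod_eq_zero_iff_dvd]
    push_cast at hb ⊢
    rw [ZMod.natCast_self]
    linear_combination -hb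
  obtain ⟨a', h⟩ := FareyArc.of_dvd hq hqQ hy hdvd
  have hq0 : (0 : ℝ) < q := by exact_mod_cast hq
  have e : ((σ * (q - l * b) : ℤ) : ℝ) / q = σ * (1 - l * b / q) := by
    push_cast; field_simp
  obtain ⟨h1, h2⟩ := hu
  refine ⟨a', h, by rw [e]; linarith, ?_⟩
  have h3 := h.sub_eq
  have h4 : gapLength ε X q y ≤ 1 / (q * y) := by
    have := gapLength_le (X := X) (q := q) (y := y) hε0
    rwa [one_div_mul_one_div] at this
  rw [e] at h3
  linarith

theorem goodSet_subset (hσ : σ = 1 ∨ σ = -1) (hl : 2 ≤ l) (hQ : 2 ≤ Q) (hε : ε ≤ 1 / Q)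
    (hX : X ≤ Q) {I : Set ℝ} {u : ℝ} (hu : u ∈ goodSet σ l I ε X Q) :
    ∃ p ∈ arcIndex l (σ * l) Q (numRange l 0 1), u ∈ arcSet σ l ε X p.1 p.2.1 p.2.2 := by
  obtain ⟨-, hhit, γ₁, γ₂, hc, -, -, ⟨hγ0, hγ1, hdvd⟩, hu1, hu2⟩ := hu
  have hσ2 : σ * σ = 1 := by rcases hσ with rfl | rfl <;> norm_num
  have harc : FareyArc Q (σ * γ₁.num) γ₁.den (σ * γ₂.num) γ₂.den := by
    rcases hc with ⟨rfl, hc⟩ | ⟨rfl, hc⟩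
    · simpa using hc.fareyArc
    · simpa using hc.fareyArc.reflect
  have hnum0 : 0 < γ₁.num := Rat.num_pos.2 hγ0
  have hnum1 : γ₁.num ≤ γ₁.den := Rat.num_le_denom_iff.2 hγ1
  obtain ⟨b', hb'⟩ := hdvd
  have hl0 : (0 : ℤ) < l := by omega
  have hb0 : 0 ≤ b' := by
    by_contra! h
    nlinarith
  lift b' to ℕ using hb0
  set q := γ₁.den with hqdef
  set y := γ₂.den with hydef
  have hn : γ₁.num = q - l * b' := by linarith
  have hq0 : (0 : ℝ) < q := by exact_mod_cast harc.pos
  have hy0 : (0 : ℝ) < y := by exact_mod_cast harc.pos'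
  have hγ : (γ₁ : ℝ) = 1 - l * b' / q := by
    rw [Rat.cast_def, hn, ← hqdef]; push_cast; field_simp
  have hdet := harc.det
  have hZ : ((σ * l : ℤ) : ZMod q) * b' * y = 1 := by
    have h1 : (q : ℤ) ∣ σ * l * b' * y - 1 := ⟨-(σ * γ₂.num - σ * y), by
      rw [hn] at hdet; linear_combination hdet⟩
    rw [← ZMod.intCast_zmod_eq_zero_iff_dvd] at h1
    push_cast at h1 ⊢
    linear_combination h1
  have hcop : l.Coprime q := by
    rw [← Nat.isCoprime_iff_coprime]
    exact ⟨σ * b' * y, σ * γ₂.num - σ * y, by rw [hn] at hdet; linear_combination hdet⟩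
  refine ⟨⟨q, y, b'⟩, ?_, ?_⟩
  · have hle := harc.le
    have hle' := harc.le'
    have hadd := harc.lt_add
    have hpos := harc.pos
    simp only [arcIndex, Finset.mem_sigma, Finset.mem_filter, Finset.mem_Icc, Finset.mem_Ico]
    refine ⟨⟨⟨hpos, hle⟩, hcop⟩, ⟨by omega, by omega⟩, ?_, hZ⟩
    rw [mem_numRange (by omega) hpos, ← hγ]
    exact ⟨by exact_mod_cast hγ0, by exact_mod_cast hγ1⟩
  · have e1 : ((σ * γ₁.num : ℤ) : ℝ) / q = σ * γ₁ := by
      rw [Rat.cast_def γ₁, ← hqdef]; push_cast; ring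
    have e2 : ((σ * γ₂.num : ℤ) : ℝ) / y = σ * γ₂ := by
      rw [Rat.cast_def γ₂, ← hydef]; push_cast; ring
    have hlt2 : (σ : ℝ) * u < ((σ * γ₂.num : ℤ) : ℝ) / y := by rw [e2]; linarith
    have hσr : (σ : ℝ) * σ = 1 := by exact_mod_cast hσ2
    have key := (hits_iff_of_arc harc hQ hε hX hl (s := σ) (u := σ * u) ⟨b', by
      rw [hn]; linear_combination (l * b' - q : ℤ) * hσ2⟩ (by rw [e1]; linarith) hlt2).1 (by
        intro m n hm hmX hmn
        refine hhit m (σ * n) hm hmX ?_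
        have : (m : ℝ) * u - (σ * n : ℤ) = σ * (m * (σ * u) - n) := by
          push_cast; linear_combination (-(m : ℝ) * u) * hσr
        rw [this, abs_mul]
        rcases hσ with rfl | rfl <;> simpa using hmn)
    rw [← gapLength_lt_iff_of_arc harc hlt2, e1, hγ] at key
    refine ⟨by rw [← hγ]; exact hu1, ?_⟩
    change (σ : ℝ) * (u - (1 - l * b' / q)) < gapLength ε X q y
    linarith

theorem mem_goodSet (hσ : σ = 1 ∨ σ = -1) (hl : 2 ≤ l) (hQ : 2 ≤ Q) (hε0 : 0 ≤ ε) (hε : ε ≤ 1 / Q)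
    (hX : X ≤ Q) {I : Set ℝ} {s t : ℝ} (hs : 0 ≤ s) (ht : t ≤ 1) (hI : Set.Ioo s t ⊆ I) {u : ℝ}
    (hu1 : s + 1 / Q ≤ u) (hu2 : u ≤ t - 1 / Q)
    (hu : ∃ p ∈ arcIndex l (σ * l) Q (numRange l 0 1), u ∈ arcSet σ l ε X p.1 p.2.1 p.2.2) :
    u ∈ goodSet σ l I ε X Q := by
  obtain ⟨⟨q, y, b⟩, hp, hu⟩ := hu
  simp only [arcIndex, Finset.mem_sigma, Finset.mem_filter, Finset.mem_Icc] at hp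
  obtain ⟨⟨⟨hq1, hqQ⟩, hcop⟩, hy, hb, hZ⟩ := hp
  obtain ⟨a', harc, h1, h2⟩ := arc_of_mem_arcSet hε0 hq1 hqQ hy hZ hu
  have hσ2 : σ * σ = 1 := by rcases hσ with rfl | rfl <;> norm_num
  have hσr : (σ : ℝ) * σ = 1 := by exact_mod_cast hσ2
  have hq0 : (0 : ℝ) < q := by exact_mod_cast harc.pos
  have hy0 : (0 : ℝ) < y := by exact_mod_cast harc.pos'
  have hlen := harc.sub_eq
  have hlen' := harc.one_div_mul_le
  set n : ℤ := q - l * b with hn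
  set γ₁ : ℚ := (n : ℚ) / q with hγ₁
  set γ₂ : ℚ := ((σ * a' : ℤ) : ℚ) / y with hγ₂
  have c1 : (γ₁ : ℝ) = (n : ℝ) / q := by rw [hγ₁]; push_cast; rfl
  have c2 : (γ₂ : ℝ) = σ * (a' : ℝ) / y := by rw [hγ₂]; push_cast; rfl
  have d1 : 0 < σ * (u - γ₁) := by
    rw [c1]; push_cast at h1; rw [mul_div_assoc] at h1; linarith
  have d2 : 0 < σ * (γ₂ - u) := by
    have : (σ : ℝ) * γ₂ = a' / y := by rw [c2]; linear_combination ((a' : ℝ) / y) * hσr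
    rw [mul_sub, this]; linarith
  have d3 : σ * (γ₂ - γ₁) ≤ 1 / (Q : ℝ) := by
    have : (σ : ℝ) * γ₂ = a' / y := by rw [c2]; linear_combination ((a' : ℝ) / y) * hσr
    rw [mul_sub, this, c1]
    push_cast at hlen
    rw [mul_div_assoc] at hlen
    linarith
  have hb1 : s < γ₁ ∧ (γ₁ : ℝ) < t ∧ s < γ₂ ∧ (γ₂ : ℝ) < t := by
    rcases hσ with rfl | rfl
    · push_cast at d1 d2 d3
      refine ⟨?_, ?_, ?_, ?_⟩ <;> linarith
    · push_cast at d1 d2 d3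
      refine ⟨?_, ?_, ?_, ?_⟩ <;> linarith
  obtain ⟨b1, b2, b3, b4⟩ := hb1
  have n1 : 0 < n := by
    have : (0 : ℝ) < γ₁ := by linarith
    rw [c1, div_pos_iff_of_pos_right hq0] at this
    exact_mod_cast this
  have n2 : n ≤ q := by
    have : (γ₁ : ℝ) < 1 := by linarith
    rw [c1, div_lt_one hq0] at this
    exact_mod_cast this.le
  have m1 : 0 < σ * a' := by
    have : (0 : ℝ) < γ₂ := by linarith
    rw [c2, div_pos_iff_of_pos_right hy0] at this
    exact_mod_cast this
  have m2 : σ * a' ≤ y := by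
    have : (γ₂ : ℝ) < 1 := by linarith
    rw [c2, div_lt_one hy0] at this
    exact_mod_cast this.le
  have hncop : Nat.Coprime n.natAbs q := by
    have := harc.isCoprime.of_mul_left_right
    exact Int.isCoprime_iff_gcd_eq_one.1 this
  have hqz : (0 : ℤ) < q := by exact_mod_cast hq1
  have hnum : γ₁.num = n := by
    have := Rat.num_div_eq_of_coprime hqz hncop
    rwa [Int.cast_natCast] at this
  have hden : γ₁.den = q := by
    have := Rat.den_div_eq_of_coprime hqz hncop
    rw [Int.cast_natCast, ← hγ₁] at this
    exact_mod_cast this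
  refine ⟨hI ⟨?_, ?_⟩, ?_, γ₁, γ₂, ?_, hI ⟨b1, b2⟩, hI ⟨b3, b4⟩, ⟨?_, ?_, ?_⟩, d1, d2⟩
  · have : (0 : ℝ) < 1 / Q := by positivity
    linarith
  · have : (0 : ℝ) < 1 / Q := by positivity
    linarith
  · have hg := hu.2
    have key := (hits_iff_of_arc harc hQ hε hX hl (s := σ) (u := σ * u) ⟨b, by
      rw [hn]; linear_combination (l * b - q : ℤ) * hσ2⟩ h1 h2).2 (by
        rw [← gapLength_lt_iff_of_arc harc h2]
        have e : ((σ * n : ℤ) : ℝ) / q = σ * (1 - l * b / q) := by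
          rw [hn]; push_cast; field_simp
        rw [e]
        change (σ : ℝ) * (u - (1 - l * b / q)) < gapLength ε X q y at hg
        linarith)
    intro m k hm hmX hmk
    have := key m (σ * k) hm hmX (by
      have : (m : ℝ) * (σ * u) - (σ * k : ℤ) = σ * (m * u - k) := by push_cast; ring
      rw [this, abs_mul]
      rcases hσ with rfl | rfl <;> simpa using hmk)
    rwa [← mul_assoc, hσ2, one_mul] at this
  · rcases hσ with rfl | rfl
    · left
      refine ⟨rfl, ?_⟩
      rw [one_mul] at harc m2 hγ₂
      rw [hγ₁, hγ₂]
      exact harc.consecFarey n1 m2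
    · right
      refine ⟨rfl, ?_⟩
      have h3 := harc.reflect
      have e1 : -(-1 * n) = n := by ring
      have e2 : -a' = -1 * a' := by ring
      rw [e1, e2] at h3
      exact h3.consecFarey m1 n2
  · exact_mod_cast (by linarith : (0 : ℝ) < γ₁)
  · exact_mod_cast (by linarith : (γ₁ : ℝ) ≤ 1)
  · rw [hnum, hden, hn]
    exact ⟨b, by ring⟩

end GoodSet

section ArcUnion

/-- The union of the arcs enumerated by `gapSum`. -/
def arcUnion (σ : ℤ) (l : ℕ) (ε X : ℝ) (Q : ℕ) (J : ℕ → Finset ℕ) : Set ℝ :=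
  ⋃ p ∈ arcIndex l (σ * l) Q J, arcSet σ l ε X p.1 p.2.1 p.2.2

theorem mem_arcUnion {σ : ℤ} {l : ℕ} {ε X : ℝ} {Q : ℕ} {J : ℕ → Finset ℕ} {u : ℝ} :
    u ∈ arcUnion σ l ε X Q J ↔
      ∃ p ∈ arcIndex l (σ * l) Q J, u ∈ arcSet σ l ε X p.1 p.2.1 p.2.2 := by
  simp [arcUnion]

variable {σ : ℤ} {l Q : ℕ} {ε X : ℝ}

theorem arcSet_eq_Ioo (hσ : σ = 1 ∨ σ = -1) (q y b : ℕ) :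
    ∃ c, arcSet σ l ε X q y b = Set.Ioo c (c + gapLength ε X q y) := by
  rcases hσ with rfl | rfl
  · refine ⟨1 - l * b / q, ?_⟩
    ext u
    simp only [arcSet, Set.mem_ofPred_eq, Set.mem_Ioo]
    push_cast
    constructor <;> rintro ⟨h1, h2⟩ <;> constructor <;> linarith
  · refine ⟨1 - l * b / q - gapLength ε X q y, ?_⟩
    ext u
    simp only [arcSet, Set.mem_ofPred_eq, Set.mem_Ioo]
    push_cast
    constructor <;> rintro ⟨h1, h2⟩ <;> constructor <;> linarith

theorem measurableSet_arcSet (hσ : σ = 1 ∨ σ = -1) (q y b : ℕ) :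
    MeasurableSet (arcSet σ l ε X q y b) := by
  obtain ⟨c, hc⟩ := arcSet_eq_Ioo (l := l) (ε := ε) (X := X) hσ q y b
  rw [hc]; exact measurableSet_Ioo

theorem measurableSet_arcUnion (hσ : σ = 1 ∨ σ = -1) (J : ℕ → Finset ℕ) :
    MeasurableSet (arcUnion σ l ε X Q J) :=
  Finset.measurableSet_biUnion _ fun _ _ => measurableSet_arcSet hσ _ _ _

theorem volume_real_arcUnion (hσ : σ = 1 ∨ σ = -1) (hl : 0 < l) (hε0 : 0 ≤ ε) (hε : ε ≤ 1 / Q)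
    (J : ℕ → Finset ℕ) : volume.real (arcUnion σ l ε X Q J) = gapSum l (σ * l) ε X Q J := by
  have hσ0 : σ ≠ 0 := by rcases hσ with rfl | rfl <;> norm_num
  have hdisj : ((arcIndex l (σ * l) Q J : Finset _) : Set (Σ _ : ℕ, Σ _ : ℕ, ℕ)).PairwiseDisjoint
      fun p => arcSet σ l ε X p.1 p.2.1 p.2.2 := by
    rintro ⟨q, y, b⟩ hp ⟨q', y', b'⟩ hp' hne
    rw [Function.onFun, Set.disjoint_left]
    intro u hu hu'
    refine hne ?_
    simp only [arcIndex, Finset.mem_coe, Finset.mem_sigma, Finset.mem_filter, Finset.mem_Icc]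
      at hp hp'
    obtain ⟨a, h, h1, h2⟩ := arc_of_mem_arcSet hε0 hp.1.1.1 hp.1.1.2 hp.2.1 hp.2.2.2 hu
    obtain ⟨a', h', h1', h2'⟩ := arc_of_mem_arcSet hε0 hp'.1.1.1 hp'.1.1.2 hp'.2.1 hp'.2.2.2 hu'
    obtain ⟨e1, rfl, -, rfl⟩ := h.unique h' h1 h2 h1' h2'
    have e2 := mul_left_cancel₀ hσ0 e1
    have e3 : (l : ℤ) * b = l * b' := by linarith
    have e4 := mul_left_cancel₀ (by exact_mod_cast hl.ne') e3
    have e5 : b = b' := by exact_mod_cast e4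
    rw [e5]
  rw [arcUnion, measureReal_biUnion_finset hdisj (fun _ _ => measurableSet_arcSet hσ _ _ _) (by
    rintro ⟨q, y, b⟩ -
    obtain ⟨c, hc⟩ := arcSet_eq_Ioo (l := l) (ε := ε) (X := X) hσ q y b
    simp only [hc, Real.volume_Ioo]
    exact ENNReal.ofReal_ne_top)]
  have hlen : ∀ p ∈ arcIndex l (σ * l) Q J,
      volume.real (arcSet σ l ε X p.1 p.2.1 p.2.2) = gapLength ε X p.1 p.2.1 := by
    rintro ⟨q, y, b⟩ hp
    simp only [arcIndex, Finset.mem_sigma, Finset.mem_filter, Finset.mem_Icc] at hp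
    obtain ⟨c, hc⟩ := arcSet_eq_Ioo (l := l) (ε := ε) (X := X) hσ q y b
    have hq0 : (0 : ℝ) < q := by exact_mod_cast hp.1.1.1
    have hqQ : (q : ℝ) ≤ Q := by exact_mod_cast hp.1.1.2
    have h0 : 0 ≤ gapLength ε X q y :=
      gapLength_nonneg hε0 (hε.trans (one_div_le_one_div_of_le hq0 hqQ))
    simp only [hc]
    rw [Real.volume_real_Ioo_of_le (by linarith)]; ring
  rw [Finset.sum_congr rfl hlen, arcIndex, Finset.sum_sigma, gapSum]
  refine Finset.sum_congr rfl fun q _ => ?_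
  rw [Finset.sum_sigma]
  refine Finset.sum_congr rfl fun y _ => ?_
  dsimp only
  rw [Finset.sum_const, nsmul_eq_mul, mul_comm]

theorem arcUnion_symmDiff (hσ : σ = 1 ∨ σ = -1) (hl : 0 < l) (hε0 : 0 ≤ ε) {s t : ℝ}
    (hs : 0 ≤ s) (ht : t ≤ 1) :
    arcUnion σ l ε X Q (numRange l 0 1) ∩ Set.Ioo s t ⊆
      arcUnion σ l ε X Q (numRange l s t) ∪
        (Set.Icc (s - 1 / Q) (s + 1 / Q) ∪ Set.Icc (t - 1 / Q) (t + 1 / Q)) ∧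
    arcUnion σ l ε X Q (numRange l s t) ⊆
      (arcUnion σ l ε X Q (numRange l 0 1) ∩ Set.Ioo s t) ∪
        (Set.Icc (s - 1 / Q) (s + 1 / Q) ∪ Set.Icc (t - 1 / Q) (t + 1 / Q)) := by
  have hnear : ∀ {q y b : ℕ} {u : ℝ}, 1 ≤ q → q ≤ Q → y ∈ Finset.Ico (Q - q + 1) (Q + 1) →
      ((σ * l : ℤ) : ZMod q) * b * y = 1 → u ∈ arcSet σ l ε X q y b →
      |u - (1 - l * b / q)| ≤ 1 / Q := by
    intro q y b u hq hqQ hy hb hu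
    obtain ⟨a', h, -, -⟩ := arc_of_mem_arcSet hε0 hq hqQ hy hb hu
    have h4 : gapLength ε X q y ≤ 1 / (q * y) := by
      have := gapLength_le (X := X) (q := q) (y := y) hε0
      rwa [one_div_mul_one_div] at this
    have h5 := h.one_div_mul_le
    obtain ⟨h1, h2⟩ := hu
    rw [abs_le]
    rcases hσ with rfl | rfl <;> push_cast at h1 h2 <;> constructor <;> linarith
  constructor
  · rintro u ⟨hu, hsu, hut⟩
    rw [mem_arcUnion] at hu
    obtain ⟨⟨q, y, b⟩, hp, hu⟩ := hu
    simp only [arcIndex, Finset.mem_sigma, Finset.mem_filter, Finset.mem_Icc] at hp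
    obtain ⟨⟨⟨hq1, hqQ⟩, hcop⟩, hy, hb, hZ⟩ := hp
    have h1 := abs_le.1 (hnear hq1 hqQ hy hZ hu)
    by_cases hs1 : u ≤ s + 1 / Q
    · right; left; constructor <;> linarith
    by_cases ht1 : t - 1 / Q ≤ u
    · right; right; constructor <;> linarith
    left
    rw [mem_arcUnion]
    refine ⟨⟨q, y, b⟩, ?_, hu⟩
    simp only [arcIndex, Finset.mem_sigma, Finset.mem_filter, Finset.mem_Icc]
    refine ⟨⟨⟨hq1, hqQ⟩, hcop⟩, hy, ?_, hZ⟩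
    rw [mem_numRange hl hq1]
    constructor <;> linarith
  · intro u hu
    rw [mem_arcUnion] at hu
    obtain ⟨⟨q, y, b⟩, hp, hu⟩ := hu
    simp only [arcIndex, Finset.mem_sigma, Finset.mem_filter, Finset.mem_Icc] at hp
    obtain ⟨⟨⟨hq1, hqQ⟩, hcop⟩, hy, hb, hZ⟩ := hp
    have h1 := abs_le.1 (hnear hq1 hqQ hy hZ hu)
    rw [mem_numRange hl hq1] at hb
    by_cases hs1 : u ≤ s
    · right; left; constructor <;> linarith
    by_cases ht1 : t ≤ u
    · right; right; constructor <;> linarith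
    left
    refine ⟨mem_arcUnion.2 ⟨⟨q, y, b⟩, ?_, hu⟩, by linarith, by linarith⟩
    simp only [arcIndex, Finset.mem_sigma, Finset.mem_filter, Finset.mem_Icc]
    refine ⟨⟨⟨hq1, hqQ⟩, hcop⟩, hy, ?_, hZ⟩
    rw [mem_numRange hl hq1]
    constructor <;> linarith

theorem card_numRange {s t : ℝ} (hl : 0 < l) (hst : s ≤ t) (ht : t ≤ 1) (q : ℕ) :
    |((numRange l s t q).card : ℝ) - q * ((t - s) / l)| ≤ 2 := by
  have hl0 : (0 : ℝ) < l := by exact_mod_cast hl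
  have h1 : (0 : ℝ) ≤ q * (1 - t) / l := by
    have : 0 ≤ 1 - t := by linarith
    positivity
  have h2 : (q : ℝ) * (1 - t) / l ≤ q * (1 - s) / l := by gcongr
  rw [numRange, Nat.card_Ico, Nat.cast_sub (Nat.ceil_le_ceil h2)]
  have a1 := Nat.le_ceil ((q : ℝ) * (1 - t) / l)
  have a2 := Nat.ceil_lt_add_one h1
  have b1 := Nat.le_ceil ((q : ℝ) * (1 - s) / l)
  have b2 := Nat.ceil_lt_add_one (h1.trans h2)
  have e : (q : ℝ) * ((t - s) / l) = q * (1 - s) / l - q * (1 - t) / l := by ring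
  rw [e, abs_le]
  constructor <;> linarith

theorem abs_volume_arcUnion_inter_sub_le (hσ : σ = 1 ∨ σ = -1) (hl : 1 ≤ l) (hQ : 1 ≤ Q) {M : ℝ}
    (hM : 1 + Real.log Q ≤ M) (hτ : ∀ n ≠ 0, n ≤ Q → (n.divisors.card : ℝ) ≤ M) {lam : ℝ}
    (hε0 : 0 ≤ ε) (hε : ε ≤ 1 / Q) (hε1 : 1 ≤ ε * (Q + 1)) (hlam0 : 0 ≤ lam) (hlam1 : lam ≤ 1)
    {s t : ℝ} (hs : 0 ≤ s) (hst : s ≤ t) (ht : t ≤ 1) :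
    |volume.real (arcUnion σ l ε (lam * Q) Q (numRange l 0 1) ∩ Set.Ioo s t) -
      Cconst l * (zeta2 - lam) / l * (t - s)| ≤
      (48 + (4 * (l + 2) + 3 * |Cconst l|)) * M ^ 7 / √Q := by
  have hQ0 : (0 : ℝ) < Q := by exact_mod_cast hQ
  have hl0 : (1 : ℝ) ≤ l := by exact_mod_cast hl
  have hL : 0 ≤ Real.log Q := Real.log_natCast_nonneg _
  have hM1 : 1 ≤ M := by linarith
  set N := Set.Icc (s - 1 / Q) (s + 1 / (Q : ℝ)) ∪ Set.Icc (t - 1 / Q) (t + 1 / (Q : ℝ)) with hN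
  have hNv : volume.real N ≤ 4 / Q := by
    have h0 : (0 : ℝ) ≤ 1 / Q := by positivity
    refine (measureReal_union_le _ _).trans ?_
    rw [Real.volume_real_Icc_of_le (by linarith), Real.volume_real_Icc_of_le (by linarith)]
    apply le_of_eq; ring
  have hUfin : ∀ J, volume (arcUnion σ l ε (lam * Q) Q J) ≠ ⊤ := by
    intro J
    refine ((measure_biUnion_lt_top (Finset.finite_toSet _) ?_)).ne
    rintro ⟨q, y, b⟩ -
    obtain ⟨c, hc⟩ := arcSet_eq_Ioo (l := l) (ε := ε) (X := lam * Q) hσ q y b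
    simp only [hc, Real.volume_Ioo]
    exact ENNReal.ofReal_lt_top
  have hNfin : volume N ≠ ⊤ := by
    refine (measure_union_lt_top ?_ ?_).ne <;> rw [Real.volume_Icc] <;> exact ENNReal.ofReal_lt_top
  obtain ⟨i1, i2⟩ := arcUnion_symmDiff (Q := Q) (X := lam * Q) hσ hl hε0 hs ht
  have j1 : volume.real (arcUnion σ l ε (lam * Q) Q (numRange l 0 1) ∩ Set.Ioo s t) ≤
      gapSum l (σ * l) ε (lam * Q) Q (numRange l s t) + 4 / Q := by
    refine (measureReal_mono i1 (measure_union_lt_top (hUfin _).lt_top hNfin.lt_top).ne).trans ?_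
    refine (measureReal_union_le _ _).trans ?_
    rw [volume_real_arcUnion hσ hl hε0 hε]
    linarith
  have j2 : gapSum l (σ * l) ε (lam * Q) Q (numRange l s t) ≤
      volume.real (arcUnion σ l ε (lam * Q) Q (numRange l 0 1) ∩ Set.Ioo s t) + 4 / Q := by
    rw [← volume_real_arcUnion hσ hl hε0 hε]
    refine (measureReal_mono i2 (measure_union_lt_top
      ((measure_mono Set.inter_subset_left).trans_lt (hUfin _).lt_top) hNfin.lt_top).ne).trans ?_
    refine (measureReal_union_le _ _).trans ?_
    linarith
  have hs1 : ((σ * l : ℤ)).natAbs = l := by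
    rcases hσ with rfl | rfl <;> simp
  have k1 := abs_gapSum_sub_le hs1 hQ hM hτ (X := lam * Q) (Z := (t - s) / l) hε0 hε
    (J := numRange l s t) (a := fun q => ⌈q * (1 - t) / l⌉₊) (c := fun q => ⌈q * (1 - s) / l⌉₊) (by
      intro q hq
      refine ⟨rfl, ?_, card_numRange hl hst ht q⟩
      rw [Nat.ceil_le, div_le_iff₀ (by linarith)]
      have : (0 : ℝ) ≤ q := by positivity
      nlinarith)
  have k2 := abs_sum_totient_gapLength_sub_le hl hQ hε0 hε hε1 hlam0 hlam1
  set T := ∑ q ∈ (Finset.Icc 1 Q).filter (Nat.Coprime l), (q.totient / q : ℝ) *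
        ∑ y ∈ Finset.Ico (Q - q + 1) (Q + 1), gapLength ε (lam * Q) q y
  have hZ0 : 0 ≤ (t - s) / l := div_nonneg (by linarith) (by linarith)
  have hZ1 : (t - s) / l ≤ 1 := by rw [div_le_one (by linarith)]; linarith
  have k3 : |(t - s) / l * T - Cconst l * (zeta2 - lam) / l * (t - s)| ≤
      (4 * (l + 2) + 3 * |Cconst l|) * (1 + Real.log Q) ^ 2 / Q := by
    have : (t - s) / l * T - Cconst l * (zeta2 - lam) / l * (t - s) =
        (t - s) / l * (T - Cconst l * (zeta2 - lam)) := by ring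
    rw [this, abs_mul, abs_of_nonneg hZ0]
    exact (mul_le_of_le_one_left (abs_nonneg _) hZ1).trans k2
  have hsq : √(Q : ℝ) ≤ Q := by
    rw [Real.sqrt_le_left hQ0.le]
    have : (1 : ℝ) ≤ Q := by exact_mod_cast hQ
    nlinarith
  have hsq0 : 0 < √(Q : ℝ) := by positivity
  have m1 : 4 / (Q : ℝ) ≤ 4 * M ^ 7 / √Q := by
    have : 1 ≤ M ^ 7 := one_le_pow₀ hM1
    gcongr; linarith
  have m2 : (4 * (l + 2) + 3 * |Cconst l|) * (1 + Real.log Q) ^ 2 / Q ≤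
      (4 * (l + 2) + 3 * |Cconst l|) * M ^ 7 / √Q := by
    have : (1 + Real.log Q) ^ 2 ≤ M ^ 7 :=
      (pow_le_pow_left₀ (by positivity) hM 2).trans (pow_le_pow_right₀ hM1 (by norm_num))
    gcongr
  have e : (48 + (4 * (l + 2) + 3 * |Cconst l|)) * M ^ 7 / √Q =
      4 * M ^ 7 / √Q + (44 * M ^ 7 / √Q + (4 * (l + 2) + 3 * |Cconst l|) * M ^ 7 / √Q) := by ring
  rw [e]
  rw [abs_le] at k1 k3 ⊢
  constructor <;> linarith [k1.1, k1.2, k3.1, k3.2]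

end ArcUnion

section ArctanMeasure

theorem toReal_volume_arctan_image {S : Set ℝ} (hS : MeasurableSet S) :
    (volume (Real.arctan '' S)).toReal = ∫ u in S, 1 / (1 + u ^ 2) := by
  have h := integral_image_eq_integral_abs_deriv_smul (F := ℝ) hS
    (fun x _ => (Real.hasDerivAt_arctan x).hasDerivWithinAt) Real.arctan_injective.injOn
    (fun _ => 1)
  rw [setIntegral_const, smul_eq_mul, mul_one] at h
  rw [← measureReal_def, h]
  refine setIntegral_congr_fun hS fun u _ => ?_
  have : (0 : ℝ) < 1 + u ^ 2 := by positivity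
  simp only [smul_eq_mul, mul_one]
  rw [abs_of_pos (by positivity)]

theorem integrable_weight_restrict (S : Set ℝ) :
    Integrable (fun u : ℝ => 1 / (1 + u ^ 2)) (volume.restrict S) := by
  simp_rw [one_div]
  exact integrable_inv_one_add_sq.restrict

theorem Ioo_inter_superlevel {s t r : ℝ} (hs : 0 ≤ s) (hst : s ≤ t) (hr : 0 < r) (hr1 : r ≤ 1) :
    ∃ t', s ≤ t' ∧ t' ≤ t ∧ ∀ u, u ≠ t' →
      ((r ≤ 1 / (1 + u ^ 2) ∧ u ∈ Set.Ioo s t) ↔ u ∈ Set.Ioo s t') := by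
  have hr' : 0 ≤ 1 / r - 1 := by
    rw [sub_nonneg, le_div_iff₀ hr]; linarith
  refine ⟨max s (min t √(1 / r - 1)), le_max_left _ _, max_le hst (min_le_left _ _), ?_⟩
  intro u hu
  have key : 0 ≤ u → (r ≤ 1 / (1 + u ^ 2) ↔ u ≤ √(1 / r - 1)) := by
    intro hu0
    rw [Real.le_sqrt hu0 hr', le_div_iff₀ (by positivity), le_sub_iff_add_le, le_div_iff₀ hr,
      mul_comm, add_comm]
  constructor
  · rintro ⟨h1, h2, h3⟩
    rw [key (by linarith)] at h1
    exact ⟨h2, lt_of_le_of_ne (le_max_of_le_right (le_min h3.le h1)) hu⟩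
  · rintro ⟨h2, h3⟩
    have h4 : u < min t √(1 / r - 1) := by
      rcases lt_max_iff.1 h3 with h | h
      · exact absurd h (not_lt.2 h2.le)
      · exact h
    rw [lt_min_iff] at h4
    exact ⟨(key (by linarith)).2 h4.2.le, h2, h4.1⟩

theorem abs_setIntegral_weight_sub_le {U : Set ℝ} {κ E : ℝ}
    (H : ∀ s t : ℝ, 0 ≤ s → s ≤ t → t ≤ 1 →
      |volume.real (U ∩ Set.Ioo s t) - κ * (t - s)| ≤ E)
    {s t : ℝ} (hs : 0 ≤ s) (hst : s ≤ t) (ht : t ≤ 1) :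
    |(∫ u in U ∩ Set.Ioo s t, 1 / (1 + u ^ 2)) - κ * ∫ u in Set.Ioo s t, 1 / (1 + u ^ 2)| ≤ E := by
  have hw0 : ∀ u : ℝ, 0 ≤ 1 / (1 + u ^ 2) := fun u => by positivity
  have hw1 : ∀ u : ℝ, 1 / (1 + u ^ 2) ≤ 1 := fun u => by
    rw [div_le_one (by positivity)]; nlinarith [sq_nonneg u]
  have hlc : ∀ S : Set ℝ, ∫ u in S, 1 / (1 + u ^ 2) =
      ∫ r in Set.Ioc (0 : ℝ) 1, (volume.restrict S).real {u | r ≤ 1 / (1 + u ^ 2)} := fun S =>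
    (integrable_weight_restrict S).integral_eq_integral_Ioc_meas_le
      (Eventually.of_forall hw0) (Eventually.of_forall hw1)
  have hlev : ∀ r, MeasurableSet {u : ℝ | r ≤ 1 / (1 + u ^ 2)} := fun r =>
    measurableSet_le measurable_const (by fun_prop)
  have hantiInt : ∀ S : Set ℝ, S ⊆ Set.Ioo s t → IntegrableOn
      (fun r => (volume.restrict S).real {u : ℝ | r ≤ 1 / (1 + u ^ 2)}) (Set.Ioc 0 1) := by
    intro S hS
    have hfin : volume S ≠ ⊤ := ((measure_mono hS).trans_lt (by
      rw [Real.volume_Ioo]; exact ENNReal.ofReal_lt_top)).ne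
    have hanti : Antitone fun r => (volume.restrict S).real {u : ℝ | r ≤ 1 / (1 + u ^ 2)} := by
      intro r r' hrr
      refine measureReal_mono (fun u hu => le_trans hrr hu) ?_
      rw [Measure.restrict_apply (hlev r)]
      exact ((measure_mono Set.inter_subset_right).trans_lt hfin.lt_top).ne
    exact ((hanti.antitoneOn _).integrableOn_isCompact isCompact_Icc).mono_set
      Set.Ioc_subset_Icc_self
  rw [hlc, hlc, ← integral_const_mul, ← integral_sub (hantiInt _ Set.inter_subset_right)
    ((hantiInt _ subset_rfl).const_mul κ), ← Real.norm_eq_abs]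
  refine (norm_setIntegral_le_of_norm_le_const (C := E) (by simp) fun r hr => ?_).trans ?_
  · obtain ⟨t', h1, h2, h3⟩ := Ioo_inter_superlevel hs hst hr.1 hr.2
    have hae : ∀ V : Set ℝ, ({u : ℝ | r ≤ 1 / (1 + u ^ 2)} ∩ (V ∩ Set.Ioo s t) : Set ℝ)
        =ᵐ[volume] (V ∩ Set.Ioo s t' : Set ℝ) := by
      intro V
      filter_upwards [compl_mem_ae_iff.2 (measure_singleton (μ := volume) t')] with u hu
      refine propext ?_
      have := h3 u hu
      change (r ≤ 1 / (1 + u ^ 2) ∧ u ∈ V ∧ u ∈ Set.Ioo s t) ↔ u ∈ V ∧ u ∈ Set.Ioo s t'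
      tauto
    have e1 : (volume.restrict (U ∩ Set.Ioo s t)).real {u : ℝ | r ≤ 1 / (1 + u ^ 2)} =
        volume.real (U ∩ Set.Ioo s t') := by
      rw [measureReal_restrict_apply (hlev r)]
      exact measureReal_congr (hae U)
    have e2 : (volume.restrict (Set.Ioo s t)).real {u : ℝ | r ≤ 1 / (1 + u ^ 2)} = t' - s := by
      rw [measureReal_restrict_apply (hlev r)]
      have := measureReal_congr (hae Set.univ)
      rw [Set.univ_inter, Set.univ_inter] at this
      rw [this, Real.volume_real_Ioo_of_le h1]
    rw [e1, e2, Real.norm_eq_abs]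
    exact H s t' hs h1 (h2.trans ht)
  · simp

/-- An order-connected subset of `[0, 1]` lies between `(s, t)` and `[s, t]`. -/
theorem exists_Ioo_subset_of_ordConnected {I : Set ℝ} (hI : I ⊆ Set.Icc 0 1)
    (hc : I.OrdConnected) : ∃ s t, 0 ≤ s ∧ s ≤ t ∧ t ≤ 1 ∧ Set.Ioo s t ⊆ I ∧ I ⊆ Set.Icc s t := by
  rcases I.eq_empty_or_nonempty with rfl | hne
  · exact ⟨0, 0, le_rfl, le_rfl, zero_le_one, by simp, by simp⟩
  have hbb : BddBelow I := ⟨0, fun x hx => (hI hx).1⟩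
  have hba : BddAbove I := ⟨1, fun x hx => (hI hx).2⟩
  obtain ⟨x, hx⟩ := hne
  refine ⟨sInf I, sSup I, le_csInf ⟨x, hx⟩ fun y hy => (hI hy).1,
    (csInf_le hbb hx).trans (le_csSup hba hx), csSup_le ⟨x, hx⟩ fun y hy => (hI hy).2, ?_,
    fun y hy => ⟨csInf_le hbb hy, le_csSup hba hy⟩⟩
  rintro y ⟨h1, h2⟩
  obtain ⟨a, ha, hay⟩ := exists_lt_of_csInf_lt ⟨x, hx⟩ h1
  obtain ⟨b, hb, hyb⟩ := exists_lt_of_lt_csSup ⟨x, hx⟩ h2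
  exact hc.out ha hb ⟨hay.le, hyb.le⟩

/-- If `S` agrees with `U` on `I` away from the endpoints of `I`, the measure of `arctan '' S` is
estimated by the density of `U`. -/
theorem abs_volume_arctan_image_sub_le {U S I : Set ℝ} (hU : MeasurableSet U) {κ E η : ℝ}
    (hη : 0 ≤ η) (H : ∀ s t : ℝ, 0 ≤ s → s ≤ t → t ≤ 1 →
      |volume.real (U ∩ Set.Ioo s t) - κ * (t - s)| ≤ E)
    {s t : ℝ} (hs : 0 ≤ s) (hst : s ≤ t) (ht : t ≤ 1) (hI1 : Set.Ioo s t ⊆ I)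
    (hI2 : I ⊆ Set.Icc s t) (hS1 : S ⊆ U ∩ I)
    (hS2 : U ∩ Set.Icc (s + η) (t - η) ⊆ S) :
    |(volume (Real.arctan '' S)).toReal - κ * ∫ u in I, 1 / (1 + u ^ 2)| ≤ E + 2 * η := by
  have hw0 : ∀ u : ℝ, 0 ≤ 1 / (1 + u ^ 2) := fun u => by positivity
  have hw1 : ∀ u : ℝ, 1 / (1 + u ^ 2) ≤ 1 := fun u => by
    rw [div_le_one (by positivity)]; nlinarith [sq_nonneg u]
  have hIae : I =ᵐ[volume] Set.Ioo s t :=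
    (Filter.EventuallyLE.antisymm (LE.le.eventuallyLE hI2 |>.trans
      Ioo_ae_eq_Icc.symm.le) (LE.le.eventuallyLE hI1))
  rw [setIntegral_congr_set hIae]
  have hmain := abs_setIntegral_weight_sub_le H hs hst ht
  have hfin : ∀ T : Set ℝ, volume (Real.arctan '' T) ≠ ⊤ := by
    intro T
    refine ((measure_mono (t := Set.Icc (-(π / 2)) (π / 2)) ?_).trans_lt (by
      rw [Real.volume_Icc]; exact ENNReal.ofReal_lt_top)).ne
    rintro _ ⟨x, -, rfl⟩
    exact ⟨(Real.neg_pi_div_two_lt_arctan x).le, (Real.arctan_lt_pi_div_two x).le⟩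
  have hup : (volume (Real.arctan '' S)).toReal ≤ ∫ u in U ∩ Set.Ioo s t, 1 / (1 + u ^ 2) := by
    have h1 : (volume (Real.arctan '' S)).toReal ≤
        (volume (Real.arctan '' (U ∩ Set.Icc s t))).toReal :=
      ENNReal.toReal_mono (hfin _) (measure_mono (Set.image_mono
        (hS1.trans (Set.inter_subset_inter_right _ hI2))))
    rw [toReal_volume_arctan_image (hU.inter measurableSet_Icc)] at h1
    rw [setIntegral_congr_set ((ae_eq_refl U).inter Ioo_ae_eq_Icc)]
    exact h1
  have hlow : (∫ u in U ∩ Set.Ioo s t, 1 / (1 + u ^ 2)) - 2 * η ≤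
      (volume (Real.arctan '' S)).toReal := by
    have h1 : (volume (Real.arctan '' (U ∩ Set.Icc (s + η) (t - η)))).toReal ≤
        (volume (Real.arctan '' S)).toReal :=
      ENNReal.toReal_mono (hfin _) (measure_mono (Set.image_mono hS2))
    rw [toReal_volume_arctan_image (hU.inter measurableSet_Icc)] at h1
    have h2 : (∫ u in U ∩ Set.Ioo s t, 1 / (1 + u ^ 2)) ≤
        (∫ u in U ∩ Set.Icc (s + η) (t - η), 1 / (1 + u ^ 2)) +
        ∫ u in Set.Icc s (s + η) ∪ Set.Icc (t - η) t, 1 / (1 + u ^ 2) := by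
      have hsub : U ∩ Set.Ioo s t ⊆ (U ∩ Set.Icc (s + η) (t - η)) ∪
          (Set.Icc s (s + η) ∪ Set.Icc (t - η) t) := by
        rintro u ⟨hu, h1, h2⟩
        by_cases h3 : u ≤ s + η
        · right; left; exact ⟨h1.le, h3⟩
        by_cases h4 : t - η ≤ u
        · right; right; exact ⟨h4, h2.le⟩
        left
        exact ⟨hu, by linarith, by linarith⟩
      rw [← toReal_volume_arctan_image (hU.inter measurableSet_Ioo),
        ← toReal_volume_arctan_image (hU.inter measurableSet_Icc),
        ← toReal_volume_arctan_image (measurableSet_Icc.union measurableSet_Icc),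
        ← ENNReal.toReal_add (hfin _) (hfin _)]
      refine ENNReal.toReal_mono (ENNReal.add_ne_top.2 ⟨hfin _, hfin _⟩) ?_
      refine (measure_mono (Set.image_mono hsub)).trans ?_
      rw [Set.image_union]
      exact measure_union_le _ _
    have h3 : ∫ u in Set.Icc s (s + η) ∪ Set.Icc (t - η) t, 1 / (1 + u ^ 2) ≤ 2 * η := by
      have hv : volume.real (Set.Icc s (s + η) ∪ Set.Icc (t - η) t) ≤ 2 * η := by
        refine (measureReal_union_le _ _).trans ?_
        rw [Real.volume_real_Icc_of_le (by linarith), Real.volume_real_Icc_of_le (by linarith)]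
        apply le_of_eq; ring
      have hlt : volume (Set.Icc s (s + η) ∪ Set.Icc (t - η) t) < ⊤ := by
        refine measure_union_lt_top ?_ ?_ <;> rw [Real.volume_Icc] <;> exact ENNReal.ofReal_lt_top
      have := norm_setIntegral_le_of_norm_le_const (C := 1)
        (f := fun u : ℝ => 1 / (1 + u ^ 2)) hlt
        (fun u _ => by rw [Real.norm_eq_abs, abs_of_nonneg (hw0 u)]; exact hw1 u)
      rw [one_mul] at this
      exact (le_abs_self _).trans (this.trans hv)
    linarith
  rw [abs_le] at hmain ⊢
  constructor <;> linarith [hmain.1, hmain.2]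

end ArctanMeasure

section PowerSaving

theorem Gmeas2_eq_goodSet {l : ℕ} {I : Set ℝ} {ε lam : ℝ} (hlam : 0 ≤ lam) :
    Gmeas2 l I ε lam = (volume (Real.arctan ''
      goodSet 1 l I ε (lam * (⌊1 / ε⌋₊ : ℝ)) ⌊1 / ε⌋₊)).toReal := by
  unfold Gmeas2
  congr 2
  ext ω
  constructor
  · rintro ⟨⟨u, hu, rfl⟩, h1, γ, γ', h2, h3, h4, h5, h6, h7⟩
    rw [ofReal_lt_qfree_iff (by positivity)] at h1
    rw [Real.tan_arctan] at h1 h6 h7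
    refine ⟨u, ⟨hu, h1, γ, γ', Or.inl ⟨rfl, h2⟩, h3, h4, h5, ?_, ?_⟩, rfl⟩ <;>
    · push_cast; linarith
  · rintro ⟨u, ⟨hu, h1, γ, γ', h2, h3, h4, h5, h6, h7⟩, rfl⟩
    push_cast at h6 h7
    refine ⟨⟨u, hu, rfl⟩, ?_, γ, γ', ?_, h3, h4, h5, ?_, ?_⟩
    · rw [ofReal_lt_qfree_iff (by positivity), Real.tan_arctan]
      exact h1
    · rcases h2 with h2 | h2
      · exact h2.2
      · exact absurd h2.1 (by norm_num)
    · rw [Real.tan_arctan]; linarith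
    · rw [Real.tan_arctan]; linarith

theorem Gmeas3_eq_goodSet {l : ℕ} {I : Set ℝ} {ε lam : ℝ} (hlam : 0 ≤ lam) :
    Gmeas3 l I ε lam = (volume (Real.arctan ''
      goodSet (-1) l I ε (lam * (⌊1 / ε⌋₊ : ℝ)) ⌊1 / ε⌋₊)).toReal := by
  unfold Gmeas3
  congr 2
  ext ω
  constructor
  · rintro ⟨⟨u, hu, rfl⟩, h1, γ, γ', h2, h3, h4, h5, h6, h7⟩
    rw [ofReal_lt_qfree_iff (by positivity)] at h1
    rw [Real.tan_arctan] at h1 h6 h7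
    refine ⟨u, ⟨hu, h1, γ', γ, Or.inr ⟨rfl, h2⟩, h4, h3, h5, ?_, ?_⟩, rfl⟩ <;>
    · push_cast; linarith
  · rintro ⟨u, ⟨hu, h1, γ', γ, h2, h3, h4, h5, h6, h7⟩, rfl⟩
    push_cast at h6 h7
    refine ⟨⟨u, hu, rfl⟩, ?_, γ, γ', ?_, h4, h3, h5, ?_, ?_⟩
    · rw [ofReal_lt_qfree_iff (by positivity), Real.tan_arctan]
      exact h1
    · rcases h2 with h2 | h2
      · exact absurd h2.1 (by norm_num)
      · exact h2.2
    · rw [Real.tan_arctan]; linarith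
    · rw [Real.tan_arctan]; linarith

theorem abs_volume_arctan_goodSet_sub_le {σ : ℤ} (hσ : σ = 1 ∨ σ = -1) {l Q : ℕ} (hl : 2 ≤ l)
    (hQ : 2 ≤ Q) {M ε lam : ℝ} (hM : 1 + Real.log Q ≤ M)
    (hτ : ∀ n : ℕ, n ≠ 0 → n ≤ Q → (n.divisors.card : ℝ) ≤ M) (hε0 : 0 < ε) (hε : ε ≤ 1 / Q)
    (hε1 : 1 ≤ ε * (Q + 1)) (hlam0 : 0 < lam) (hlam1 : lam ≤ 1) {I : Set ℝ}
    (hI : I ⊆ Set.Icc 0 1) (hc : I.OrdConnected) :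
    |(volume (Real.arctan '' goodSet σ l I ε (lam * (Q : ℝ)) Q)).toReal -
        (∫ u in I, 1 / (1 + u ^ 2)) * Cconst l * (zeta2 - lam) / l| ≤
      (48 + (4 * (l + 2) + 3 * |Cconst l|)) * M ^ 7 / √Q + 2 * (1 / Q) := by
  have hX : lam * (Q : ℝ) ≤ Q := mul_le_of_le_one_left (by positivity) hlam1
  obtain ⟨s, t, hs, hst, ht, hI1, hI2⟩ := exists_Ioo_subset_of_ordConnected hI hc
  have := abs_volume_arctan_image_sub_le
    (U := arcUnion σ l ε (lam * (Q : ℝ)) Q (numRange l 0 1))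
    (S := goodSet σ l I ε (lam * (Q : ℝ)) Q) (I := I)
    (measurableSet_arcUnion hσ _) (η := 1 / (Q : ℝ)) (by positivity)
    (fun s t hs hst ht => abs_volume_arcUnion_inter_sub_le hσ (by lia) (by lia) hM hτ hε0.le
      hε hε1 hlam0.le hlam1 hs hst ht) hs hst ht hI1 hI2
    (fun u hu => ⟨mem_arcUnion.2 (goodSet_subset hσ hl hQ hε hX hu), hu.1⟩)
    (fun u hu => mem_goodSet hσ hl hQ hε0.le hε hX hs ht hI1 hu.2.1 hu.2.2
      (mem_arcUnion.1 hu.1))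
  convert this using 3
  ring

/-- `1 + log n` and the number of divisors of the integers up to `n` are `O(n ^ δ)`. -/
theorem exists_log_divisors_le_rpow {δ : ℝ} (hδ : 0 < δ) :
    ∃ C : ℝ, 1 ≤ C ∧ ∀ Q : ℕ, 1 ≤ Q → 1 + Real.log Q ≤ C * (Q : ℝ) ^ δ ∧
      ∀ n : ℕ, n ≠ 0 → n ≤ Q → (n.divisors.card : ℝ) ≤ C * (Q : ℝ) ^ δ := by
  obtain ⟨C, hC1, hC⟩ := card_divisors_le_rpow hδ
  have hδ' : 0 < 1 / δ := by positivity
  refine ⟨C + 1 / δ, by linarith, fun Q hQ => ⟨?_, fun n hn hnQ => ?_⟩⟩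
  · have h1 := Real.log_le_rpow_div (x := (Q : ℝ)) (by positivity) hδ
    have h2 : (1 : ℝ) ≤ (Q : ℝ) ^ δ :=
      Real.one_le_rpow (by exact_mod_cast hQ) hδ.le
    have h3 : (Q : ℝ) ^ δ / δ = 1 / δ * (Q : ℝ) ^ δ := by ring
    nlinarith
  · refine (hC n hn).trans ?_
    gcongr
    linarith

/-- The power saving `ε ^ (1 / 2 - δ)` for the measures of the good sets. -/
theorem exists_abs_volume_arctan_goodSet_sub_le_rpow {l : ℕ} (hl : 2 ≤ l) {δ : ℝ} (hδ : 0 < δ) :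
    ∃ C > 0, ∀ ε : ℝ, 0 < ε → ε < 1 / 2 → ∀ lam : ℝ, 0 < lam → lam ≤ 1 →
      ∀ I : Set ℝ, I ⊆ Set.Icc 0 1 → I.OrdConnected → ∀ σ : ℤ, σ = 1 ∨ σ = -1 →
      |(volume (Real.arctan '' goodSet σ l I ε (lam * (⌊1 / ε⌋₊ : ℝ)) ⌊1 / ε⌋₊)).toReal -
        (∫ u in I, 1 / (1 + u ^ 2)) * Cconst l * (zeta2 - lam) / l| ≤ C * ε ^ (1 / 2 - δ) := by
  obtain ⟨C, hC1, hC⟩ := exists_log_divisors_le_rpow (δ := δ / 7) (by positivity)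
  set A : ℝ := 48 + (4 * (l + 2) + 3 * |Cconst l|) with hA
  have hA0 : 0 < A := by positivity
  refine ⟨A * C ^ 7 * 2 + 4, by positivity, ?_⟩
  intro ε hε hε2 lam hlam0 hlam1 I hI hc σ hσ
  have hinv : 2 < 1 / ε := by rw [lt_div_iff₀ hε]; linarith
  set Q := ⌊1 / ε⌋₊ with hQdef
  have hQ : 2 ≤ Q := Nat.le_floor (by exact_mod_cast hinv.le)
  have hQle : (Q : ℝ) ≤ 1 / ε := Nat.floor_le (by positivity)
  have hQlt : 1 / ε < Q + 1 := Nat.lt_floor_add_one _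
  have hQ0 : (0 : ℝ) < Q := by positivity
  have hQ2 : (2 : ℝ) ≤ Q := by exact_mod_cast hQ
  have hε1 : 1 ≤ ε * (Q + 1) := by
    rw [div_lt_iff₀ hε] at hQlt; linarith
  have hεQ : ε ≤ 1 / Q := by
    rw [le_div_iff₀ hε] at hQle
    rw [le_div_iff₀ hQ0]; linarith
  obtain ⟨hM, hτ⟩ := hC Q (by lia)
  refine (abs_volume_arctan_goodSet_sub_le hσ hl hQ hM hτ hε hεQ hε1 hlam0 hlam1 hI hc).trans ?_
  rw [← hA]
  have hQinv : 1 / (Q : ℝ) ≤ 2 * ε := by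
    rw [div_le_iff₀ hQ0]; nlinarith
  have hpow : ((Q : ℝ) ^ (δ / 7)) ^ 7 = (Q : ℝ) ^ δ := by
    rw [← Real.rpow_natCast, ← Real.rpow_mul hQ0.le]
    congr 1; push_cast; ring
  have hQδ : (Q : ℝ) ^ δ ≤ ε ^ (-δ) := by
    rw [Real.rpow_neg hε.le, ← Real.inv_rpow hε.le, ← one_div]
    exact Real.rpow_le_rpow hQ0.le hQle hδ.le
  have hsqrt : 1 / √(Q : ℝ) ≤ 2 * ε ^ (1 / 2 : ℝ) := by
    rw [← Real.sqrt_eq_rpow, ← Real.sqrt_one, ← Real.sqrt_div zero_le_one]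
    refine Real.sqrt_le_iff.2 ⟨by positivity, ?_⟩
    rw [mul_pow, Real.sq_sqrt hε.le]
    linarith
  have hsplit : ε ^ (1 / 2 - δ) = ε ^ (-δ) * ε ^ (1 / 2 : ℝ) := by
    rw [← Real.rpow_add hε]; congr 1; ring
  have hεle : ε ≤ ε ^ (1 / 2 - δ) := by
    conv_lhs => rw [← Real.rpow_one ε]
    exact Real.rpow_le_rpow_of_exponent_ge hε (by linarith) (by linarith)
  have h1 : A * (C * (Q : ℝ) ^ (δ / 7)) ^ 7 / √(Q : ℝ) ≤ A * C ^ 7 * 2 * ε ^ (1 / 2 - δ) := by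
    rw [mul_pow, hpow, hsplit]
    calc A * (C ^ 7 * (Q : ℝ) ^ δ) / √(Q : ℝ)
        = A * C ^ 7 * ((Q : ℝ) ^ δ * (1 / √(Q : ℝ))) := by ring
      _ ≤ A * C ^ 7 * (ε ^ (-δ) * (2 * ε ^ (1 / 2 : ℝ))) := by gcongr
      _ = _ := by ring
  linarith

end PowerSaving

theorem statement12 (l : ℕ) (hl : 2 ≤ l)
    (c c₁ δ K : ℝ) (hc : c ∈ Set.Ioo (0 : ℝ) 1) (hc₁ : c₁ ∈ Set.Ioo (0 : ℝ) 1)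
    (hδ : 0 < δ) (hK : 1 ≤ K) (Λ : Set ℝ) (hΛc : IsCompact Λ) (hΛ : Λ ⊆ Set.Ioc 0 1) :
    ∃ C > 0, ∃ ε₀ > 0, ∀ ε : ℝ, 0 < ε → ε < ε₀ → ∀ lam ∈ Λ,
      ∀ I : Set ℝ, I ⊆ Set.Icc 0 1 → I.OrdConnected →
      K⁻¹ * ε ^ c ≤ (volume I).toReal → (volume I).toReal ≤ K * ε ^ c →
      |Gmeas2 l I ε lam - (∫ u in I, 1 / (1 + u ^ 2)) * Cconst l * (zeta2 - lam) / l| ≤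
        C * ε ^ (min (c + c₁) (1 / 2 - 2 * c₁) - δ) ∧
      |Gmeas3 l I ε lam - (∫ u in I, 1 / (1 + u ^ 2)) * Cconst l * (zeta2 - lam) / l| ≤
        C * ε ^ (min (c + c₁) (1 / 2 - 2 * c₁) - δ) := by
  obtain ⟨C, hC0, hC⟩ := exists_abs_volume_arctan_goodSet_sub_le_rpow hl hδ
  refine ⟨C, hC0, 1 / 2, by norm_num, ?_⟩
  intro ε hε hε2 lam hlam I hI hIc _ _
  have hexp : ε ^ (1 / 2 - δ) ≤ ε ^ (min (c + c₁) (1 / 2 - 2 * c₁) - δ) := by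
    refine Real.rpow_le_rpow_of_exponent_ge hε (by linarith) ?_
    have := min_le_right (c + c₁) (1 / 2 - 2 * c₁)
    linarith [hc₁.1]
  have hlam0 := (hΛ hlam).1
  have hbound := hC ε hε hε2 lam hlam0 (hΛ hlam).2 I hI hIc
  rw [Gmeas2_eq_goodSet hlam0.le, Gmeas3_eq_goodSet hlam0.le]
  have hmul := mul_le_mul_of_nonneg_left hexp hC0.le
  exact ⟨(hbound 1 (Or.inl rfl)).trans hmul, (hbound (-1) (Or.inr rfl)).trans hmul⟩
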